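/- For every p with 6 ≤ p ≤ ∞ there exists a constant C > 0 such that for all k ∈ ℕ and all f ∈ ℋ_k, one has ‖f‖_{L^p(S²)} ≤ C · (1+k)^{2(1/4 − 1/p)} · ‖f‖_{L²(S²)}, where for p = ∞ the left-hand side is the essential supremum of |f| on S² and the exponent is 1/2. -/

import Mathlib

open MeasureTheory Metric MvPolynomial
open scoped ENNReal

/-- The standard surface measure on the unit sphere `S² ⊆ ℝ³`. -/
noncomputable def sphereMeasure : Measure (sphere (0 : EuclideanSpace ℝ (Fin 3)) 1) :=
  (volume : Measure (EuclideanSpace ℝ (Fin 3))).toSphere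

/-- `f : S² → ℂ` belongs to `ℋ_k`, i.e. it is the restriction to the unit sphere of a
complex-valued polynomial on `ℝ³` that is homogeneous of degree `k` and harmonic. -/
def IsSphericalHarmonic (k : ℕ) (f : sphere (0 : EuclideanSpace ℝ (Fin 3)) 1 → ℂ) : Prop :=
  ∃ P : MvPolynomial (Fin 3) ℂ,
    P.IsHomogeneous k ∧
    (∑ i : Fin 3, pderiv i (pderiv i P)) = 0 ∧
    ∀ x : sphere (0 : EuclideanSpace ℝ (Fin 3)) 1,
      f x = MvPolynomial.eval (fun i => ((x : EuclideanSpace ℝ (Fin 3)) i : ℂ)) P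

local notation "ℝ³" => EuclideanSpace ℝ (Fin 3)
local notation "𝕊²" => sphere (0 : EuclideanSpace ℝ (Fin 3)) 1

/-- Sonine-type bound for solutions of Legendre's equation
`∂((1 - t²) ∂u) + l u = 0` on `[0, 1]`, written as a first order system. -/
theorem legendre_sonine_bound {l κ : ℝ} (hl : 2 ≤ l) {u w : ℝ → ℝ}
    (hu : ∀ t ∈ Set.Ioo (0 : ℝ) 1, HasDerivAt u (w t / (1 - t ^ 2)) t)
    (hw : ∀ t ∈ Set.Ioo (0 : ℝ) 1, HasDerivAt w (-(l * u t)) t)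
    (huc : ContinuousOn u (Set.Icc 0 1)) (hwc : ContinuousOn w (Set.Icc 0 1))
    (hw1 : w 1 = 0) (hκ : ∀ t ∈ Set.Icc (0 : ℝ) 1, |u t| ≤ κ) {t : ℝ}
    (ht : t ∈ Set.Icc (0 : ℝ) 1) :
    √l * (√(1 - t ^ 2) * u t ^ 2) ≤ 5 / 2 * κ ^ 2 := by
  have hκ0 : 0 ≤ κ := (abs_nonneg _).trans (hκ 1 (by norm_num))
  have hu2 : ∀ t ∈ Set.Icc (0 : ℝ) 1, u t ^ 2 ≤ κ ^ 2 := fun t ht =>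
    sq_le_sq' (by linarith [neg_abs_le (u t), hκ t ht]) ((le_abs_self _).trans (hκ t ht))
  have hN : ∀ t ∈ Set.Icc (0 : ℝ) 1,
      w t ^ 2 + l * (1 - t ^ 2) * u t ^ 2 ≤ l * κ ^ 2 * (1 - t ^ 2) := by
    have hanti : AntitoneOn (fun t => l * κ ^ 2 * (1 - t ^ 2) -
        (w t ^ 2 + l * (1 - t ^ 2) * u t ^ 2)) (Set.Icc 0 1) := by
      have hd : ∀ t ∈ Set.Ioo (0 : ℝ) 1, HasDerivAt (fun t => l * κ ^ 2 * (1 - t ^ 2) -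
          (w t ^ 2 + l * (1 - t ^ 2) * u t ^ 2)) (-(2 * l * t * (κ ^ 2 - u t ^ 2))) t := by
        intro t ht
        have hp : 1 - t ^ 2 ≠ 0 := by nlinarith [ht.1, ht.2]
        have h1 : HasDerivAt (fun t : ℝ => 1 - t ^ 2) (-(2 * t)) t := by
          simpa using ((hasDerivAt_pow 2 t).const_sub 1)
        have := ((h1.const_mul (l * κ ^ 2)).sub (((hw t ht).pow 2).add
          ((h1.const_mul l).mul ((hu t ht).pow 2))))
        refine this.congr_deriv ?_
        simp only [Pi.pow_apply]
        field_simp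
        ring
      refine antitoneOn_of_deriv_nonpos (convex_Icc 0 1) (by fun_prop) ?_ ?_
      · rw [interior_Icc]
        exact fun t ht => (hd t ht).differentiableAt.differentiableWithinAt
      · rw [interior_Icc]
        intro t ht
        rw [(hd t ht).deriv]
        have := hu2 t ⟨ht.1.le, ht.2.le⟩
        have : 0 ≤ l * t * (κ ^ 2 - u t ^ 2) :=
          mul_nonneg (mul_nonneg (by linarith) ht.1.le) (by linarith)
        linarith
    intro t ht
    have := hanti ht (Set.right_mem_Icc.2 zero_le_one) ht.2
    simp only [hw1] at this
    norm_num at this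
    linarith
  set t₀ := √(1 - 1 / l) with ht₀
  have hl0 : 0 < l := by linarith
  have hinv : 1 / l ≤ 1 := by rw [div_le_one hl0]; linarith
  have hinv0 : 0 < 1 / l := by positivity
  have ht₀sq : t₀ ^ 2 = 1 - 1 / l := Real.sq_sqrt (by linarith)
  have ht₀0 : 0 ≤ t₀ := Real.sqrt_nonneg _
  have ht₀1 : t₀ < 1 := by nlinarith
  have hsl : 0 < √l := Real.sqrt_pos.2 hl0
  rcases le_total t t₀ with h | h
  · have hmono : MonotoneOn (fun t => (w t ^ 2 + l * (1 - t ^ 2) * u t ^ 2 - t * u t * w t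
        + u t ^ 2 / 2) / √(1 - t ^ 2)) (Set.Icc 0 t₀) := by
      have hd : ∀ t ∈ Set.Ioo (0 : ℝ) t₀, HasDerivAt
          (fun t => (w t ^ 2 + l * (1 - t ^ 2) * u t ^ 2 - t * u t * w t
            + u t ^ 2 / 2) / √(1 - t ^ 2))
          (t * u t ^ 2 / (2 * (1 - t ^ 2) * √(1 - t ^ 2))) t := by
        intro t ht
        have ht' : t ∈ Set.Ioo (0 : ℝ) 1 := ⟨ht.1, ht.2.trans ht₀1⟩
        have hp : 0 < 1 - t ^ 2 := by nlinarith [ht'.1, ht'.2]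
        have h1 : HasDerivAt (fun t : ℝ => 1 - t ^ 2) (-(2 * t)) t := by
          simpa using ((hasDerivAt_pow 2 t).const_sub 1)
        have h2 := (((((hw t ht').pow 2).add
          ((h1.const_mul l).mul ((hu t ht').pow 2))).sub
          (((hasDerivAt_id t).mul (hu t ht')).mul (hw t ht'))).add
          (((hu t ht').pow 2).div_const 2)).div (h1.sqrt hp.ne') (Real.sqrt_pos.2 hp).ne'
        have hs := Real.sq_sqrt hp.le
        have hsp := Real.sqrt_pos.2 hp
        refine h2.congr_deriv ?_
        simp only [Pi.add_apply, Pi.sub_apply, Pi.mul_apply, Pi.pow_apply, id]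
        symm
        generalize √(1 - t ^ 2) = s at *
        rw [← hs]
        have : s ≠ 0 := hsp.ne'
        have ht2 : t ^ 2 = 1 - s ^ 2 := by linarith
        field_simp
        ring_nf
        simp only [ht2]
        ring
      refine monotoneOn_of_deriv_nonneg (convex_Icc 0 t₀) ?_ ?_ ?_
      · have hsub : Set.Icc 0 t₀ ⊆ Set.Icc 0 1 := Set.Icc_subset_Icc_right ht₀1.le
        have h1 := huc.mono hsub
        have h2 := hwc.mono hsub
        refine ContinuousOn.div (by fun_prop) (by fun_prop) ?_
        intro t ht
        exact (Real.sqrt_pos.2 (by nlinarith [ht.1, ht.2])).ne'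
      · rw [interior_Icc]
        exact fun t ht => (hd t ht).differentiableAt.differentiableWithinAt
      · rw [interior_Icc]
        intro t ht
        rw [(hd t ht).deriv]
        have hp : 0 < 1 - t ^ 2 := by nlinarith [ht.1, ht.2]
        have := ht.1.le
        positivity
    have h1 := hmono ⟨ht.1, h⟩ (Set.right_mem_Icc.2 ht₀0) h
    have hp : 0 < 1 - t ^ 2 := by nlinarith [ht.1, h]
    have hs := Real.sq_sqrt hp.le
    have hsp := Real.sqrt_pos.2 hp
    have hp0 : √(1 - t₀ ^ 2) = 1 / √l := by
      rw [ht₀sq]; simp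
    simp only [hp0] at h1
    have hN0 := hN t₀ ⟨ht₀0, ht₀1.le⟩
    have hu0 := hu2 t₀ ⟨ht₀0, ht₀1.le⟩
    have e1 : 1 - t₀ ^ 2 = 1 / l := by rw [ht₀sq]; ring
    rw [e1] at h1 hN0
    have e2 : l * κ ^ 2 * (1 / l) = κ ^ 2 := by field_simp
    have e3 : l * (1 / l) = 1 := by field_simp
    rw [e2, e3] at hN0
    rw [e3] at h1
    have hX0 : w t₀ ^ 2 + 1 * u t₀ ^ 2 - t₀ * u t₀ * w t₀ + u t₀ ^ 2 / 2 ≤ 5 / 2 * κ ^ 2 := by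
      nlinarith [sq_nonneg (t₀ * u t₀ + w t₀), mul_nonneg (sub_nonneg.2 ht₀1.le) (sq_nonneg (u t₀)),
        mul_nonneg ht₀0 (mul_nonneg (sub_nonneg.2 ht₀1.le) (sq_nonneg (u t₀)))]
    have hX : l * (1 - t ^ 2) * u t ^ 2 ≤ w t ^ 2 + l * (1 - t ^ 2) * u t ^ 2 - t * u t * w t
        + u t ^ 2 / 2 := by
      nlinarith [sq_nonneg (w t - t * u t / 2), mul_nonneg hp.le (sq_nonneg (u t)), sq_nonneg (u t)]
    have h2 : l * (1 - t ^ 2) * u t ^ 2 / √(1 - t ^ 2) ≤ 5 / 2 * κ ^ 2 / (1 / √l) :=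
      (div_le_div_of_nonneg_right hX hsp.le).trans
        (h1.trans (div_le_div_of_nonneg_right hX0 (by positivity)))
    have hl' := Real.sq_sqrt hl0.le
    have e4 : l * (1 - t ^ 2) * u t ^ 2 / √(1 - t ^ 2)
        = √l * (√l * (√(1 - t ^ 2) * u t ^ 2)) := by
      rw [div_eq_iff hsp.ne']
      nth_rewrite 1 [← hs, ← hl']
      ring
    have e5 : 5 / 2 * κ ^ 2 / (1 / √l) = √l * (5 / 2 * κ ^ 2) := by field_simp
    rw [e4, e5] at h2
    exact le_of_mul_le_mul_left h2 hsl
  · have hp : √(1 - t ^ 2) ≤ 1 / √l := by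
      rw [show 1 / √l = √(1 / l) by simp]
      apply Real.sqrt_le_sqrt
      nlinarith
    have : √l * √(1 - t ^ 2) ≤ 1 := by
      calc √l * √(1 - t ^ 2) ≤ √l * (1 / √l) := by gcongr
        _ = 1 := by field_simp
    calc √l * (√(1 - t ^ 2) * u t ^ 2) = (√l * √(1 - t ^ 2)) * u t ^ 2 := by ring
      _ ≤ 1 * κ ^ 2 := by exact mul_le_mul this (hu2 t ht) (sq_nonneg _) zero_le_one
      _ ≤ 5 / 2 * κ ^ 2 := by nlinarith [sq_nonneg κ]

/-- Solutions of the associated Legendre equation `∂((1 - t²) ∂u) + (l - μ / (1 - t²)) u = 0`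
are bounded by their `L²` norm away from the turning points. -/
theorem assocLegendre_sup_le {l μ : ℝ} (hl : 420 ≤ l) (hμ0 : 0 ≤ μ) (hμ : μ ≤ 65 / 100 * l)
    {u w : ℝ → ℝ}
    (hu : ∀ t ∈ Set.Icc (-1 / 2 : ℝ) (1 / 2), HasDerivAt u (w t / (1 - t ^ 2)) t)
    (hw : ∀ t ∈ Set.Icc (-1 / 2 : ℝ) (1 / 2),
      HasDerivAt w (-((l - μ / (1 - t ^ 2)) * u t)) t) {t : ℝ}
    (ht : t ∈ Set.Icc (-1 / 2 : ℝ) (1 / 2)) :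
    u t ^ 2 ≤ 90 * ∫ s in (0 : ℝ)..(1 / 2), u s ^ 2 := by
  have hpos : ∀ t ∈ Set.Icc (-1 / 2 : ℝ) (1 / 2), 3 / 4 ≤ 1 - t ^ 2 := fun t ht => by
    nlinarith [ht.1, ht.2]
  have huc : ContinuousOn u (Set.Icc (-1 / 2) (1 / 2)) := fun t ht =>
    (hu t ht).continuousAt.continuousWithinAt
  have hwc : ContinuousOn w (Set.Icc (-1 / 2) (1 / 2)) := fun t ht =>
    (hw t ht).continuousAt.continuousWithinAt
  set N : ℝ → ℝ := fun t => w t ^ 2 + (l * (1 - t ^ 2) - μ) * u t ^ 2 with hNdef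
  have hNd : ∀ t ∈ Set.Icc (-1 / 2 : ℝ) (1 / 2), HasDerivAt N (-(2 * l * t * u t ^ 2)) t := by
    intro t ht
    have hp : 1 - t ^ 2 ≠ 0 := by linarith [hpos t ht]
    have h1 : HasDerivAt (fun t : ℝ => 1 - t ^ 2) (-(2 * t)) t := by
      simpa using ((hasDerivAt_pow 2 t).const_sub 1)
    have := ((hw t ht).pow 2).add (((h1.const_mul l).sub_const μ).mul ((hu t ht).pow 2))
    refine this.congr_deriv ?_
    simp only [Pi.pow_apply]
    field_simp
    ring
  have hNc : ContinuousOn N (Set.Icc (-1 / 2) (1 / 2)) := fun t ht =>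
    (hNd t ht).continuousAt.continuousWithinAt
  have hlow : ∀ t ∈ Set.Icc (-1 / 2 : ℝ) (1 / 2), w t ^ 2 + l / 10 * u t ^ 2 ≤ N t := by
    intro t ht
    have : l / 10 ≤ l * (1 - t ^ 2) - μ := by nlinarith [hpos t ht]
    simp only [hNdef]
    gcongr
  have hN0 : ∀ t ∈ Set.Icc (-1 / 2 : ℝ) (1 / 2), N t ≤ N 0 := by
    intro t ht
    rcases le_total t 0 with h | h
    · have hm : MonotoneOn N (Set.Icc (-1 / 2) 0) := by
        refine monotoneOn_of_deriv_nonneg (convex_Icc _ _)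
          (hNc.mono (Set.Icc_subset_Icc_right (by norm_num))) ?_ ?_
        all_goals rw [interior_Icc]
        · exact fun s hs =>
            (hNd s ⟨hs.1.le, by linarith [hs.2]⟩).differentiableAt.differentiableWithinAt
        · intro s hs
          rw [(hNd s ⟨hs.1.le, by linarith [hs.2]⟩).deriv]
          have : 0 ≤ l * (-s) * u s ^ 2 :=
            mul_nonneg (mul_nonneg (by linarith) (by linarith [hs.2])) (sq_nonneg _)
          linarith
      exact hm ⟨ht.1, h⟩ ⟨by norm_num, le_rfl⟩ h
    · have hm : AntitoneOn N (Set.Icc 0 (1 / 2)) := by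
        refine antitoneOn_of_deriv_nonpos (convex_Icc _ _)
          (hNc.mono (Set.Icc_subset_Icc_left (by norm_num))) ?_ ?_
        all_goals rw [interior_Icc]
        · exact fun s hs =>
            (hNd s ⟨by linarith [hs.1], hs.2.le⟩).differentiableAt.differentiableWithinAt
        · intro s hs
          rw [(hNd s ⟨by linarith [hs.1], hs.2.le⟩).deriv]
          have : 0 ≤ l * s * u s ^ 2 :=
            mul_nonneg (mul_nonneg (by linarith) hs.1.le) (sq_nonneg _)
          linarith
      exact hm ⟨le_rfl, by norm_num⟩ ⟨h, ht.2⟩ h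
  have huw : ∀ t ∈ Set.Icc (-1 / 2 : ℝ) (1 / 2), |u t * w t| ≤ N t / 12 := by
    intro t ht
    have h1 := hlow t ht
    have h2 : w t ^ 2 + 36 * u t ^ 2 ≤ N t := by nlinarith [sq_nonneg (u t)]
    rw [abs_le]
    constructor <;> nlinarith [sq_nonneg (w t - 6 * u t), sq_nonneg (w t + 6 * u t)]
  have hsub : Set.Icc (0 : ℝ) (1 / 2) ⊆ Set.Icc (-1 / 2) (1 / 2) :=
    Set.Icc_subset_Icc_left (by norm_num)
  have hu2c : ContinuousOn (fun s => u s ^ 2) (Set.Icc 0 (1 / 2)) := (huc.mono hsub).pow 2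
  have hintg : IntervalIntegrable (fun s => u s ^ 2) volume 0 (1 / 2) :=
    ContinuousOn.intervalIntegrable (by rwa [Set.uIcc_of_le (by norm_num)])
  have hkey : N 0 / 2 + u 0 * w 0 ≤ u (1 / 2) * w (1 / 2)
      + 3 * l * ∫ s in (0 : ℝ)..(1 / 2), u s ^ 2 := by
    set Ψ : ℝ → ℝ := fun t => (1 / 2 - t) * N t + u t * w t with hΨ
    have hΨd : ∀ t ∈ Set.Icc (0 : ℝ) (1 / 2), HasDerivAt Ψ
        (-N t - (1 / 2 - t) * (2 * l * t * u t ^ 2) +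
          (w t ^ 2 / (1 - t ^ 2) - (l - μ / (1 - t ^ 2)) * u t ^ 2)) t := by
      intro t ht
      have := ((((hasDerivAt_id t).const_sub (1 / 2)).mul (hNd t (hsub ht))).add
        ((hu t (hsub ht)).mul (hw t (hsub ht))))
      refine this.congr_deriv ?_
      simp only [id_eq]
      ring
    have hle : ∀ t ∈ Set.Icc (0 : ℝ) (1 / 2), -(3 * l * u t ^ 2) ≤
        (-N t - (1 / 2 - t) * (2 * l * t * u t ^ 2) +
          (w t ^ 2 / (1 - t ^ 2) - (l - μ / (1 - t ^ 2)) * u t ^ 2)) := by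
      intro t ht
      have hp := hpos t (hsub ht)
      have hp0 : 0 < 1 - t ^ 2 := by linarith
      have h1 : w t ^ 2 ≤ w t ^ 2 / (1 - t ^ 2) := by
        rw [le_div_iff₀ hp0]; nlinarith [sq_nonneg (w t), sq_nonneg t]
      have h2 : 0 ≤ μ / (1 - t ^ 2) * u t ^ 2 := by positivity
      have h3 : 0 ≤ μ * u t ^ 2 := by positivity
      have h4 : 0 ≤ l * u t ^ 2 := mul_nonneg (by linarith) (sq_nonneg _)
      have h5 : (1 / 2 - t) * (2 * t) ≤ 1 := by nlinarith [sq_nonneg t, ht.1, ht.2]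
      simp only [hNdef]
      nlinarith [mul_nonneg (sub_nonneg.2 h5) h4, mul_nonneg (sq_nonneg t) h4]
    have h1 := intervalIntegral.integral_eq_sub_of_hasDerivAt (a := 0) (b := 1 / 2) (f := Ψ)
      (fun t ht => hΨd t (by rwa [Set.uIcc_of_le (by norm_num)] at ht)) (by
        apply ContinuousOn.intervalIntegrable
        rw [Set.uIcc_of_le (by norm_num)]
        have hN' := hNc.mono hsub
        have hu' := huc.mono hsub
        have hw' := hwc.mono hsub
        have hp : ContinuousOn (fun t : ℝ => (1 - t ^ 2)⁻¹) (Set.Icc 0 (1 / 2)) :=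
          ContinuousOn.inv₀ (by fun_prop) fun t ht => by linarith [hpos t (hsub ht)]
        simp only [div_eq_mul_inv] at hN' hu' hw' hp ⊢
        fun_prop)
    have h2 := intervalIntegral.integral_mono_on (a := (0 : ℝ)) (b := 1 / 2) (by norm_num)
      ((hintg.const_mul (3 * l)).neg) (g := fun t => (-N t - (1 / 2 - t) * (2 * l * t * u t ^ 2) +
          (w t ^ 2 / (1 - t ^ 2) - (l - μ / (1 - t ^ 2)) * u t ^ 2))) (by
        apply ContinuousOn.intervalIntegrable
        rw [Set.uIcc_of_le (by norm_num)]
        have hN' := hNc.mono hsub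
        have hu' := huc.mono hsub
        have hw' := hwc.mono hsub
        have hp : ContinuousOn (fun t : ℝ => (1 - t ^ 2)⁻¹) (Set.Icc 0 (1 / 2)) :=
          ContinuousOn.inv₀ (by fun_prop) fun t ht => by linarith [hpos t (hsub ht)]
        simp only [div_eq_mul_inv] at hN' hu' hw' hp ⊢
        fun_prop) (fun t ht => hle t ht)
    rw [h1] at h2
    simp only [Pi.neg_apply, intervalIntegral.integral_neg,
      intervalIntegral.integral_const_mul] at h2
    simp only [hΨ] at h2
    norm_num at h2 ⊢
    linarith
  have m0 : (0 : ℝ) ∈ Set.Icc (-1 / 2 : ℝ) (1 / 2) := by norm_num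
  have m1 : (1 / 2 : ℝ) ∈ Set.Icc (-1 / 2 : ℝ) (1 / 2) := by norm_num
  have a0 := (abs_le.1 (huw 0 m0)).1
  have a1 := (abs_le.1 (huw _ m1)).2
  have a2 := hN0 _ m1
  have a3 := hN0 t ht
  have a4 := hlow t ht
  have a5 : l * u t ^ 2 ≤ l * (90 * ∫ s in (0 : ℝ)..(1 / 2), u s ^ 2) := by
    nlinarith [sq_nonneg (w t)]
  exact le_of_mul_le_mul_left a5 (by linarith)

theorem lintegral_comp_abs_eq (g : ℝ → ℝ≥0∞) :
    ∫⁻ s, g |s| = 2 * ∫⁻ s in Set.Ioi (0 : ℝ), g s := by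
  rw [← lintegral_add_compl _ (measurableSet_Ioi (a := (0 : ℝ))), two_mul]
  congr 1
  · exact setLIntegral_congr_fun measurableSet_Ioi fun s hs => by
      rw [abs_of_pos hs]
  · rw [Set.compl_Ioi, setLIntegral_congr (Iio_ae_eq_Iic (a := (0 : ℝ))).symm,
      ← lintegral_indicator measurableSet_Iio, ← lintegral_indicator measurableSet_Ioi,
      ← lintegral_neg_eq_self (μ := volume)]
    congr 1
    ext s
    by_cases hs : 0 < s
    · simp [Set.indicator, hs, abs_of_pos hs]
    · simp [Set.indicator, hs]

theorem lintegral_near_rpow {r : ℝ} (hr : 0 < r) (a : ℝ) :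
    ∫⁻ s, Set.indicator {s : ℝ | |s| < r} (fun s => ENNReal.ofReal |s| ^ (-(1 / 2) : ℝ)) (s - a)
      = 4 * ENNReal.ofReal r ^ (1 / 2 : ℝ) := by
  rw [lintegral_sub_right_eq_self
    (fun s => Set.indicator {s : ℝ | |s| < r} (fun s => ENNReal.ofReal |s| ^ (-(1 / 2) : ℝ)) s) a]
  have h1 : ∀ s : ℝ, Set.indicator {s : ℝ | |s| < r}
      (fun s => ENNReal.ofReal |s| ^ (-(1 / 2) : ℝ)) s
      = (Set.Iio r).indicator (fun s => ENNReal.ofReal s ^ (-(1 / 2) : ℝ)) |s| := fun s => by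
    simp [Set.indicator]
  simp_rw [h1]
  rw [lintegral_comp_abs_eq, setLIntegral_indicator measurableSet_Iio, Set.inter_comm,
    Set.Ioi_inter_Iio]
  have h2 : ∫⁻ s in Set.Ioo 0 r, ENNReal.ofReal s ^ (-(1 / 2) : ℝ)
      = ∫⁻ s in Set.Ioo 0 r, ENNReal.ofReal (s ^ (-(1 / 2) : ℝ)) :=
    setLIntegral_congr_fun measurableSet_Ioo fun s hs => by
      rw [ENNReal.ofReal_rpow_of_pos hs.1]
  rw [h2, ← ofReal_integral_eq_lintegral_ofReal
    ((intervalIntegral.integrableOn_Ioo_rpow_iff hr).2 (by norm_num))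
    ((ae_restrict_iff' measurableSet_Ioo).2 (ae_of_all _ fun s hs => Real.rpow_nonneg hs.1.le _)),
    ← integral_Ioc_eq_integral_Ioo, ← intervalIntegral.integral_of_le hr.le,
    integral_rpow (by norm_num), ENNReal.ofReal_rpow_of_pos hr,
    show (2 : ℝ≥0∞) = ENNReal.ofReal 2 by simp, show (4 : ℝ≥0∞) = ENNReal.ofReal 4 by simp,
    ← ENNReal.ofReal_mul (by norm_num), ← ENNReal.ofReal_mul (by norm_num)]
  congr 1
  norm_num
  ring

theorem lintegral_far_rpow {r : ℝ} (hr : 0 < r) (a : ℝ) :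
    ∫⁻ s, Set.indicator {s : ℝ | r < |s|} (fun s => ENNReal.ofReal |s| ^ (-2 : ℝ)) (s - a)
      = 2 * ENNReal.ofReal r ^ (-1 : ℝ) := by
  rw [lintegral_sub_right_eq_self
    (fun s => Set.indicator {s : ℝ | r < |s|} (fun s => ENNReal.ofReal |s| ^ (-2 : ℝ)) s) a]
  have h1 : ∀ s : ℝ, Set.indicator {s : ℝ | r < |s|}
      (fun s => ENNReal.ofReal |s| ^ (-2 : ℝ)) s
      = (Set.Ioi r).indicator (fun s => ENNReal.ofReal s ^ (-2 : ℝ)) |s| := fun s => by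
    simp [Set.indicator]
  simp_rw [h1]
  rw [lintegral_comp_abs_eq, setLIntegral_indicator measurableSet_Ioi, Set.Ioi_inter_Ioi,
    max_eq_left hr.le]
  have h2 : ∫⁻ s in Set.Ioi r, ENNReal.ofReal s ^ (-2 : ℝ)
      = ∫⁻ s in Set.Ioi r, ENNReal.ofReal (s ^ (-2 : ℝ)) :=
    setLIntegral_congr_fun measurableSet_Ioi fun s hs => by
      rw [ENNReal.ofReal_rpow_of_pos (hr.trans hs)]
  rw [h2, ← ofReal_integral_eq_lintegral_ofReal
    (integrableOn_Ioi_rpow_of_lt (by norm_num) hr)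
    ((ae_restrict_iff' measurableSet_Ioi).2
      (ae_of_all _ fun s hs => Real.rpow_nonneg (hr.trans hs).le _)),
    integral_Ioi_rpow_of_lt (by norm_num) hr, ENNReal.ofReal_rpow_of_pos hr]
  norm_num

section HardyLittlewoodSobolev

variable {X : Type*} [MeasurableSpace X] {μ : Measure X} {τ : X → ℝ} {C : ℝ≥0∞}

theorem lintegral_comp_le_of_map_le (hτ : Measurable τ) (hC : μ.map τ ≤ C • volume)
    {g : ℝ → ℝ≥0∞} (hg : Measurable g) : ∫⁻ y, g (τ y) ∂μ ≤ C * ∫⁻ s, g s := by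
  rw [← lintegral_map hg hτ, ← smul_eq_mul, ← lintegral_smul_measure]
  exact lintegral_mono' hC le_rfl

/-- The inner integral in the diagonal Hardy–Littlewood–Sobolev inequality, restricted to the
set where `J` does not exceed its value at the base point. -/
theorem hls_inner_le (hτ : Measurable τ) (hC : μ.map τ ≤ C • volume)
    {J : X → ℝ≥0∞} (hJ : Measurable J) (hJtop : ∀ x, J x ≠ ∞) (hI : ∫⁻ x, J x ∂μ ≠ ∞) (x : X) :
    ∫⁻ y, {y | J y ≤ J x}.indicator
      (fun y => J y ^ (3 / 4 : ℝ) * ENNReal.ofReal |τ x - τ y| ^ (-(1 / 2) : ℝ)) y ∂μ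
    ≤ (4 * C + (2 * C) ^ (1 / 4 : ℝ)) * (J x ^ (1 / 4 : ℝ) * (∫⁻ x, J x ∂μ) ^ (1 / 2 : ℝ)) := by
  by_cases hI0 : ∫⁻ x, J x ∂μ = 0
  · have h0 := (lintegral_eq_zero_iff hJ).1 hI0
    refine le_of_eq_of_le ((lintegral_congr_ae ?_).trans lintegral_zero) zero_le
    filter_upwards [h0] with y hy
    have hy : J y = 0 := hy
    simp [Set.indicator, hy]
  by_cases hx0 : J x = 0
  · refine le_of_eq_of_le ((lintegral_congr fun y => ?_).trans lintegral_zero) zero_le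
    by_cases hy : J y ≤ J x
    · have hy0 : J y = 0 := by simpa [hx0] using hy
      simp [Set.indicator, hy0]
    · simp [Set.indicator, hy]
  set I := ∫⁻ x, J x ∂μ with hIdef
  set r := (I / J x).toReal with hr
  have hq0 : I / J x ≠ 0 := ENNReal.div_ne_zero.2 ⟨hI0, hJtop x⟩
  have hqt : I / J x ≠ ∞ := (ENNReal.div_lt_top hI hx0).ne
  have hrpos : 0 < r := ENNReal.toReal_pos hq0 hqt
  have hrr : ENNReal.ofReal r = I / J x := ENNReal.ofReal_toReal hqt
  set k : ℝ → ℝ≥0∞ := fun s => ENNReal.ofReal |s| ^ (-(1 / 2) : ℝ) with hk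
  have hkm : Measurable k := by fun_prop
  have hms1 : MeasurableSet {s : ℝ | |s| < r} := measurableSet_lt (by fun_prop) (by fun_prop)
  have hms2 : MeasurableSet {s : ℝ | r < |s|} := measurableSet_lt (by fun_prop) (by fun_prop)
  have hms3 : MeasurableSet {s : ℝ | r ≤ |s|} := measurableSet_le (by fun_prop) (by fun_prop)
  have hsplit : ∀ y, {y | J y ≤ J x}.indicator
      (fun y => J y ^ (3 / 4 : ℝ) * ENNReal.ofReal |τ x - τ y| ^ (-(1 / 2) : ℝ)) y ≤
      J x ^ (3 / 4 : ℝ) * {s : ℝ | |s| < r}.indicator k (τ y - τ x)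
        + J y ^ (3 / 4 : ℝ) * {s : ℝ | r ≤ |s|}.indicator k (τ y - τ x) := by
    intro y
    by_cases hy : J y ≤ J x
    · by_cases hs : |τ y - τ x| < r
      · simp only [Set.indicator, Set.mem_ofPred_eq, hy, hs, if_true, hk, abs_sub_comm (τ x)]
        exact le_add_right (by gcongr)
      · simp only [Set.indicator, Set.mem_ofPred_eq, hy, if_true, hk, abs_sub_comm (τ x),
          not_lt.1 hs]
        exact le_add_self
    · simp [Set.indicator, hy]
  refine (lintegral_mono hsplit).trans ?_
  have hm1 : Measurable fun y => {s : ℝ | |s| < r}.indicator k (τ y - τ x) :=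
    (hkm.indicator hms1).comp (hτ.sub_const _)
  rw [lintegral_add_left (hm1.const_mul _), lintegral_const_mul _ hm1, add_mul]
  have hfin : J x ^ (3 / 4 : ℝ) * (I / J x) ^ (1 / 2 : ℝ) =
      J x ^ (1 / 4 : ℝ) * I ^ (1 / 2 : ℝ) := by
    rw [ENNReal.div_rpow_of_nonneg _ _ (by norm_num), ← mul_div_assoc, mul_comm, mul_div_assoc,
      ← ENNReal.rpow_sub _ _ hx0 (hJtop x), mul_comm]
    norm_num
  have hfin2 : I ^ (3 / 4 : ℝ) * ((I / J x) ^ (-1 : ℝ)) ^ (1 / 4 : ℝ)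
      = J x ^ (1 / 4 : ℝ) * I ^ (1 / 2 : ℝ) := by
    rw [ENNReal.rpow_neg_one, ENNReal.inv_div (Or.inl (hJtop x)) (Or.inl hx0),
      ENNReal.div_rpow_of_nonneg _ _ (by norm_num), ← mul_div_assoc, mul_comm, mul_div_assoc,
      ← ENNReal.rpow_sub _ _ hI0 hI]
    norm_num
  refine add_le_add ?_ ?_
  · have h1 := lintegral_comp_le_of_map_le hτ hC
      (g := fun s => {s : ℝ | |s| < r}.indicator k (s - τ x))
      ((hkm.indicator hms1).comp (measurable_id.sub_const _))
    rw [lintegral_near_rpow hrpos, hrr] at h1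
    calc _ ≤ J x ^ (3 / 4 : ℝ) * (C * (4 * (I / J x) ^ (1 / 2 : ℝ))) := by gcongr
      _ = 4 * C * (J x ^ (3 / 4 : ℝ) * (I / J x) ^ (1 / 2 : ℝ)) := by ring
      _ ≤ _ := by rw [hfin]
  · have h1 := ENNReal.lintegral_mul_le_Lp_mul_Lq μ (p := 4 / 3) (q := 4)
      ⟨by norm_num, by norm_num, by norm_num⟩
      (f := fun y => J y ^ (3 / 4 : ℝ)) (g := fun y => {s : ℝ | r ≤ |s|}.indicator k (τ y - τ x))
      (by fun_prop) ((hkm.indicator hms3).comp (hτ.sub_const _)).aemeasurable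
    refine h1.trans ?_
    have e1 : ∀ y, (J y ^ (3 / 4 : ℝ)) ^ (4 / 3 : ℝ) = J y := fun y => by
      rw [← ENNReal.rpow_mul]; norm_num
    have e2 : ∀ s, ({s : ℝ | r ≤ |s|}.indicator k s) ^ (4 : ℝ)
        = {s : ℝ | r ≤ |s|}.indicator (fun s => ENNReal.ofReal |s| ^ (-2 : ℝ)) s := fun s => by
      by_cases hs : r ≤ |s|
      · simp only [Set.indicator, Set.mem_ofPred_eq, hs, if_true, hk]
        rw [← ENNReal.rpow_mul]; norm_num
      · simp [Set.indicator, hs]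
    simp only [e1, e2]
    have h2 := lintegral_comp_le_of_map_le hτ hC
      (g := fun s => {s : ℝ | r ≤ |s|}.indicator (fun s => ENNReal.ofReal |s| ^ (-2 : ℝ)) (s - τ x))
      (by
        refine Measurable.comp (g := {s : ℝ | r ≤ |s|}.indicator
          (fun s => ENNReal.ofReal |s| ^ (-2 : ℝ))) (Measurable.indicator (by fun_prop) hms3)
          (measurable_id.sub_const _))
    have h3 : ∫⁻ s, {s : ℝ | r ≤ |s|}.indicator (fun s => ENNReal.ofReal |s| ^ (-2 : ℝ)) (s - τ x)
        = ∫⁻ s, {s : ℝ | r < |s|}.indicator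
          (fun s => ENNReal.ofReal |s| ^ (-2 : ℝ)) (s - τ x) := by
      refine lintegral_congr_ae ?_
      have : ∀ᵐ s : ℝ, s ∉ ({τ x + r, τ x - r} : Set ℝ) :=
        measure_eq_zero_iff_ae_notMem.1 ((Set.toFinite _).measure_zero _)
      filter_upwards [this] with s hs
      have : |s - τ x| ≠ r := by
        intro h
        apply hs
        rcases (abs_eq hrpos.le).1 h with h | h
        · left; linarith
        · right; simp; linarith
      by_cases h : r ≤ |s - τ x|
      · simp [Set.indicator, h, lt_of_le_of_ne h this.symm]
      · simp [Set.indicator, h, show ¬ r < |s - τ x| from fun h' => h h'.le]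
    rw [h3, lintegral_far_rpow hrpos, hrr] at h2
    calc _ ≤ I ^ (3 / 4 : ℝ) * (C * (2 * (I / J x) ^ (-1 : ℝ))) ^ (1 / 4 : ℝ) := by
          refine mul_le_mul' (by norm_num; rfl) ?_
          gcongr
      _ = (2 * C) ^ (1 / 4 : ℝ) * (I ^ (3 / 4 : ℝ) * ((I / J x) ^ (-1 : ℝ)) ^ (1 / 4 : ℝ)) := by
          rw [← mul_assoc, mul_comm C 2, ENNReal.mul_rpow_of_nonneg _ _ (by norm_num)]
          ring
      _ ≤ _ := by rw [hfin2]

/-- Diagonal Hardy–Littlewood–Sobolev inequality with kernel `|τ x - τ y|^{-1/2}`. -/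
theorem hls_diagonal [SFinite μ] (hτ : Measurable τ) (hC : μ.map τ ≤ C • volume)
    {J : X → ℝ≥0∞} (hJ : Measurable J) (hJtop : ∀ x, J x ≠ ∞) (hI : ∫⁻ x, J x ∂μ ≠ ∞) :
    ∫⁻ x, ∫⁻ y, J x ^ (3 / 4 : ℝ) * J y ^ (3 / 4 : ℝ) *
      ENNReal.ofReal |τ x - τ y| ^ (-(1 / 2) : ℝ) ∂μ ∂μ
    ≤ 2 * (4 * C + (2 * C) ^ (1 / 4 : ℝ)) * (∫⁻ x, J x ∂μ) ^ (3 / 2 : ℝ) := by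
  set A := 4 * C + (2 * C) ^ (1 / 4 : ℝ)
  set I := ∫⁻ x, J x ∂μ with hIdef
  set h : X → X → ℝ≥0∞ := fun x y => {y | J y ≤ J x}.indicator
      (fun y => J y ^ (3 / 4 : ℝ) * ENNReal.ofReal |τ x - τ y| ^ (-(1 / 2) : ℝ)) y with hh
  have hmeas : Measurable (fun p : X × X => J p.1 ^ (3 / 4 : ℝ) * h p.1 p.2) := by
    have : (fun p : X × X => h p.1 p.2) = {p : X × X | J p.2 ≤ J p.1}.indicator
        (fun p => J p.2 ^ (3 / 4 : ℝ) * ENNReal.ofReal |τ p.1 - τ p.2| ^ (-(1 / 2) : ℝ)) := by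
      ext p; simp [hh, Set.indicator]
    refine Measurable.mul (by fun_prop) ?_
    rw [this]
    exact Measurable.indicator (by fun_prop) (measurableSet_le (by fun_prop) (by fun_prop))
  have hone : ∫⁻ x, ∫⁻ y, J x ^ (3 / 4 : ℝ) * h x y ∂μ ∂μ ≤ A * I ^ (3 / 2 : ℝ) := by
    have : ∀ x, ∫⁻ y, J x ^ (3 / 4 : ℝ) * h x y ∂μ ≤ A * I ^ (1 / 2 : ℝ) * J x := by
      intro x
      have hm : Measurable (h x) := by
        refine Measurable.indicator (by fun_prop) (measurableSet_le hJ measurable_const)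
      rw [lintegral_const_mul _ hm]
      calc _ ≤ J x ^ (3 / 4 : ℝ) * (A * (J x ^ (1 / 4 : ℝ) * I ^ (1 / 2 : ℝ))) := by
            gcongr
            exact hls_inner_le hτ hC hJ hJtop hI x
        _ = A * I ^ (1 / 2 : ℝ) * (J x ^ (3 / 4 : ℝ) * J x ^ (1 / 4 : ℝ)) := by ring
        _ = _ := by
            rw [← ENNReal.rpow_add_of_nonneg _ _ (by norm_num) (by norm_num)]
            norm_num
    refine (lintegral_mono this).trans ?_
    rw [lintegral_const_mul _ hJ, mul_assoc, ← hIdef]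
    nth_rewrite 2 [← ENNReal.rpow_one I]
    rw [← ENNReal.rpow_add_of_nonneg _ _ (by norm_num) (by norm_num)]
    norm_num
  have hle : ∀ x y, J x ^ (3 / 4 : ℝ) * J y ^ (3 / 4 : ℝ) *
      ENNReal.ofReal |τ x - τ y| ^ (-(1 / 2) : ℝ)
      ≤ J x ^ (3 / 4 : ℝ) * h x y + J y ^ (3 / 4 : ℝ) * h y x := by
    intro x y
    rcases le_total (J y) (J x) with hxy | hxy
    · refine le_add_right (le_of_eq ?_)
      simp [hh, Set.indicator, hxy, mul_assoc]
    · refine le_add_left (le_of_eq ?_)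
      simp only [hh, Set.indicator, Set.mem_ofPred_eq, hxy, if_true, abs_sub_comm (τ x)]
      ring
  calc _ ≤ ∫⁻ x, ∫⁻ y, (J x ^ (3 / 4 : ℝ) * h x y + J y ^ (3 / 4 : ℝ) * h y x) ∂μ ∂μ :=
        lintegral_mono fun x => lintegral_mono fun y => hle x y
    _ = ∫⁻ x, ∫⁻ y, J x ^ (3 / 4 : ℝ) * h x y ∂μ ∂μ
        + ∫⁻ x, ∫⁻ y, J y ^ (3 / 4 : ℝ) * h y x ∂μ ∂μ := by
        rw [← lintegral_add_left hmeas.lintegral_prod_right']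
        refine lintegral_congr fun x => ?_
        have hm : Measurable fun y => J x ^ (3 / 4 : ℝ) * h x y :=
          hmeas.comp measurable_prodMk_left
        rw [← lintegral_add_left hm]
    _ = ∫⁻ x, ∫⁻ y, J x ^ (3 / 4 : ℝ) * h x y ∂μ ∂μ
        + ∫⁻ x, ∫⁻ y, J x ^ (3 / 4 : ℝ) * h x y ∂μ ∂μ := by
        congr 1
        exact lintegral_lintegral_swap (hmeas.comp measurable_swap).aemeasurable
    _ ≤ A * I ^ (3 / 2 : ℝ) + A * I ^ (3 / 2 : ℝ) := add_le_add hone hone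
    _ = _ := by ring

end HardyLittlewoodSobolev

/-- The space of harmonic homogeneous polynomials of degree `k` in three variables. -/
noncomputable def solidHarmonic (k : ℕ) : Submodule ℂ (MvPolynomial (Fin 3) ℂ) :=
  homogeneousSubmodule (Fin 3) ℂ k ⊓
    LinearMap.ker (∑ i : Fin 3, (pderiv (R := ℂ) i).toLinearMap ∘ₗ (pderiv i).toLinearMap)

theorem mem_solidHarmonic {k : ℕ} {P : MvPolynomial (Fin 3) ℂ} :
    P ∈ solidHarmonic k ↔ P.IsHomogeneous k ∧ ∑ i : Fin 3, pderiv i (pderiv i P) = 0 := by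
  simp [solidHarmonic, LinearMap.sum_apply]

theorem pderiv_aeval {σ τ R : Type*} [CommSemiring R] [Fintype σ]
    (g : σ → MvPolynomial τ R) (i : τ) (P : MvPolynomial σ R) :
    pderiv i (aeval g P) = ∑ j, aeval g (pderiv j P) * pderiv i (g j) := by
  classical
  induction P using MvPolynomial.induction_on with
  | C a => simp [algebraMap_eq]
  | add p q hp hq => simp only [map_add, hp, hq, add_mul, Finset.sum_add_distrib]
  | mul_X p j hp =>
    simp only [map_mul, aeval_X, pderiv_mul, hp, map_add, add_mul, Finset.sum_add_distrib,
      pderiv_X, Finset.sum_mul]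
    congr 1
    · exact Finset.sum_congr rfl fun l _ => by ring
    · rw [Finset.sum_eq_single j]
      · simp
      · intro l _ hl
        simp [hl.symm]
      · simp

theorem hasDerivAt_eval {σ : Type*} [Fintype σ] {γ γ' : σ → ℝ → ℂ} {t : ℝ}
    (hγ : ∀ i, HasDerivAt (γ i) (γ' i t) t) (P : MvPolynomial σ ℂ) :
    HasDerivAt (fun s => eval (fun i => γ i s) P)
      (∑ i, eval (fun i => γ i t) (pderiv i P) * γ' i t) t := by
  classical
  induction P using MvPolynomial.induction_on with
  | C a => simpa using hasDerivAt_const t a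
  | add p q hp hq =>
    simp only [map_add, add_mul, Finset.sum_add_distrib]
    exact hp.add hq
  | mul_X p j hp =>
    have h := hp.mul (hγ j)
    simp only [map_mul, eval_X]
    refine h.congr_deriv ?_
    simp only [pderiv_mul, map_add, map_mul, eval_X, add_mul, Finset.sum_add_distrib,
      pderiv_X, Finset.sum_mul]
    congr 1
    · exact Finset.sum_congr rfl fun l _ => by ring
    · rw [Finset.sum_eq_single j]
      · simp
      · intro l _ hl
        simp [hl.symm]
      · simp

/-- The value of a polynomial at a point of `ℝ³`. -/
noncomputable def evalAt (x : ℝ³) : MvPolynomial (Fin 3) ℂ →ₐ[ℂ] ℂ :=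
  aeval fun i => (x i : ℂ)

theorem evalAt_eq (x : ℝ³) (P : MvPolynomial (Fin 3) ℂ) :
    evalAt x P = eval (fun i => (x i : ℂ)) P := by
  rw [evalAt, ← coe_aeval_eq_eval]
  rfl

theorem continuous_evalAt (P : MvPolynomial (Fin 3) ℂ) : Continuous fun x : ℝ³ => evalAt x P := by
  simp_rw [evalAt_eq]
  exact (MvPolynomial.continuous_eval P).comp (by fun_prop)

/-- Precomposition of a polynomial with a linear isometry. -/
noncomputable def compIsometry (R : ℝ³ ≃ₗᵢ[ℝ] ℝ³) :
    MvPolynomial (Fin 3) ℂ →ₐ[ℂ] MvPolynomial (Fin 3) ℂ :=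
  aeval fun j => ∑ i, C ((R (EuclideanSpace.single i 1) j : ℝ) : ℂ) * X i

theorem evalAt_compIsometry (R : ℝ³ ≃ₗᵢ[ℝ] ℝ³) (x : ℝ³) (P : MvPolynomial (Fin 3) ℂ) :
    evalAt x (compIsometry R P) = evalAt (R x) P := by
  have h : (evalAt x).comp (compIsometry R) = evalAt (R x) := by
    refine MvPolynomial.algHom_ext fun j => ?_
    simp only [AlgHom.comp_apply, compIsometry, evalAt, aeval_X, map_sum, map_mul,
      aeval_C]
    have hx : x = ∑ i, x i • EuclideanSpace.single i (1 : ℝ) := by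
      ext j
      simp [Fin.sum_univ_three]
      fin_cases j <;> simp
    conv_rhs => rw [hx, map_sum]
    simp [mul_comm]
  exact DFunLike.congr_fun h P

theorem compIsometry_mem {k : ℕ} (R : ℝ³ ≃ₗᵢ[ℝ] ℝ³) {P : MvPolynomial (Fin 3) ℂ}
    (hP : P ∈ solidHarmonic k) : compIsometry R P ∈ solidHarmonic k := by
  rw [mem_solidHarmonic] at hP ⊢
  set a : Fin 3 → Fin 3 → ℂ := fun j i => ((R (EuclideanSpace.single i 1) j : ℝ) : ℂ) with ha
  have hlin : ∀ i j, pderiv i (∑ l, C (a j l) * X l : MvPolynomial (Fin 3) ℂ) = C (a j i) := by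
    intro i j
    simp [pderiv_X, Pi.single_apply]
  have hd : ∀ i (Q : MvPolynomial (Fin 3) ℂ), pderiv i (compIsometry R Q)
      = ∑ j, compIsometry R (pderiv j Q) * C (a j i) := by
    intro i Q
    rw [compIsometry, pderiv_aeval]
    exact Finset.sum_congr rfl fun j _ => by rw [hlin]
  have horth : ∀ j l, ∑ i, a j i * a l i = if j = l then 1 else 0 := by
    intro j l
    have h1 : ∀ j i, (R (EuclideanSpace.single i 1) j : ℝ)
        = R.symm (EuclideanSpace.single j 1) i := by
      intro j i
      have h := R.inner_map_map (EuclideanSpace.single i (1 : ℝ))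
        (R.symm (EuclideanSpace.single j 1))
      rw [R.apply_symm_apply] at h
      simpa [EuclideanSpace.inner_single_right, EuclideanSpace.inner_single_left] using h
    have h2 := R.symm.inner_map_map (EuclideanSpace.single l (1 : ℝ)) (EuclideanSpace.single j 1)
    rw [PiLp.inner_apply, EuclideanSpace.inner_single_left] at h2
    simp only [ha, h1, ← Complex.ofReal_mul, ← Complex.ofReal_sum]
    simp only [RCLike.inner_apply, conj_trivial] at h2
    rw [h2]
    simp only [PiLp.single_apply, one_mul, eq_comm (a := l)]
    split_ifs <;> simp
  refine ⟨?_, ?_⟩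
  · have := hP.1.aeval (fun j => ∑ i, C ((R (EuclideanSpace.single i 1) j : ℝ) : ℂ) * X i)
      (n := 1) fun j => IsHomogeneous.sum _ _ _ fun i _ => isHomogeneous_C_mul_X _ _
    simpa [compIsometry] using this
  · have h : ∑ i, pderiv i (pderiv i (compIsometry R P))
        = ∑ j, ∑ l, compIsometry R (pderiv l (pderiv j P)) * C (∑ i, a l i * a j i) := by
      simp only [hd, map_sum, Finset.sum_mul, pderiv_mul, pderiv_C, mul_zero, add_zero,
        Finset.mul_sum, map_mul]
      rw [Finset.sum_comm]
      refine Finset.sum_congr rfl fun j _ => ?_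
      rw [Finset.sum_comm]
      exact Finset.sum_congr rfl fun l _ => Finset.sum_congr rfl fun i _ => by ring
    rw [h]
    have h0 := congrArg (compIsometry R) hP.2
    rw [map_zero, map_sum] at h0
    simpa [horth] using h0

theorem coeff_eq_zero_of_harmonic {P : MvPolynomial (Fin 3) ℂ}
    (hP : ∑ i : Fin 3, pderiv i (pderiv i P) = 0)
    (h0 : ∀ d : Fin 3 →₀ ℕ, d 2 ≤ 1 → coeff d P = 0) : P = 0 := by
  have key : ∀ (c : ℕ) (d : Fin 3 →₀ ℕ), d 2 = c → coeff d P = 0 := by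
    intro c
    induction c using Nat.strong_induction_on with
    | _ c ih =>
      intro d hd
      rcases Nat.lt_or_ge c 2 with hc | hc
      · exact h0 d (by omega)
      · set e : Fin 3 →₀ ℕ := d - Finsupp.single 2 2 with he
        have hde : d = e + Finsupp.single 2 1 + Finsupp.single 2 1 := by
          ext i
          fin_cases i <;> simp [he]
          omega
        have he2 : e 2 = c - 2 := by simp [he, hd]
        have h := congrArg (coeff e) hP
        simp only [Fin.sum_univ_three, coeff_add, coeff_pderiv, coeff_zero, ← hde] at h
        rw [ih (c - 2) (by omega) _ (by simp [he2]), ih (c - 2) (by omega) _ (by simp [he2])] at h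
        simp only [zero_mul, zero_add, mul_eq_zero] at h
        rcases h with (h | h) | h
        · exact h
        · exact absurd h (by norm_cast)
        · exact absurd h (by norm_cast)
  ext d
  simpa using key _ d rfl

theorem solidHarmonic_finrank_le (k : ℕ) :
    FiniteDimensional ℂ (solidHarmonic k) ∧ Module.finrank ℂ (solidHarmonic k) ≤ 2 * k + 1 := by
  let m : ℕ → ℕ → ℕ → (Fin 3 →₀ ℕ) := fun a b c => Finsupp.equivFunOnFinite.symm ![a, b, c]
  let L : solidHarmonic k →ₗ[ℂ] (Fin (k + 1) ⊕ Fin k → ℂ) :=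
    LinearMap.pi fun s => (Sum.elim (fun a : Fin (k + 1) => lcoeff ℂ (m a (k - a) 0))
      (fun a : Fin k => lcoeff ℂ (m a (k - 1 - a) 1)) s) ∘ₗ (solidHarmonic k).subtype
  have hL : Function.Injective L := by
    rw [injective_iff_map_eq_zero]
    rintro ⟨P, hP⟩ hLP
    have hP' := mem_solidHarmonic.1 hP
    refine Subtype.ext (coeff_eq_zero_of_harmonic hP'.2 fun d hd => ?_)
    by_cases hdeg : d.degree = k
    · have hsum : d 0 + d 1 + d 2 = k := by
        rw [← hdeg, Finsupp.degree_eq_sum, Fin.sum_univ_three]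
      have hm : ∀ a b c, a = d 0 → b = d 1 → c = d 2 → m a b c = d := by
        rintro a b c rfl rfl rfl
        ext i
        fin_cases i <;> rfl
      rcases Nat.le_one_iff_eq_zero_or_eq_one.1 hd with h2 | h2
      · have := congrFun hLP (Sum.inl ⟨d 0, by omega⟩)
        simp only [L, LinearMap.pi_apply, Sum.elim_inl, LinearMap.comp_apply, lcoeff_apply,
          Submodule.subtype_apply] at this
        rwa [hm (d 0) (k - d 0) 0 rfl (by omega) h2.symm] at this
      · have := congrFun hLP (Sum.inr ⟨d 0, by omega⟩)
        simp only [L, LinearMap.pi_apply, Sum.elim_inr, LinearMap.comp_apply, lcoeff_apply,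
          Submodule.subtype_apply] at this
        rwa [hm (d 0) (k - 1 - d 0) 1 rfl (by omega) h2.symm] at this
    · exact hP'.1.coeff_eq_zero hdeg
  refine ⟨FiniteDimensional.of_injective L hL, ?_⟩
  refine (LinearMap.finrank_le_finrank_of_injective hL).trans ?_
  simp
  omega

theorem volume_slice_eq {ρ : ℝ} (hρ : 0 < ρ) {A : Set ℝ} (hA : MeasurableSet A) :
    volume {z : ℝ | ρ ^ 2 + z ^ 2 < 1 ∧ z / √(ρ ^ 2 + z ^ 2) ∈ A}
      = ∫⁻ t in A ∩ Set.Ioo (-1) 1, {t : ℝ | ρ / √(1 - t ^ 2) < 1}.indicator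
        (fun t => ENNReal.ofReal (ρ / √(1 - t ^ 2)) * ENNReal.ofReal (1 / (1 - t ^ 2))) t := by
  set T : Set ℝ := {t : ℝ | ρ / √(1 - t ^ 2) < 1}
  have hT : MeasurableSet T := measurableSet_lt (by fun_prop) measurable_const
  set s : Set ℝ := T ∩ (A ∩ Set.Ioo (-1) 1)
  set φ : ℝ → ℝ := fun t => ρ * t / √(1 - t ^ 2)
  have hpos : ∀ t ∈ Set.Ioo (-1 : ℝ) 1, 0 < 1 - t ^ 2 := fun t ht => by nlinarith [ht.1, ht.2]
  have hφ : ∀ t ∈ Set.Ioo (-1 : ℝ) 1, ρ ^ 2 + φ t ^ 2 = ρ ^ 2 / (1 - t ^ 2) := fun t ht => by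
    have := hpos t ht
    simp only [φ, div_pow, Real.sq_sqrt this.le]
    field_simp
    ring
  have hinv : ∀ t ∈ Set.Ioo (-1 : ℝ) 1, φ t / √(ρ ^ 2 + φ t ^ 2) = t := fun t ht => by
    have h := hpos t ht
    have h' := Real.sqrt_pos.2 h
    rw [hφ t ht, Real.sqrt_div (sq_nonneg _), Real.sqrt_sq hρ.le]
    simp only [φ]
    field_simp
  have himage : {z : ℝ | ρ ^ 2 + z ^ 2 < 1 ∧ z / √(ρ ^ 2 + z ^ 2) ∈ A} = φ '' s := by
    ext z
    constructor
    · rintro ⟨h1, h2⟩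
      have hq : 0 < ρ ^ 2 + z ^ 2 := by positivity
      have hq' := Real.sqrt_pos.2 hq
      have e1 : 1 - (z / √(ρ ^ 2 + z ^ 2)) ^ 2 = ρ ^ 2 / (ρ ^ 2 + z ^ 2) := by
        rw [div_pow, Real.sq_sqrt hq.le]
        field_simp
        ring
      have e2 : √(1 - (z / √(ρ ^ 2 + z ^ 2)) ^ 2) = ρ / √(ρ ^ 2 + z ^ 2) := by
        rw [e1, Real.sqrt_div (sq_nonneg _), Real.sqrt_sq hρ.le]
      refine ⟨z / √(ρ ^ 2 + z ^ 2), ⟨?_, h2, ?_⟩, ?_⟩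
      · change ρ / √(1 - (z / √(ρ ^ 2 + z ^ 2)) ^ 2) < 1
        rw [e2, div_div_cancel₀ hρ.ne']
        exact (Real.sqrt_lt' one_pos).2 (by simpa using h1)
      · have : (z / √(ρ ^ 2 + z ^ 2)) ^ 2 < 1 := by
          have : 0 < ρ ^ 2 / (ρ ^ 2 + z ^ 2) := by positivity
          linarith
        rw [sq_lt_one_iff_abs_lt_one, abs_lt] at this
        exact this
      · simp only [φ]
        rw [e2]
        field_simp
    · rintro ⟨t, ⟨h1, h2, h3⟩, rfl⟩
      have h := hpos t h3
      refine ⟨?_, by rwa [hinv t h3]⟩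
      rw [hφ t h3]
      have h1 : ρ / √(1 - t ^ 2) < 1 := h1
      have h4 : 0 ≤ ρ / √(1 - t ^ 2) := by positivity
      have h5 : (ρ / √(1 - t ^ 2)) ^ 2 < 1 := by nlinarith
      rwa [div_pow, Real.sq_sqrt h.le] at h5
  have hs : MeasurableSet s := hT.inter (hA.inter measurableSet_Ioo)
  have hinj : Set.InjOn φ s := fun t ht t' ht' h => by
    rw [← hinv t ht.2.2, ← hinv t' ht'.2.2, h]
  have hder : ∀ t ∈ s, HasDerivWithinAt φ (ρ / √(1 - t ^ 2) * (1 / (1 - t ^ 2))) s t := by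
    intro t ht
    have h := hpos t ht.2.2
    have h' := Real.sqrt_pos.2 h
    have h1 : HasDerivAt (fun t : ℝ => 1 - t ^ 2) (-(2 * t)) t := by
      simpa using (hasDerivAt_pow 2 t).const_sub 1
    have h2 := ((hasDerivAt_id t).const_mul ρ).div (h1.sqrt h.ne') h'.ne'
    refine (h2.congr_deriv ?_).hasDerivWithinAt
    simp only [id]
    have h3 := Real.sq_sqrt h.le
    field_simp
    rw [h3]
    ring
  have := lintegral_image_eq_lintegral_abs_deriv_mul hs hder hinj (fun _ => 1)
  rw [himage, ← setLIntegral_one, this, setLIntegral_indicator hT]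
  refine setLIntegral_congr_fun hs fun t ht => ?_
  have h := hpos t ht.2.2
  simp only [mul_one]
  rw [abs_of_pos (by positivity), ENNReal.ofReal_mul (by positivity)]

theorem volume_cone_eq {A : Set ℝ} (hA : MeasurableSet A) :
    (volume : Measure (Fin 3 → ℝ)) {y | y 0 ^ 2 + y 1 ^ 2 + y 2 ^ 2 < 1 ∧
      y 2 / √(y 0 ^ 2 + y 1 ^ 2 + y 2 ^ 2) ∈ A}
    = (∫⁻ w : Fin 2 → ℝ, {w : Fin 2 → ℝ | √(w 0 ^ 2 + w 1 ^ 2) < 1}.indicator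
        (fun w => ENNReal.ofReal √(w 0 ^ 2 + w 1 ^ 2)) w) * volume (A ∩ Set.Ioo (-1) 1) := by
  have hmp := volume_preserving_piFinSuccAbove (fun _ : Fin 3 => ℝ) 2
  set r : (Fin 2 → ℝ) → ℝ := fun w => √(w 0 ^ 2 + w 1 ^ 2) with hr
  set k : (Fin 2 → ℝ) → ℝ≥0∞ := {w | r w < 1}.indicator (fun w => ENNReal.ofReal (r w)) with hk
  have hkm : Measurable k :=
    Measurable.indicator (by fun_prop) (measurableSet_lt (by fun_prop) measurable_const)
  set B : Set (ℝ × (Fin 2 → ℝ)) := {q | r q.2 ^ 2 + q.1 ^ 2 < 1 ∧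
      q.1 / √(r q.2 ^ 2 + q.1 ^ 2) ∈ A} with hB
  have hBm : MeasurableSet B :=
    (measurableSet_lt (f := fun q : ℝ × (Fin 2 → ℝ) => r q.2 ^ 2 + q.1 ^ 2) (by fun_prop)
      measurable_const).inter ((by fun_prop :
        Measurable fun q : ℝ × (Fin 2 → ℝ) => q.1 / √(r q.2 ^ 2 + q.1 ^ 2)) hA)
  have hpre : {y : Fin 3 → ℝ | y 0 ^ 2 + y 1 ^ 2 + y 2 ^ 2 < 1 ∧
      y 2 / √(y 0 ^ 2 + y 1 ^ 2 + y 2 ^ 2) ∈ A}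
      = MeasurableEquiv.piFinSuccAbove (fun _ : Fin 3 => ℝ) 2 ⁻¹' B := by
    ext y
    have h0 : r (fun i => y ((2 : Fin 3).succAbove i)) ^ 2 = y 0 ^ 2 + y 1 ^ 2 := by
      rw [hr, Real.sq_sqrt (by positivity)]
      rfl
    simp only [hB, Set.mem_preimage, Set.mem_ofPred_eq]
    rw [show ((MeasurableEquiv.piFinSuccAbove (fun _ : Fin 3 => ℝ) 2) y).2
      = fun i => y ((2 : Fin 3).succAbove i) from rfl, h0]
    rfl
  have hr0 : ∀ᵐ w : Fin 2 → ℝ, 0 < r w := by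
    have : ∀ᵐ w : Fin 2 → ℝ, w ≠ 0 := by
      simp [ae_iff]
    filter_upwards [this] with w hw
    refine Real.sqrt_pos.2 ?_
    by_contra hcon
    apply hw
    ext i
    have h0 : w 0 ^ 2 = 0 := by nlinarith [sq_nonneg (w 0), sq_nonneg (w 1)]
    have h1 : w 1 ^ 2 = 0 := by nlinarith [sq_nonneg (w 0), sq_nonneg (w 1)]
    fin_cases i
    · simpa using h0
    · simpa using h1
  rw [hpre, hmp.measure_preimage hBm.nullMeasurableSet, Measure.volume_eq_prod,
    Measure.prod_apply_symm hBm]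
  have hslice : ∀ᵐ w : Fin 2 → ℝ, volume ((fun z => (z, w)) ⁻¹' B)
      = ∫⁻ t in A ∩ Set.Ioo (-1) 1, k ((√(1 - t ^ 2))⁻¹ • w) *
          ENNReal.ofReal (1 / (1 - t ^ 2)) := by
    filter_upwards [hr0] with w hw
    refine (volume_slice_eq hw hA).trans ?_
    refine setLIntegral_congr_fun (hA.inter measurableSet_Ioo) fun t ht => ?_
    have hsc : r ((√(1 - t ^ 2))⁻¹ • w) = r w / √(1 - t ^ 2) := by
      simp only [hr, Pi.smul_apply, smul_eq_mul, mul_pow, ← mul_add]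
      rw [Real.sqrt_mul (sq_nonneg _), Real.sqrt_sq (by positivity), div_eq_inv_mul]
    by_cases h : r w / √(1 - t ^ 2) < 1
    · simp [hk, Set.indicator, hsc, h]
    · simp [hk, Set.indicator, hsc, h]
  rw [lintegral_congr_ae hslice, lintegral_lintegral_swap (by
    refine Measurable.aemeasurable ?_
    fun_prop)]
  have hin : ∀ t ∈ A ∩ Set.Ioo (-1 : ℝ) 1,
      ∫⁻ w : Fin 2 → ℝ, k ((√(1 - t ^ 2))⁻¹ • w) * ENNReal.ofReal (1 / (1 - t ^ 2))
        = ∫⁻ w, k w := by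
    intro t ht
    have hp : 0 < 1 - t ^ 2 := by nlinarith [ht.2.1, ht.2.2]
    have hsp := Real.sqrt_pos.2 hp
    rw [lintegral_mul_const _ (by fun_prop),
      ← lintegral_map (μ := (volume : Measure (Fin 2 → ℝ)))
        (g := fun w : Fin 2 → ℝ => (√(1 - t ^ 2))⁻¹ • w) hkm (by fun_prop),
      Measure.map_addHaar_smul _ (inv_ne_zero hsp.ne'), lintegral_smul_measure, smul_eq_mul]
    simp only [Module.finrank_fin_fun, inv_pow, inv_inv, Real.sq_sqrt hp.le, abs_of_pos hp]
    rw [mul_right_comm, ← ENNReal.ofReal_mul hp.le, mul_one_div_cancel hp.ne']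
    simp
  rw [setLIntegral_congr_fun (hA.inter measurableSet_Ioo) hin, setLIntegral_const]

theorem sphere_sum_sq (x : 𝕊²) : (x : ℝ³) 0 ^ 2 + (x : ℝ³) 1 ^ 2 + (x : ℝ³) 2 ^ 2 = 1 := by
  have h := EuclideanSpace.norm_sq_eq (x : ℝ³)
  rw [norm_eq_of_mem_sphere x] at h
  simpa [Fin.sum_univ_three] using h.symm

instance : IsFiniteMeasure sphereMeasure := by unfold sphereMeasure; infer_instance

instance : Measure.IsOpenPosMeasure sphereMeasure := by unfold sphereMeasure; infer_instance

theorem continuous_sphere_height : Continuous fun x : 𝕊² => (x : ℝ³) 2 := by fun_prop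

/-- The height function pushes the surface measure to a multiple of Lebesgue measure. -/
theorem exists_map_sphereMeasure_height : ∃ c : ℝ≥0∞, c ≠ 0 ∧ c ≠ ∞ ∧
    sphereMeasure.map (fun x : 𝕊² => (x : ℝ³) 2) = c • volume.restrict (Set.Ioo (-1) 1) := by
  set c : ℝ≥0∞ := 3 * (∫⁻ w : Fin 2 → ℝ, {w : Fin 2 → ℝ | √(w 0 ^ 2 + w 1 ^ 2) < 1}.indicator
        (fun w => ENNReal.ofReal √(w 0 ^ 2 + w 1 ^ 2)) w) with hc
  have hmap : sphereMeasure.map (fun x : 𝕊² => (x : ℝ³) 2)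
      = c • volume.restrict (Set.Ioo (-1) 1) := by
    ext A hA
    have hA' := continuous_sphere_height.measurable hA
    rw [Measure.map_apply continuous_sphere_height.measurable hA, sphereMeasure,
      Measure.toSphere_apply' _ hA', Measure.smul_apply, Measure.restrict_apply hA, smul_eq_mul,
      hc, mul_assoc, ← volume_cone_eq hA,
      ← (EuclideanSpace.volume_preserving_symm_measurableEquiv_toLp (Fin 3)).measure_preimage_emb
        (MeasurableEquiv.toLp 2 (Fin 3 → ℝ)).symm.measurableEmbedding]
    congr 1
    · simp
    · refine measure_congr ?_
      have hne : ∀ᵐ y : ℝ³, y ≠ 0 := by simp [ae_iff]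
      filter_upwards [hne] with y hy
      have hn : ‖y‖ ^ 2 = y 0 ^ 2 + y 1 ^ 2 + y 2 ^ 2 := by
        simp [EuclideanSpace.norm_sq_eq, Fin.sum_univ_three]
      have hpos : 0 < ‖y‖ := norm_pos_iff.2 hy
      refine propext ⟨?_, ?_⟩
      · rintro ⟨r, hr, _, ⟨x, hx, rfl⟩, rfl⟩
        simp only at hn hpos ⊢
        have hnr : ‖r • (x : ℝ³)‖ = r := by
          rw [norm_smul, norm_eq_of_mem_sphere x, mul_one, Real.norm_of_nonneg hr.1.le]
        refine ⟨?_, ?_⟩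
        · change (r • (x : ℝ³)) 0 ^ 2 + (r • (x : ℝ³)) 1 ^ 2 + (r • (x : ℝ³)) 2 ^ 2 < 1
          rw [← hn, hnr]
          nlinarith [hr.1, hr.2]
        · change (r • (x : ℝ³)) 2 /
            √((r • (x : ℝ³)) 0 ^ 2 + (r • (x : ℝ³)) 1 ^ 2 + (r • (x : ℝ³)) 2 ^ 2) ∈ A
          rw [← hn, hnr, Real.sqrt_sq hr.1.le, PiLp.smul_apply, smul_eq_mul,
            mul_div_cancel_left₀ _ hr.1.ne']
          exact hx
      · rintro ⟨h1, h2⟩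
        change y 0 ^ 2 + y 1 ^ 2 + y 2 ^ 2 < 1 at h1
        change y 2 / √(y 0 ^ 2 + y 1 ^ 2 + y 2 ^ 2) ∈ A at h2
        rw [← hn] at h1 h2
        rw [Real.sqrt_sq hpos.le] at h2
        refine ⟨‖y‖, ⟨hpos, by nlinarith⟩, ‖y‖⁻¹ • y,
          ⟨⟨‖y‖⁻¹ • y, by simp [norm_smul, hpos.ne']⟩, ?_, rfl⟩, ?_⟩
        · change (‖y‖⁻¹ • y) 2 ∈ A
          rwa [PiLp.smul_apply, smul_eq_mul, inv_mul_eq_div]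
        · simp [smul_smul, hpos.ne']
  have huniv := congrArg (fun ν => ν Set.univ) hmap
  simp only [Measure.smul_apply, Measure.restrict_apply_univ, Real.volume_Ioo, smul_eq_mul] at huniv
  rw [Measure.map_apply continuous_sphere_height.measurable .univ, Set.preimage_univ] at huniv
  have h0 : sphereMeasure Set.univ ≠ 0 := by
    rw [Ne, Measure.measure_univ_eq_zero]
    exact (volume : Measure ℝ³).toSphere_ne_zero
  have ht : sphereMeasure Set.univ ≠ ∞ := measure_ne_top _ _
  rw [huniv] at h0 ht
  refine ⟨c, left_ne_zero_of_mul h0, fun h => ht ?_, hmap⟩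
  rw [h]
  exact ENNReal.top_mul (right_ne_zero_of_mul h0)

/-- The action of a linear isometry on the unit sphere. -/
noncomputable def sphereMap (R : ℝ³ ≃ₗᵢ[ℝ] ℝ³) (x : 𝕊²) : 𝕊² :=
  ⟨R x, by simp⟩

@[simp]
theorem coe_sphereMap (R : ℝ³ ≃ₗᵢ[ℝ] ℝ³) (x : 𝕊²) : (sphereMap R x : ℝ³) = R x := rfl

theorem continuous_sphereMap (R : ℝ³ ≃ₗᵢ[ℝ] ℝ³) : Continuous (sphereMap R) :=
  Continuous.subtype_mk (R.continuous.comp continuous_subtype_val) _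

theorem sphereMap_symm_apply (R : ℝ³ ≃ₗᵢ[ℝ] ℝ³) (x : 𝕊²) :
    sphereMap R.symm (sphereMap R x) = x := Subtype.ext (by simp)

theorem sphereMap_apply_symm (R : ℝ³ ≃ₗᵢ[ℝ] ℝ³) (x : 𝕊²) :
    sphereMap R (sphereMap R.symm x) = x := Subtype.ext (by simp)

open scoped Pointwise in
theorem measurePreserving_sphereMap (R : ℝ³ ≃ₗᵢ[ℝ] ℝ³) :
    MeasurePreserving (sphereMap R) sphereMeasure sphereMeasure := by
  refine ⟨(continuous_sphereMap R).measurable, ?_⟩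
  ext s hs
  have hs' := (continuous_sphereMap R).measurable hs
  rw [Measure.map_apply (continuous_sphereMap R).measurable hs, sphereMeasure,
    Measure.toSphere_apply' _ hs', Measure.toSphere_apply' _ hs]
  congr 1
  have himg : (Set.Ioo (0 : ℝ) 1 • (Subtype.val '' (sphereMap R ⁻¹' s)) : Set ℝ³)
      = R ⁻¹' (Set.Ioo (0 : ℝ) 1 • (Subtype.val '' s)) := by
    ext y
    constructor
    · rintro ⟨r, hr, _, ⟨x, hx, rfl⟩, rfl⟩
      exact ⟨r, hr, _, ⟨sphereMap R x, hx, rfl⟩, by simp⟩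
    · rintro ⟨r, hr, _, ⟨x, hx, rfl⟩, h⟩
      refine ⟨r, hr, _, ⟨sphereMap R.symm x, ?_, rfl⟩, ?_⟩
      · rwa [Set.mem_preimage, sphereMap_apply_symm]
      · apply R.injective
        simpa using h
  rw [himg]
  exact R.measurePreserving.measure_preimage_emb R.toHomeomorph.measurableEmbedding _

theorem measurableEmbedding_sphereMap (R : ℝ³ ≃ₗᵢ[ℝ] ℝ³) : MeasurableEmbedding (sphereMap R) :=
  (Homeomorph.mk ⟨sphereMap R, sphereMap R.symm, sphereMap_symm_apply R, sphereMap_apply_symm R⟩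
    (continuous_sphereMap R) (continuous_sphereMap R.symm)).measurableEmbedding

/-- Restriction of polynomials to the unit sphere. -/
noncomputable def restrictSphere : MvPolynomial (Fin 3) ℂ →ₗ[ℂ] C(𝕊², ℂ) where
  toFun P := ⟨fun x => evalAt x P, (continuous_evalAt P).comp continuous_subtype_val⟩
  map_add' P Q := by ext; simp
  map_smul' c P := by ext; simp

@[simp]
theorem restrictSphere_apply (P : MvPolynomial (Fin 3) ℂ) (x : 𝕊²) :
    restrictSphere P x = evalAt x P := rfl

/-- The space of spherical harmonics of degree `k`. -/
noncomputable def sphericalHarmonic (k : ℕ) : Submodule ℂ C(𝕊², ℂ) :=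
  (solidHarmonic k).map restrictSphere

theorem mem_sphericalHarmonic {k : ℕ} {f : C(𝕊², ℂ)} :
    f ∈ sphericalHarmonic k ↔ ∃ P ∈ solidHarmonic k, ∀ x : 𝕊², f x = evalAt x P := by
  simp only [sphericalHarmonic, Submodule.mem_map]
  refine exists_congr fun P => and_congr_right fun _ => ?_
  rw [eq_comm, ContinuousMap.ext_iff]
  rfl

theorem IsSphericalHarmonic.exists_mem {k : ℕ} {f : 𝕊² → ℂ} (hf : IsSphericalHarmonic k f) :
    ∃ F ∈ sphericalHarmonic k, f = F := by
  obtain ⟨P, h1, h2, h3⟩ := hf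
  exact ⟨restrictSphere P, ⟨P, mem_solidHarmonic.2 ⟨h1, h2⟩, rfl⟩,
    funext fun x => by rw [h3, restrictSphere_apply, evalAt_eq]⟩

instance (k : ℕ) : FiniteDimensional ℂ (sphericalHarmonic k) := by
  have := (solidHarmonic_finrank_le k).1
  unfold sphericalHarmonic
  infer_instance

theorem finrank_sphericalHarmonic_le (k : ℕ) :
    Module.finrank ℂ (sphericalHarmonic k) ≤ 2 * k + 1 := by
  have := (solidHarmonic_finrank_le k).1
  exact (Submodule.finrank_map_le _ _).trans (solidHarmonic_finrank_le k).2

/-- Precomposition with a linear isometry, as a linear map on continuous functions. -/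
noncomputable def rotate (R : ℝ³ ≃ₗᵢ[ℝ] ℝ³) : C(𝕊², ℂ) →ₗ[ℂ] C(𝕊², ℂ) where
  toFun f := f.comp ⟨sphereMap R, continuous_sphereMap R⟩
  map_add' _ _ := rfl
  map_smul' _ _ := rfl

@[simp]
theorem rotate_apply (R : ℝ³ ≃ₗᵢ[ℝ] ℝ³) (f : C(𝕊², ℂ)) (x : 𝕊²) :
    rotate R f x = f (sphereMap R x) := rfl

theorem rotate_mem {k : ℕ} (R : ℝ³ ≃ₗᵢ[ℝ] ℝ³) {f : C(𝕊², ℂ)} (hf : f ∈ sphericalHarmonic k) :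
    rotate R f ∈ sphericalHarmonic k := by
  rw [mem_sphericalHarmonic] at hf ⊢
  obtain ⟨P, hP, h⟩ := hf
  exact ⟨compIsometry R P, compIsometry_mem R hP, fun x => by
    rw [evalAt_compIsometry, rotate_apply, h, coe_sphereMap]⟩

theorem integral_comp_sphereMap {E : Type*} [NormedAddCommGroup E] [NormedSpace ℝ E]
    (R : ℝ³ ≃ₗᵢ[ℝ] ℝ³) (g : 𝕊² → E) :
    ∫ x, g (sphereMap R x) ∂sphereMeasure = ∫ x, g x ∂sphereMeasure :=
  (measurePreserving_sphereMap R).integral_comp (measurableEmbedding_sphereMap R) g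

theorem lintegral_comp_sphereMap (R : ℝ³ ≃ₗᵢ[ℝ] ℝ³) (g : 𝕊² → ℝ≥0∞) :
    ∫⁻ x, g (sphereMap R x) ∂sphereMeasure = ∫⁻ x, g x ∂sphereMeasure :=
  (measurePreserving_sphereMap R).lintegral_comp_emb (measurableEmbedding_sphereMap R) g

/-- The sesquilinear pairing `∫ conj f * g` over the sphere. -/
noncomputable def spherePair (f g : C(𝕊², ℂ)) : ℂ := ∫ x, star (f x) * g x ∂sphereMeasure

theorem integrable_of_continuous {g : 𝕊² → ℂ} (hg : Continuous g) : Integrable g sphereMeasure :=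
  hg.integrable_of_hasCompactSupport (HasCompactSupport.of_compactSpace g)

/-- `Y` is an orthonormal basis of the spherical harmonics of degree `k`. -/
structure IsHarmonicBasis (k n : ℕ) (Y : Fin n → C(𝕊², ℂ)) : Prop where
  card_le : n ≤ 2 * k + 1
  mem : ∀ i, Y i ∈ sphericalHarmonic k
  pair : ∀ i j, spherePair (Y i) (Y j) = if i = j then 1 else 0
  sum_repr : ∀ f ∈ sphericalHarmonic k, f = ∑ i, spherePair (Y i) f • Y i

theorem exists_isHarmonicBasis (k : ℕ) : ∃ (n : ℕ) (Y : Fin n → C(𝕊², ℂ)),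
    IsHarmonicBasis k n Y := by
  let T : C(𝕊², ℂ) →L[ℂ] Lp ℂ 2 sphereMeasure := ContinuousMap.toLp 2 sphereMeasure ℂ
  have hTinj : Function.Injective T := ContinuousMap.toLp_injective sphereMeasure
  have hin : ∀ f g : C(𝕊², ℂ), inner ℂ (T f) (T g) = spherePair f g := fun f g => by
    rw [ContinuousMap.inner_toLp]
    exact integral_congr_ae (ae_of_all _ fun x => mul_comm _ _)
  let W : Submodule ℂ (Lp ℂ 2 sphereMeasure) := (sphericalHarmonic k).map (T : C(𝕊², ℂ) →ₗ[ℂ] _)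
  let b := stdOrthonormalBasis ℂ W
  have hb : ∀ i, ∃ y ∈ sphericalHarmonic k, T y = b i := fun i => (b i).2
  choose Y hY hYb using hb
  refine ⟨_, Y, (Submodule.finrank_map_le _ _).trans (finrank_sphericalHarmonic_le k), hY, ?_, ?_⟩
  · intro i j
    rw [← hin, hYb, hYb]
    exact orthonormal_iff_ite.1 b.orthonormal i j
  · intro f hf
    apply hTinj
    have h := b.sum_repr' (⟨T f, ⟨f, hf, rfl⟩⟩ : W)
    have h' := congrArg Subtype.val h
    rw [map_sum]
    simp only [map_smul, hYb, ← hin]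
    exact h'.symm.trans (by simp)

theorem spherePair_star (f g : C(𝕊², ℂ)) : star (spherePair f g) = spherePair g f := by
  rw [spherePair, spherePair, ← starRingEnd_apply, ← integral_conj]
  exact integral_congr_ae (ae_of_all _ fun x => by simp [mul_comm])

theorem spherePair_sum_smul {ι : Type*} (s : Finset ι) (f : C(𝕊², ℂ)) (c : ι → ℂ)
    (g : ι → C(𝕊², ℂ)) :
    spherePair f (∑ i ∈ s, c i • g i) = ∑ i ∈ s, c i * spherePair f (g i) := by
  simp only [spherePair, ContinuousMap.coe_sum, ContinuousMap.coe_smul, Finset.sum_apply,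
    Pi.smul_apply, smul_eq_mul, Finset.mul_sum]
  rw [integral_finsetSum]
  · refine Finset.sum_congr rfl fun i _ => ?_
    rw [← integral_const_mul]
    exact integral_congr_ae (ae_of_all _ fun x => by ring)
  · exact fun i _ => integrable_of_continuous (by fun_prop)

theorem sum_smul_spherePair {ι : Type*} (s : Finset ι) (f : C(𝕊², ℂ)) (c : ι → ℂ)
    (g : ι → C(𝕊², ℂ)) :
    spherePair (∑ i ∈ s, c i • g i) f = ∑ i ∈ s, star (c i) * spherePair (g i) f := by
  rw [← spherePair_star, spherePair_sum_smul, star_sum]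
  exact Finset.sum_congr rfl fun i _ => by rw [star_mul', spherePair_star]

theorem spherePair_rotate (R : ℝ³ ≃ₗᵢ[ℝ] ℝ³) (f g : C(𝕊², ℂ)) :
    spherePair (rotate R f) (rotate R g) = spherePair f g :=
  integral_comp_sphereMap R fun x => star (f x) * g x

/-- The squared `L²` norm over the sphere. -/
noncomputable def sphereNormSq (f : C(𝕊², ℂ)) : ℝ := ∫ x, ‖f x‖ ^ 2 ∂sphereMeasure

theorem spherePair_self (f : C(𝕊², ℂ)) : spherePair f f = sphereNormSq f := by
  rw [spherePair, sphereNormSq, ← integral_complex_ofReal]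
  refine integral_congr_ae (ae_of_all _ fun x => ?_)
  simp [← starRingEnd_apply, RCLike.conj_mul]

theorem sphereNormSq_nonneg (f : C(𝕊², ℂ)) : 0 ≤ sphereNormSq f :=
  integral_nonneg fun _ => by positivity

theorem sphereNormSq_rotate (R : ℝ³ ≃ₗᵢ[ℝ] ℝ³) (f : C(𝕊², ℂ)) :
    sphereNormSq (rotate R f) = sphereNormSq f :=
  integral_comp_sphereMap R fun x => ‖f x‖ ^ 2

theorem exists_sphereMap_eq (x y : 𝕊²) : ∃ R : ℝ³ ≃ₗᵢ[ℝ] ℝ³, sphereMap R x = y :=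
  ⟨Submodule.reflection (ℝ ∙ ((x : ℝ³) - y))ᗮ, Subtype.ext (Submodule.reflection_sub (by simp))⟩

/-- The section `K(·, y)` of the reproducing kernel of a basis. -/
noncomputable def kernelSection {n : ℕ} (Y : Fin n → C(𝕊², ℂ)) (y : 𝕊²) : C(𝕊², ℂ) :=
  ∑ i, star (Y i y) • Y i

theorem kernelSection_apply {n : ℕ} (Y : Fin n → C(𝕊², ℂ)) (x y : 𝕊²) :
    kernelSection Y y x = ∑ i, Y i x * star (Y i y) := by
  simp [kernelSection, mul_comm]

namespace IsHarmonicBasis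

variable {k n : ℕ} {Y : Fin n → C(𝕊², ℂ)}

theorem kernelSection_mem (hY : IsHarmonicBasis k n Y) (y : 𝕊²) :
    kernelSection Y y ∈ sphericalHarmonic k :=
  Submodule.sum_mem _ fun i _ => Submodule.smul_mem _ _ (hY.mem i)

theorem spherePair_kernelSection (hY : IsHarmonicBasis k n Y) {f : C(𝕊², ℂ)}
    (hf : f ∈ sphericalHarmonic k) (y : 𝕊²) : spherePair (kernelSection Y y) f = f y := by
  rw [kernelSection, sum_smul_spherePair]
  conv_rhs => rw [hY.sum_repr f hf]
  simp [mul_comm]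

theorem kernelSection_sphereMap (hY : IsHarmonicBasis k n Y) (R : ℝ³ ≃ₗᵢ[ℝ] ℝ³) (x y : 𝕊²) :
    kernelSection Y (sphereMap R y) (sphereMap R x) = kernelSection Y y x := by
  set g := rotate R (kernelSection Y (sphereMap R y))
  have hg : g ∈ sphericalHarmonic k := rotate_mem R (hY.kernelSection_mem _)
  have h1 : spherePair g (kernelSection Y x) = kernelSection Y x y := by
    have hrr : kernelSection Y x = rotate R (rotate R.symm (kernelSection Y x)) := by
      ext z
      simp [sphereMap_symm_apply]
    rw [hrr, spherePair_rotate, hY.spherePair_kernelSection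
      (rotate_mem _ (hY.kernelSection_mem _)), rotate_apply, sphereMap_symm_apply, ← hrr]
  have h2 := hY.spherePair_kernelSection (hY.kernelSection_mem y) x
  rw [← spherePair_star, hY.spherePair_kernelSection (hY.kernelSection_mem x)] at h2
  have h3 := hY.spherePair_kernelSection hg x
  rw [← spherePair_star, h1, h2] at h3
  exact h3.symm

theorem sphereNormSq_eq (hY : IsHarmonicBasis k n Y) {f : C(𝕊², ℂ)}
    (hf : f ∈ sphericalHarmonic k) : sphereNormSq f = ∑ i, ‖spherePair (Y i) f‖ ^ 2 := by
  have h := spherePair_self f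
  conv_lhs at h => rw [hY.sum_repr f hf, sum_smul_spherePair, ← hY.sum_repr f hf]
  have : ∀ i, star (spherePair (Y i) f) * spherePair (Y i) f
      = ((‖spherePair (Y i) f‖ ^ 2 : ℝ) : ℂ) := fun i => by
    rw [← starRingEnd_apply, RCLike.conj_mul]
    norm_cast
  simp only [this] at h
  exact_mod_cast h.symm

theorem sum_norm_sq (hY : IsHarmonicBasis k n Y) (x : 𝕊²) :
    ∑ i, ‖Y i x‖ ^ 2 = n / sphereMeasure.real Set.univ := by
  have hdiag : ∀ y, ((∑ i, ‖Y i y‖ ^ 2 : ℝ) : ℂ) = kernelSection Y y y := fun y => by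
    rw [kernelSection_apply]
    push_cast
    exact Finset.sum_congr rfl fun i _ => by
      rw [← starRingEnd_apply, RCLike.mul_conj]
      rfl
  have hconst : ∀ y, ∑ i, ‖Y i y‖ ^ 2 = ∑ i, ‖Y i x‖ ^ 2 := fun y => by
    obtain ⟨R, rfl⟩ := exists_sphereMap_eq x y
    have := hY.kernelSection_sphereMap R x x
    rw [← hdiag, ← hdiag] at this
    exact_mod_cast this
  have hintg : ∫ y, ∑ i, ‖Y i y‖ ^ 2 ∂sphereMeasure = n := by
    rw [integral_finsetSum]
    · have : ∀ i, ∫ y, ‖Y i y‖ ^ 2 ∂sphereMeasure = 1 := fun i => by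
        have := spherePair_self (Y i)
        rw [hY.pair, if_pos rfl] at this
        exact_mod_cast this.symm
      simp [this]
    · intro i _
      exact Continuous.integrable_of_hasCompactSupport (by fun_prop)
        (HasCompactSupport.of_compactSpace _)
  simp only [hconst, integral_const, smul_eq_mul] at hintg
  have hpos : sphereMeasure.real Set.univ ≠ 0 := by
    rw [Ne, measureReal_eq_zero_iff, Measure.measure_univ_eq_zero]
    exact (volume : Measure ℝ³).toSphere_ne_zero
  field_simp
  linarith

theorem norm_kernelSection_le (hY : IsHarmonicBasis k n Y) (x y : 𝕊²) :
    ‖kernelSection Y y x‖ ≤ n / sphereMeasure.real Set.univ := by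
  rw [kernelSection_apply]
  refine (norm_sum_le _ _).trans ?_
  simp only [norm_mul, norm_star]
  have h := Finset.sum_le_sum fun i (_ : i ∈ Finset.univ) =>
    two_mul_le_add_sq ‖Y i x‖ ‖Y i y‖
  rw [Finset.sum_add_distrib, hY.sum_norm_sq, hY.sum_norm_sq] at h
  simp only [mul_assoc, ← Finset.mul_sum] at h
  linarith

theorem norm_sq_le (hY : IsHarmonicBasis k n Y) {f : C(𝕊², ℂ)}
    (hf : f ∈ sphericalHarmonic k) (x : 𝕊²) :
    ‖f x‖ ^ 2 ≤ n / sphereMeasure.real Set.univ * sphereNormSq f := by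
  rw [hY.sphereNormSq_eq hf, ← hY.sum_norm_sq x, mul_comm]
  conv_lhs => rw [hY.sum_repr f hf]
  have h1 : ‖∑ i, spherePair (Y i) f * Y i x‖ ≤ ∑ i, ‖spherePair (Y i) f‖ * ‖Y i x‖ :=
    (norm_sum_le _ _).trans (by simp)
  calc _ ≤ (∑ i, ‖spherePair (Y i) f‖ * ‖Y i x‖) ^ 2 := by
        gcongr
        simpa using h1
    _ ≤ _ := Finset.sum_mul_sq_le_sq_mul_sq _ _ _

end IsHarmonicBasis

/-- Pointwise bound for spherical harmonics. -/
theorem exists_norm_sq_le_of_mem_sphericalHarmonic : ∃ C : ℝ, 0 < C ∧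
    ∀ (k : ℕ), ∀ f ∈ sphericalHarmonic k, ∀ x, ‖f x‖ ^ 2 ≤ C * (1 + k) * sphereNormSq f := by
  have hpos : 0 < sphereMeasure.real Set.univ := by
    refine lt_of_le_of_ne measureReal_nonneg fun h => ?_
    rw [eq_comm, measureReal_eq_zero_iff, Measure.measure_univ_eq_zero] at h
    exact (volume : Measure ℝ³).toSphere_ne_zero h
  refine ⟨2 / sphereMeasure.real Set.univ, by positivity, fun k f hf x => ?_⟩
  obtain ⟨n, Y, hY⟩ := exists_isHarmonicBasis k
  refine (hY.norm_sq_le hf x).trans ?_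
  refine mul_le_mul_of_nonneg_right ?_ (sphereNormSq_nonneg f)
  have : (n : ℝ) ≤ 2 * k + 1 := by exact_mod_cast hY.card_le
  rw [div_mul_eq_mul_div]
  gcongr
  linarith

theorem pderiv_pderiv_comm {σ R : Type*} [CommRing R] (i j : σ) (P : MvPolynomial σ R) :
    pderiv i (pderiv j P) = pderiv j (pderiv i P) := by
  classical
  have h : ⁅pderiv (R := R) i, pderiv (R := R) j⁆ = 0 := by
    refine MvPolynomial.derivation_ext fun l => ?_
    rw [Derivation.commutator_apply, pderiv_X, pderiv_X]
    simp only [Pi.single_apply]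
    split_ifs <;> simp
  have := congrArg (fun D : Derivation R (MvPolynomial σ R) (MvPolynomial σ R) => D P) h
  simpa [Derivation.commutator_apply, sub_eq_zero] using this

theorem sum_mul_eval_pderiv {k : ℕ} {P : MvPolynomial (Fin 3) ℂ} (hP : P.IsHomogeneous k)
    (v : Fin 3 → ℂ) : ∑ i, v i * eval v (pderiv i P) = k * eval v P := by
  have := congrArg (eval v) hP.sum_X_mul_pderiv
  simpa using this

theorem sum_mul_eval_pderiv_pderiv {k : ℕ} {P : MvPolynomial (Fin 3) ℂ} (hP : P.IsHomogeneous k)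
    (v : Fin 3 → ℂ) (j : Fin 3) :
    ∑ i, v i * eval v (pderiv i (pderiv j P)) = (k - 1) * eval v (pderiv j P) := by
  have := congrArg (fun Q => eval v (pderiv j Q)) hP.sum_X_mul_pderiv
  simp only [map_nsmul, map_sum, pderiv_mul, map_add, map_mul, eval_X, Finset.sum_add_distrib,
    pderiv_X, pderiv_pderiv_comm j] at this
  rw [Finset.sum_eq_single j] at this
  · simp only [Pi.single_eq_same, map_one, one_mul, nsmul_eq_mul] at this
    linear_combination this
  · intro i _ hi
    simp [hi.symm]
  · simp

/-- On the unit sphere, `P` transforms under rotations about the third axis with weight `m`. -/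
def HasWeight (m : ℝ) (P : MvPolynomial (Fin 3) ℂ) : Prop :=
  ∀ a t φ : ℝ, a ^ 2 + t ^ 2 = 1 →
    eval ![((a * Real.cos φ : ℝ) : ℂ), ((a * Real.sin φ : ℝ) : ℂ), (t : ℂ)] P =
      Complex.exp (m * φ * Complex.I) * eval ![(a : ℂ), 0, (t : ℂ)] P

theorem HasWeight.eval_pderiv {m : ℝ} {P : MvPolynomial (Fin 3) ℂ} (h : HasWeight m P)
    {a t : ℝ} (hat : a ^ 2 + t ^ 2 = 1) :
    (a : ℂ) ^ 2 * eval ![(a : ℂ), 0, (t : ℂ)] (pderiv 1 (pderiv 1 P)) -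
      a * eval ![(a : ℂ), 0, (t : ℂ)] (pderiv 0 P) =
      -m ^ 2 * eval ![(a : ℂ), 0, (t : ℂ)] P := by
  set γ : Fin 3 → ℝ → ℂ := ![fun φ => ((a * Real.cos φ : ℝ) : ℂ),
    fun φ => ((a * Real.sin φ : ℝ) : ℂ), fun _ => (t : ℂ)] with hγ
  set γ' : Fin 3 → ℝ → ℂ := ![fun φ => ((a * -Real.sin φ : ℝ) : ℂ),
    fun φ => ((a * Real.cos φ : ℝ) : ℂ), fun _ => 0] with hγ'
  have hd : ∀ φ i, HasDerivAt (γ i) (γ' i φ) φ := by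
    intro φ i
    fin_cases i
    · exact ((Real.hasDerivAt_cos φ).const_mul a).ofReal_comp
    · exact ((Real.hasDerivAt_sin φ).const_mul a).ofReal_comp
    · exact hasDerivAt_const _ _
  have hv : ∀ φ, (fun i => γ i φ) =
      ![((a * Real.cos φ : ℝ) : ℂ), ((a * Real.sin φ : ℝ) : ℂ), (t : ℂ)] := by
    intro φ
    funext i
    fin_cases i <;> rfl
  have hv0 : (fun i => γ i 0) = ![(a : ℂ), 0, (t : ℂ)] := by
    rw [hv]
    simp
  have hexp : ∀ φ : ℝ, HasDerivAt (fun φ : ℝ => Complex.exp (m * φ * Complex.I))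
      (m * Complex.I * Complex.exp (m * φ * Complex.I)) φ := by
    intro φ
    have := (((Complex.ofRealCLM.hasDerivAt (x := φ)).const_mul (m : ℂ)).mul_const
      Complex.I).cexp
    refine this.congr_deriv ?_
    simp
    ring
  set P₀ := eval ![(a : ℂ), 0, (t : ℂ)] P with hP₀
  have h1 : ∀ φ, ∑ i, eval (fun i => γ i φ) (pderiv i P) * γ' i φ =
      m * Complex.I * Complex.exp (m * φ * Complex.I) * P₀ := by
    intro φ
    have e1 := hasDerivAt_eval (hd φ) P
    have e2 := (hexp φ).mul_const P₀
    refine e1.unique (e2.congr_of_eventuallyEq (Filter.Eventually.of_forall fun s => ?_))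
    change eval (fun i => γ i s) P = _
    rw [hv, h a t s hat]
  have e1 := (((hasDerivAt_eval (hd 0) (pderiv 0 P)).mul
    (((Real.hasDerivAt_sin 0).neg.const_mul a).ofReal_comp)).add
    ((hasDerivAt_eval (hd 0) (pderiv 1 P)).mul
    (((Real.hasDerivAt_cos 0).const_mul a).ofReal_comp)))
  have e2 := ((hexp 0).const_mul (m * Complex.I)).mul_const P₀
  have e3 := e1.unique (e2.congr_of_eventuallyEq (Filter.Eventually.of_forall fun s => by
    have := h1 s
    simp only [Fin.sum_univ_three] at this
    simp only [hγ', Matrix.cons_val_zero, Matrix.cons_val_one, Matrix.cons_val] at this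
    rw [mul_zero, add_zero] at this
    exact this))
  simp only [hv0, Fin.sum_univ_three] at e3
  simp [hγ'] at e3
  linear_combination e3 + m ^ 2 * P₀ * Complex.I_sq

section
variable {k : ℕ} {m : ℝ} {P : MvPolynomial (Fin 3) ℂ}

/-- The profile of a polynomial along the meridian through `e₁`. -/
noncomputable def meridian (P : MvPolynomial (Fin 3) ℂ) (t : ℝ) : ℂ :=
  eval ![(√(1 - t ^ 2) : ℂ), 0, (t : ℂ)] P

theorem continuous_meridian (P : MvPolynomial (Fin 3) ℂ) : Continuous (meridian P) := by
  refine (MvPolynomial.continuous_eval P).comp (continuous_pi fun i => ?_)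
  fin_cases i
  · exact Complex.continuous_ofReal.comp (by fun_prop)
  · exact continuous_const
  · exact Complex.continuous_ofReal

theorem hasDerivAt_meridian (P : MvPolynomial (Fin 3) ℂ) {t : ℝ} (ht : t ∈ Set.Ioo (-1 : ℝ) 1) :
    HasDerivAt (meridian P) (meridian (pderiv 0 P) t * ((-t / √(1 - t ^ 2) : ℝ) : ℂ) +
      meridian (pderiv 2 P) t) t := by
  have hp : 0 < 1 - t ^ 2 := by nlinarith [ht.1, ht.2]
  set γ : Fin 3 → ℝ → ℂ := ![fun t => ((√(1 - t ^ 2) : ℝ) : ℂ), fun _ => 0, fun t => (t : ℂ)]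
    with hγ
  set γ' : Fin 3 → ℝ → ℂ := ![fun t => ((-t / √(1 - t ^ 2) : ℝ) : ℂ), fun _ => 0, fun _ => 1]
    with hγ'
  have hd : ∀ i, HasDerivAt (γ i) (γ' i t) t := by
    intro i
    fin_cases i
    · refine HasDerivAt.ofReal_comp ?_
      refine (((hasDerivAt_pow 2 t).const_sub 1).sqrt hp.ne').congr_deriv ?_
      norm_num
      field_simp
    · exact hasDerivAt_const _ _
    · exact Complex.ofRealCLM.hasDerivAt
  have hv : ∀ s, (fun i => γ i s) = ![(√(1 - s ^ 2) : ℂ), 0, (s : ℂ)] := by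
    intro s
    funext i
    fin_cases i <;> rfl
  have := hasDerivAt_eval hd P
  simp only [hv, Fin.sum_univ_three] at this
  refine this.congr_deriv ?_
  simp [hγ']
  rfl

/-- The conjugate variable `(1 - t²) ∂u` of the meridian profile `u`. -/
noncomputable def meridianFlux (k : ℕ) (P : MvPolynomial (Fin 3) ℂ) (t : ℝ) : ℂ :=
  meridian (pderiv 2 P) t - k * t * meridian P t

theorem continuous_meridianFlux (k : ℕ) (P : MvPolynomial (Fin 3) ℂ) :
    Continuous (meridianFlux k P) :=
  (continuous_meridian _).sub
    ((continuous_const.mul Complex.continuous_ofReal).mul (continuous_meridian _))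

theorem hasDerivAt_meridian_flux (hP : P ∈ solidHarmonic k) {t : ℝ} (ht : t ∈ Set.Ioo (-1 : ℝ) 1) :
    HasDerivAt (meridian P) (meridianFlux k P t / ((1 - t ^ 2 : ℝ) : ℂ)) t := by
  have hp : 0 < 1 - t ^ 2 := by nlinarith [ht.1, ht.2]
  refine (hasDerivAt_meridian P ht).congr_deriv ?_
  have h1 := sum_mul_eval_pderiv (mem_solidHarmonic.1 hP).1 ![(√(1 - t ^ 2) : ℂ), 0, (t : ℂ)]
  simp only [Fin.sum_univ_three, Matrix.cons_val_zero, Matrix.cons_val_one, Matrix.cons_val] at h1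
  have h2 : ((√(1 - t ^ 2) : ℝ) : ℂ) ^ 2 = ((1 - t ^ 2 : ℝ) : ℂ) := by
    exact_mod_cast Real.sq_sqrt hp.le
  have h0 : ((√(1 - t ^ 2) : ℝ) : ℂ) ≠ 0 := by exact_mod_cast (Real.sqrt_pos.2 hp).ne'
  rw [meridianFlux, ← h2]
  simp only [meridian]
  push_cast at h2 ⊢
  field_simp
  linear_combination (eval ![(√(1 - t ^ 2) : ℂ), 0, (t : ℂ)] (pderiv 2 P)) * h2 - t * h1

theorem hasDerivAt_meridianFlux (hP : P ∈ solidHarmonic k) (hm : HasWeight m P) {t : ℝ}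
    (ht : t ∈ Set.Ioo (-1 : ℝ) 1) :
    HasDerivAt (meridianFlux k P)
      (-(((k * (k + 1) - m ^ 2 / (1 - t ^ 2) : ℝ) : ℂ) * meridian P t)) t := by
  have hp : 0 < 1 - t ^ 2 := by nlinarith [ht.1, ht.2]
  have hh := mem_solidHarmonic.1 hP
  have hv0 : √(1 - t ^ 2) ^ 2 + t ^ 2 = 1 := by rw [Real.sq_sqrt hp.le]; ring
  have d1 := hasDerivAt_meridian (pderiv 2 P) ht
  have d2 := ((Complex.ofRealCLM.hasDerivAt (x := t)).const_mul (k : ℂ)).mul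
    (hasDerivAt_meridian_flux hP ht)
  refine (d1.sub d2).congr_deriv ?_
  have h2 : ((√(1 - t ^ 2) : ℝ) : ℂ) ^ 2 = ((1 - t ^ 2 : ℝ) : ℂ) := by
    exact_mod_cast Real.sq_sqrt hp.le
  have h0 : ((√(1 - t ^ 2) : ℝ) : ℂ) ≠ 0 := by exact_mod_cast (Real.sqrt_pos.2 hp).ne'
  have hp0 : (1 - (t : ℂ) ^ 2) ≠ 0 := by exact_mod_cast hp.ne'
  set v := ![(√(1 - t ^ 2) : ℂ), 0, (t : ℂ)] with hv
  have k1 := sum_mul_eval_pderiv hh.1 v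
  have k2 := sum_mul_eval_pderiv_pderiv hh.1 v 0
  have k3 := sum_mul_eval_pderiv_pderiv hh.1 v 2
  have k4 := hm.eval_pderiv hv0
  have k5 := congrArg (eval v) hh.2
  rw [← hv] at k4
  simp only [Fin.sum_univ_three, hv, Matrix.cons_val_zero, Matrix.cons_val_one, Matrix.cons_val,
    map_add, map_zero] at k1 k2 k3 k4 k5
  rw [← hv] at k1 k2 k3 k4 k5
  rw [pderiv_pderiv_comm 2 0] at k2
  simp only [meridianFlux, meridian, ← hv]
  push_cast at h2 ⊢
  set A := eval v P
  set A0 := eval v (pderiv 0 P)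
  set A2 := eval v (pderiv 2 P)
  set A00 := eval v (pderiv 0 (pderiv 0 P))
  set A11 := eval v (pderiv 1 (pderiv 1 P))
  set A22 := eval v (pderiv 2 (pderiv 2 P))
  set A02 := eval v (pderiv 0 (pderiv 2 P))
  set a := ((√(1 - t ^ 2) : ℝ) : ℂ)
  have k6 : A22 = -k ^ 2 * A + (2 * k - 1) * t * A2 + m ^ 2 * A := by
    linear_combination a ^ 2 * k5 - k4 - A22 * h2
      - a * k2 + t * k3 - k * k1
  have k7 : (1 - (t : ℂ) ^ 2) * (A02 * (-t / a) + A22) = A22 - (k - 1) * t * A2 := by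
    rw [← h2]
    field_simp
    linear_combination A22 * h2 - t * k3
  have k8 : A02 * (-t / a) + A22 = (A22 - (k - 1) * t * A2) / (1 - (t : ℂ) ^ 2) := by
    rw [← k7]
    field_simp
  rw [k8, k6]
  simp only [Complex.ofRealCLM_apply, Complex.ofReal_one]
  field_simp
  ring
end

theorem exists_sphereMap_eq_of_inner_eq {x x' y : 𝕊²}
    (h : inner ℝ (x : ℝ³) (y : ℝ³) = inner ℝ (x' : ℝ³) (y : ℝ³)) :
    ∃ R : ℝ³ ≃ₗᵢ[ℝ] ℝ³, sphereMap R x = x' ∧ sphereMap R y = y := by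
  refine ⟨Submodule.reflection (ℝ ∙ ((x : ℝ³) - x'))ᗮ,
    Subtype.ext (Submodule.reflection_sub (by simp)), Subtype.ext ?_⟩
  rw [coe_sphereMap]
  refine Submodule.reflection_mem_subspace_eq_self ?_
  rw [Submodule.mem_orthogonal_singleton_iff_inner_right, inner_sub_left, h, sub_self]

theorem eval_smul_of_isHomogeneous {σ R : Type*} [Fintype σ] [CommSemiring R] {k : ℕ}
    {P : MvPolynomial σ R} (hP : P.IsHomogeneous k) (r : R) (v : σ → R) :
    eval (r • v) P = r ^ k * eval v P := by
  rw [eval_eq', eval_eq', Finset.mul_sum]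
  refine Finset.sum_congr rfl fun d hd => ?_
  have hd' : ∑ i, d i = k := by
    rw [← Finsupp.degree_eq_sum, Finsupp.degree_eq_weight_one]
    exact hP (mem_support_iff.1 hd)
  simp only [Pi.smul_apply, smul_eq_mul, mul_pow, Finset.prod_mul_distrib,
    Finset.prod_pow_eq_pow_sum, hd']
  ring

theorem evalAt_smul {k : ℕ} {P : MvPolynomial (Fin 3) ℂ} (hP : P.IsHomogeneous k) (r : ℝ)
    (x : ℝ³) : evalAt (r • x) P = (r : ℂ) ^ k * evalAt x P := by
  have h : (fun i => (((r • x) i : ℝ) : ℂ)) = (r : ℂ) • fun i => ((x i : ℝ) : ℂ) := by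
    funext i
    simp
  rw [evalAt_eq, evalAt_eq, h, eval_smul_of_isHomogeneous hP]

theorem norm_neg_of_mem_sphericalHarmonic {k : ℕ} {f : C(𝕊², ℂ)} (hf : f ∈ sphericalHarmonic k)
    (x : 𝕊²) : ‖f (-x)‖ = ‖f x‖ := by
  obtain ⟨P, hP, h⟩ := mem_sphericalHarmonic.1 hf
  have := evalAt_smul (mem_solidHarmonic.1 hP).1 (-1) (x : ℝ³)
  rw [h, h, coe_neg_sphere, ← neg_one_smul ℝ (x : ℝ³), this]
  simp

/-- The point of the sphere at latitude `t` and longitude `φ`. -/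
noncomputable def spherePoint (a t φ : ℝ) (h : a ^ 2 + t ^ 2 = 1) : 𝕊² :=
  ⟨!₂[a * Real.cos φ, a * Real.sin φ, t], by
    rw [mem_sphere_zero_iff_norm, EuclideanSpace.norm_eq, Real.sqrt_eq_one]
    simp [Fin.sum_univ_three]
    linear_combination a ^ 2 * Real.sin_sq_add_cos_sq φ + h⟩

theorem evalAt_spherePoint {a t φ : ℝ} (h : a ^ 2 + t ^ 2 = 1) (P : MvPolynomial (Fin 3) ℂ) :
    evalAt (spherePoint a t φ h : 𝕊²) P =
      eval ![((a * Real.cos φ : ℝ) : ℂ), ((a * Real.sin φ : ℝ) : ℂ), (t : ℂ)] P := by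
  rw [evalAt_eq]
  congr 2
  funext i
  fin_cases i <;> rfl

theorem evalAt_spherePoint_zero {a t : ℝ} (h : a ^ 2 + t ^ 2 = 1) (P : MvPolynomial (Fin 3) ℂ) :
    evalAt (spherePoint a t 0 h : 𝕊²) P = eval ![(a : ℂ), 0, (t : ℂ)] P := by
  rw [evalAt_spherePoint]
  simp

/-- The north pole. -/
noncomputable def northPole : 𝕊² := ⟨EuclideanSpace.single 2 1, by simp⟩

theorem inner_northPole (x : ℝ³) : inner ℝ x (northPole : ℝ³) = x 2 := by
  simp [northPole, EuclideanSpace.inner_single_right]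

namespace IsHarmonicBasis

variable {k n : ℕ} {Y : Fin n → C(𝕊², ℂ)}

theorem kernelSection_eq_of_inner_eq (hY : IsHarmonicBasis k n Y) {x y x' y' : 𝕊²}
    (h : inner ℝ (x : ℝ³) (y : ℝ³) = inner ℝ (x' : ℝ³) (y' : ℝ³)) :
    kernelSection Y y x = kernelSection Y y' x' := by
  obtain ⟨R, hR⟩ := exists_sphereMap_eq y y'
  have h2 : inner ℝ (sphereMap R x : ℝ³) (y' : ℝ³) = inner ℝ (x' : ℝ³) (y' : ℝ³) := by
    rw [← h, ← hR, coe_sphereMap, coe_sphereMap, LinearIsometryEquiv.inner_map_map]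
  obtain ⟨T, hT1, hT2⟩ := exists_sphereMap_eq_of_inner_eq h2
  rw [← hY.kernelSection_sphereMap R, hR, ← hY.kernelSection_sphereMap T, hT1, hT2]

theorem norm_sq_kernelSection_le_of_nonneg (hY : IsHarmonicBasis k n Y) (hk : 1 ≤ k)
    {x y : 𝕊²} (hs : 0 ≤ inner ℝ (x : ℝ³) (y : ℝ³)) :
    √(k * (k + 1)) * (√(1 - inner ℝ (x : ℝ³) (y : ℝ³) ^ 2) * ‖kernelSection Y y x‖ ^ 2) ≤
      5 * (n / sphereMeasure.real Set.univ) ^ 2 := by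
  set t := inner ℝ (x : ℝ³) (y : ℝ³) with htdef
  have ht1 : t ≤ 1 := by
    have := real_inner_le_norm (x : ℝ³) (y : ℝ³)
    simpa using this
  obtain ⟨P, hP, hKP⟩ := mem_sphericalHarmonic.1 (hY.kernelSection_mem northPole)
  have hPh := (mem_solidHarmonic.1 hP).1
  have hw : HasWeight 0 P := by
    intro a s φ h
    rw [← evalAt_spherePoint h, ← evalAt_spherePoint_zero h, ← hKP, ← hKP]
    simp only [Complex.ofReal_zero, zero_mul, Complex.exp_zero, one_mul]
    refine hY.kernelSection_eq_of_inner_eq ?_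
    rw [inner_northPole, inner_northPole]
    rfl
  have hsq : ∀ s ∈ Set.Icc (0 : ℝ) 1, √(1 - s ^ 2) ^ 2 + s ^ 2 = 1 := fun s hs => by
    rw [Real.sq_sqrt (by nlinarith [hs.1, hs.2])]
    ring
  have hval : ∀ s (hs : s ∈ Set.Icc (0 : ℝ) 1), meridian P s =
      kernelSection Y northPole (spherePoint _ s 0 (hsq s hs)) := fun s hs => by
    rw [hKP, evalAt_spherePoint_zero, meridian]
  set κ := (n / sphereMeasure.real Set.univ : ℝ)
  have hκ : ∀ s ∈ Set.Icc (0 : ℝ) 1, ‖meridian P s‖ ≤ κ := fun s hs => by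
    rw [hval s hs]
    exact hY.norm_kernelSection_le _ _
  have hl : (2 : ℝ) ≤ k * (k + 1) := by
    have : (1 : ℝ) ≤ k := by exact_mod_cast hk
    nlinarith
  have hd1 : ∀ s ∈ Set.Ioo (0 : ℝ) 1, HasDerivAt (meridian P)
      (meridianFlux k P s / ((1 - s ^ 2 : ℝ) : ℂ)) s := fun s hs =>
    hasDerivAt_meridian_flux hP ⟨by linarith [hs.1], hs.2⟩
  have hd2 : ∀ s ∈ Set.Ioo (0 : ℝ) 1, HasDerivAt (meridianFlux k P)
      (-(((k * (k + 1) : ℝ) : ℂ) * meridian P s)) s := fun s hs => by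
    simpa using hasDerivAt_meridianFlux hP hw (t := s) ⟨by linarith [hs.1], hs.2⟩
  have hw1 : meridianFlux k P 1 = 0 := by
    have := sum_mul_eval_pderiv hPh ![(√(1 - 1 ^ 2) : ℂ), 0, ((1 : ℝ) : ℂ)]
    simp [Fin.sum_univ_three] at this
    simp [meridianFlux, meridian, this]
  have hre := legendre_sonine_bound hl (u := fun s => (meridian P s).re)
    (w := fun s => (meridianFlux k P s).re) (κ := κ)
    (fun s hs => by
      have := (Complex.reCLM.hasFDerivAt.comp_hasDerivAt s (hd1 s hs))
      rwa [Complex.reCLM_apply, Complex.div_ofReal_re] at this)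
    (fun s hs => by
      have := (Complex.reCLM.hasFDerivAt.comp_hasDerivAt s (hd2 s hs))
      rwa [Complex.reCLM_apply, Complex.neg_re, Complex.re_ofReal_mul] at this)
    (Complex.continuous_re.comp (continuous_meridian P)).continuousOn
    (Complex.continuous_re.comp (continuous_meridianFlux k P)).continuousOn (by simp [hw1])
    (fun s hs => (Complex.abs_re_le_norm _).trans (hκ s hs)) ⟨hs, ht1⟩
  have him := legendre_sonine_bound hl (u := fun s => (meridian P s).im)
    (w := fun s => (meridianFlux k P s).im) (κ := κ)
    (fun s hs => by
      have := (Complex.imCLM.hasFDerivAt.comp_hasDerivAt s (hd1 s hs))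
      rwa [Complex.imCLM_apply, Complex.div_ofReal_im] at this)
    (fun s hs => by
      have := (Complex.imCLM.hasFDerivAt.comp_hasDerivAt s (hd2 s hs))
      rwa [Complex.imCLM_apply, Complex.neg_im, Complex.im_ofReal_mul] at this)
    (Complex.continuous_im.comp (continuous_meridian P)).continuousOn
    (Complex.continuous_im.comp (continuous_meridianFlux k P)).continuousOn (by simp [hw1])
    (fun s hs => (Complex.abs_im_le_norm _).trans (hκ s hs)) ⟨hs, ht1⟩
  have hK : kernelSection Y y x = meridian P t := by
    rw [hval t ⟨hs, ht1⟩]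
    refine hY.kernelSection_eq_of_inner_eq ?_
    rw [inner_northPole, ← htdef]
    rfl
  rw [hK, Complex.sq_norm, Complex.normSq_apply]
  linarith

theorem norm_sq_kernelSection_le (hY : IsHarmonicBasis k n Y) (hk : 1 ≤ k) (x y : 𝕊²) :
    √(k * (k + 1)) * (√(1 - inner ℝ (x : ℝ³) (y : ℝ³) ^ 2) * ‖kernelSection Y y x‖ ^ 2) ≤
      5 * (n / sphereMeasure.real Set.univ) ^ 2 := by
  rcases le_total 0 (inner ℝ (x : ℝ³) (y : ℝ³)) with hs | hs
  · exact hY.norm_sq_kernelSection_le_of_nonneg hk hs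
  · have hneg : inner ℝ ((-x : 𝕊²) : ℝ³) (y : ℝ³) = -inner ℝ (x : ℝ³) (y : ℝ³) := by
      rw [coe_neg_sphere, inner_neg_left]
    have := hY.norm_sq_kernelSection_le_of_nonneg hk (x := -x) (y := y) (by linarith)
    rwa [hneg, neg_sq, norm_neg_of_mem_sphericalHarmonic (hY.kernelSection_mem y)] at this

end IsHarmonicBasis

theorem sq_height_sub_le {x y : 𝕊²} (h : 0 ≤ (x : ℝ³) 2 * (y : ℝ³) 2) :
    ((x : ℝ³) 2 - (y : ℝ³) 2) ^ 2 ≤ 2 * (1 - inner ℝ (x : ℝ³) (y : ℝ³) ^ 2) := by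
  have hx := sphere_sum_sq x
  have hy := sphere_sum_sq y
  have hi : inner ℝ (x : ℝ³) (y : ℝ³) =
      (x : ℝ³) 0 * (y : ℝ³) 0 + (x : ℝ³) 1 * (y : ℝ³) 1 + (x : ℝ³) 2 * (y : ℝ³) 2 := by
    simp [PiLp.inner_apply, Fin.sum_univ_three, mul_comm]
  have h1 : |inner ℝ (x : ℝ³) (y : ℝ³)| ≤ 1 := by
    simpa using abs_real_inner_le_norm (x : ℝ³) (y : ℝ³)
  obtain ⟨h2, h3⟩ := abs_le.1 h1
  set s := inner ℝ (x : ℝ³) (y : ℝ³)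
  rcases le_total 0 s with hs | hs
  · nlinarith [sq_nonneg ((x : ℝ³) 0 - (y : ℝ³) 0), sq_nonneg ((x : ℝ³) 1 - (y : ℝ³) 1)]
  · nlinarith [sq_nonneg ((x : ℝ³) 0 + (y : ℝ³) 0), sq_nonneg ((x : ℝ³) 1 + (y : ℝ³) 1)]

theorem sphereMeasure_real_univ_pos : 0 < sphereMeasure.real (Set.univ : Set 𝕊²) := by
  refine lt_of_le_of_ne measureReal_nonneg fun h => ?_
  rw [eq_comm, measureReal_eq_zero_iff, Measure.measure_univ_eq_zero] at h
  exact (volume : Measure ℝ³).toSphere_ne_zero h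

theorem exists_norm_sq_kernelSection_mul_le : ∃ C : ℝ, 0 < C ∧ ∀ (k n : ℕ)
    (Y : Fin n → C(𝕊², ℂ)), IsHarmonicBasis k n Y → 1 ≤ k → ∀ x y : 𝕊²,
      0 ≤ (x : ℝ³) 2 * (y : ℝ³) 2 →
      ‖kernelSection Y y x‖ ^ 2 * |(x : ℝ³) 2 - (y : ℝ³) 2| ≤ C * k := by
  have hpos := sphereMeasure_real_univ_pos
  set S := sphereMeasure.real (Set.univ : Set 𝕊²)
  refine ⟨90 / S ^ 2, by positivity, fun k n Y hY hk x y hxy => ?_⟩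
  have hk1 : (1 : ℝ) ≤ k := by exact_mod_cast hk
  have h1 := hY.norm_sq_kernelSection_le hk x y
  have h2 := sq_height_sub_le hxy
  have hn : (n : ℝ) ≤ 3 * k := by
    have : (n : ℝ) ≤ 2 * k + 1 := by exact_mod_cast hY.card_le
    linarith
  have h3 : |(x : ℝ³) 2 - (y : ℝ³) 2| ≤ 2 * √(1 - inner ℝ (x : ℝ³) (y : ℝ³) ^ 2) := by
    refine abs_le_of_sq_le_sq ?_ (by positivity)
    rw [mul_pow, Real.sq_sqrt (by nlinarith [sq_nonneg ((x : ℝ³) 2 - (y : ℝ³) 2)])]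
    nlinarith [sq_nonneg ((x : ℝ³) 2 - (y : ℝ³) 2)]
  have h4 : (k : ℝ) ≤ √(k * (k + 1)) := Real.le_sqrt_of_sq_le (by nlinarith)
  set q := √(1 - inner ℝ (x : ℝ³) (y : ℝ³) ^ 2)
  set z := ‖kernelSection Y y x‖ ^ 2
  have hz : 0 ≤ q * z := by positivity
  have h5 : (k : ℝ) * (q * z) ≤ 5 * ((3 * k) / S) ^ 2 := by
    refine (mul_le_mul_of_nonneg_right h4 hz).trans (h1.trans ?_)
    gcongr
  have h6 : q * z ≤ 45 * k / S ^ 2 := by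
    have : 5 * ((3 * k) / S) ^ 2 = k * (45 * k / S ^ 2) := by ring
    rw [this] at h5
    exact le_of_mul_le_mul_left h5 (by linarith)
  calc z * |(x : ℝ³) 2 - (y : ℝ³) 2| ≤ z * (2 * q) := by gcongr
    _ = 2 * (q * z) := by ring
    _ ≤ 2 * (45 * k / S ^ 2) := by gcongr
    _ = _ := by ring

/-- The rotation by the angle `φ` about the third axis. -/
noncomputable def axisRotation (φ : ℝ) : ℝ³ ≃ₗᵢ[ℝ] ℝ³ :=
  LinearIsometry.toLinearIsometryEquiv
    { toFun := fun x => !₂[Real.cos φ * x 0 - Real.sin φ * x 1,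
        Real.sin φ * x 0 + Real.cos φ * x 1, x 2]
      map_add' := fun x y => by
        ext i
        fin_cases i <;> simp <;> ring
      map_smul' := fun c x => by
        ext i
        fin_cases i <;> simp <;> ring
      norm_map' := fun x => by
        rw [EuclideanSpace.norm_eq, EuclideanSpace.norm_eq]
        congr 1
        simp [Fin.sum_univ_three]
        linear_combination (x 0 ^ 2 + x 1 ^ 2) * Real.sin_sq_add_cos_sq φ } rfl

theorem axisRotation_apply (φ : ℝ) (x : ℝ³) :
    axisRotation φ x = !₂[Real.cos φ * x 0 - Real.sin φ * x 1,
        Real.sin φ * x 0 + Real.cos φ * x 1, x 2] := rfl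

@[simp]
theorem axisRotation_apply_two (φ : ℝ) (x : ℝ³) : axisRotation φ x 2 = x 2 := rfl

theorem sphereMap_axisRotation_add (φ ψ : ℝ) (x : 𝕊²) :
    sphereMap (axisRotation φ) (sphereMap (axisRotation ψ) x) =
      sphereMap (axisRotation (φ + ψ)) x := by
  refine Subtype.ext ?_
  simp only [coe_sphereMap]
  ext i
  fin_cases i <;> simp [axisRotation_apply, Real.cos_add, Real.sin_add] <;> ring

theorem sphereMap_axisRotation_zero (x : 𝕊²) : sphereMap (axisRotation 0) x = x := by
  refine Subtype.ext ?_
  simp only [coe_sphereMap]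
  ext i
  fin_cases i <;> simp [axisRotation_apply]

theorem sphereMap_axisRotation_spherePoint {a t : ℝ} (φ : ℝ) (h : a ^ 2 + t ^ 2 = 1) :
    sphereMap (axisRotation φ) (spherePoint a t 0 h) = spherePoint a t φ h := by
  refine Subtype.ext ?_
  simp only [coe_sphereMap]
  ext i
  fin_cases i <;> simp [axisRotation_apply, spherePoint, mul_comm]

theorem exists_eq_sphereMap_axisRotation (x : 𝕊²) : ∃ (h : √(1 - (x : ℝ³) 2 ^ 2) ^ 2 +
    (x : ℝ³) 2 ^ 2 = 1) (φ : ℝ),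
    x = sphereMap (axisRotation φ) (spherePoint (√(1 - (x : ℝ³) 2 ^ 2)) ((x : ℝ³) 2) 0 h) := by
  have hx := sphere_sum_sq x
  have h : √(1 - (x : ℝ³) 2 ^ 2) ^ 2 + (x : ℝ³) 2 ^ 2 = 1 := by
    rw [Real.sq_sqrt (by nlinarith [sq_nonneg ((x : ℝ³) 0), sq_nonneg ((x : ℝ³) 1)])]
    ring
  set z : ℂ := ⟨(x : ℝ³) 0, (x : ℝ³) 1⟩ with hz
  have hn : ‖z‖ = √(1 - (x : ℝ³) 2 ^ 2) := by
    rw [Complex.norm_def, Complex.normSq_apply]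
    congr 1
    simp only [hz]
    linarith
  refine ⟨h, z.arg, ?_⟩
  rw [sphereMap_axisRotation_spherePoint]
  refine Subtype.ext ?_
  ext i
  fin_cases i
  · simp [spherePoint, ← hn, Complex.norm_mul_cos_arg, hz]
  · simp [spherePoint, ← hn, Complex.norm_mul_sin_arg, hz]
  · simp [spherePoint]

/-- `g` transforms under rotations about the third axis with weight `m`. -/
def IsWeightFunction (m : ℤ) (g : C(𝕊², ℂ)) : Prop :=
  ∀ (φ : ℝ) (x : 𝕊²), g (sphereMap (axisRotation φ) x) = Complex.exp (m * φ * Complex.I) * g x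

theorem IsWeightFunction.norm_eq {m : ℤ} {g : C(𝕊², ℂ)} (hg : IsWeightFunction m g) (φ : ℝ)
    (x : 𝕊²) : ‖g (sphereMap (axisRotation φ) x)‖ = ‖g x‖ := by
  rw [hg, norm_mul]
  have : (m * φ * Complex.I : ℂ) = ((m * φ : ℝ) : ℂ) * Complex.I := by push_cast; ring
  rw [this, Complex.norm_exp_ofReal_mul_I, one_mul]

theorem IsWeightFunction.spherePair_eq_zero {m l : ℤ} (hml : m ≠ l) {f g : C(𝕊², ℂ)}
    (hf : IsWeightFunction m f) (hg : IsWeightFunction l g) : spherePair f g = 0 := by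
  have hd : ((l : ℂ) - m) ≠ 0 := by
    rw [sub_ne_zero]
    exact_mod_cast hml.symm
  set φ : ℝ := Real.pi / (l - m) with hφ
  have h := spherePair_rotate (axisRotation φ) f g
  have h2 : spherePair (rotate (axisRotation φ) f) (rotate (axisRotation φ) g) =
      -spherePair f g := by
    rw [spherePair, spherePair, ← integral_neg]
    refine integral_congr_ae (ae_of_all _ fun x => ?_)
    simp only [rotate_apply, hf φ x, hg φ x, ← starRingEnd_apply, ← Complex.exp_conj,
      map_mul, Complex.conj_I, Complex.conj_ofReal, map_intCast]
    have : Complex.exp (m * φ * -Complex.I) * Complex.exp (l * φ * Complex.I) = -1 := by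
      rw [← Complex.exp_add, ← Complex.exp_pi_mul_I]
      congr 1
      rw [hφ]
      push_cast
      field_simp
      ring
    linear_combination (starRingEnd ℂ (f x) * g x) * this
  rw [h] at h2
  linear_combination (1 / 2 : ℂ) * h2

theorem sphereNormSq_sum_smul {ι : Type*} (s : Finset ι) (m : ι → ℤ) (hm : Function.Injective m)
    (g : ι → C(𝕊², ℂ)) (hg : ∀ i ∈ s, IsWeightFunction (m i) (g i)) (v : ι → ℂ) :
    sphereNormSq (∑ i ∈ s, v i • g i) = ∑ i ∈ s, ‖v i‖ ^ 2 * sphereNormSq (g i) := by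
  have h := spherePair_self (∑ i ∈ s, v i • g i)
  rw [spherePair_sum_smul] at h
  have h2 : ∀ i ∈ s, spherePair (∑ j ∈ s, v j • g j) (g i) =
      star (v i) * sphereNormSq (g i) := by
    intro i hi
    rw [sum_smul_spherePair, Finset.sum_eq_single i, spherePair_self]
    · intro j hj hji
      rw [(hg j hj).spherePair_eq_zero (fun h => hji (hm h)) (hg i hi), mul_zero]
    · exact fun h => absurd hi h
  rw [Finset.sum_congr rfl fun i hi => by rw [h2 i hi, ← mul_assoc, ← starRingEnd_apply,
    Complex.mul_conj, Complex.normSq_eq_norm_sq]] at h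
  exact_mod_cast h.symm

theorem sum_range_exp_two_pi {N : ℕ} {d : ℤ} (hd : |d| < N) :
    ∑ j ∈ Finset.range N, Complex.exp (d * (2 * Real.pi * j / N) * Complex.I) =
      if d = 0 then (N : ℂ) else 0 := by
  split_ifs with h
  · simp [h]
  have hN : (N : ℂ) ≠ 0 := by
    have : 0 < N := by have := abs_nonneg d; omega
    exact_mod_cast this.ne'
  set z := Complex.exp (d * (2 * Real.pi / N) * Complex.I) with hz
  have hzN : z ^ N = 1 := by
    rw [hz, ← Complex.exp_nat_mul, Complex.exp_eq_one_iff]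
    exact ⟨d, by field_simp⟩
  have hz1 : z ≠ 1 := by
    rw [hz, Ne, Complex.exp_eq_one_iff]
    rintro ⟨n, hn⟩
    have hpi : (Real.pi : ℂ) ≠ 0 := by exact_mod_cast Real.pi_ne_zero
    field_simp at hn
    have h3 : (d : ℂ) = N * n := by linear_combination hn
    have h4 : d = N * n := by exact_mod_cast h3
    have hn0 : n ≠ 0 := by rintro rfl; simp at h4; exact h h4
    have : (N : ℤ) ≤ |d| := by
      rw [h4, abs_mul, Nat.abs_cast]
      have := Int.one_le_abs hn0
      nlinarith
    omega
  have : ∀ j ∈ Finset.range N, Complex.exp (d * (2 * Real.pi * j / N) * Complex.I) = z ^ j := by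
    intro j _
    rw [hz, ← Complex.exp_nat_mul]
    congr 1
    ring
  rw [Finset.sum_congr rfl this, geom_sum_eq hz1, hzN, sub_self, zero_div]

theorem exists_expansion_axisRotation {k : ℕ} {f : C(𝕊², ℂ)} (hf : f ∈ sphericalHarmonic k)
    (x : 𝕊²) : ∃ c : ℕ → ℂ, ∀ φ : ℝ, f (sphereMap (axisRotation φ) x) =
      ∑ i ∈ Finset.range (2 * k + 1), c i * Complex.exp (((i - k : ℤ) : ℂ) * φ * Complex.I) := by
  obtain ⟨P, hP, hfP⟩ := mem_sphericalHarmonic.1 hf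
  have hPh := (mem_solidHarmonic.1 hP).1
  set a : ℂ := ((x : ℝ³) 0 : ℂ)
  set b : ℂ := ((x : ℝ³) 1 : ℂ)
  set c : ℂ := ((x : ℝ³) 2 : ℂ)
  let g : Fin 3 → Polynomial ℂ := ![
    Polynomial.C (a / 2) * (Polynomial.X ^ 2 + 1) +
      Polynomial.C (b * Complex.I / 2) * (Polynomial.X ^ 2 - 1),
    Polynomial.C (-a * Complex.I / 2) * (Polynomial.X ^ 2 - 1) +
      Polynomial.C (b / 2) * (Polynomial.X ^ 2 + 1),
    Polynomial.C c * Polynomial.X]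
  set q : Polynomial ℂ := aeval g P
  have hq : q.natDegree < 2 * k + 1 := by
    have := MvPolynomial.aeval_natDegree_le (m := k) (n := 2) P hPh.totalDegree_le g (by
      intro i
      fin_cases i
      · change (Polynomial.C (a / 2) * (Polynomial.X ^ 2 + 1) +
          Polynomial.C (b * Complex.I / 2) * (Polynomial.X ^ 2 - 1)).natDegree ≤ 2
        compute_degree
      · change (Polynomial.C (-a * Complex.I / 2) * (Polynomial.X ^ 2 - 1) +
          Polynomial.C (b / 2) * (Polynomial.X ^ 2 + 1)).natDegree ≤ 2
        compute_degree
      · change (Polynomial.C c * Polynomial.X).natDegree ≤ 2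
        compute_degree
        norm_num)
    exact Nat.lt_succ_of_le (by rwa [mul_comm] at this)
  refine ⟨fun i => q.coeff i, fun φ => ?_⟩
  set ζ := Complex.exp (φ * Complex.I) with hζ
  have hζ0 : ζ ≠ 0 := Complex.exp_ne_zero _
  have hcos : ζ * Complex.cos φ = (ζ ^ 2 + 1) / 2 := by
    have : Complex.exp (-φ * Complex.I) * ζ = 1 := by
      rw [hζ, ← Complex.exp_add]
      simp
    rw [Complex.cos, ← hζ]
    linear_combination this / 2
  have hsin : ζ * Complex.sin φ = -Complex.I * (ζ ^ 2 - 1) / 2 := by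
    have : Complex.exp (-φ * Complex.I) * ζ = 1 := by
      rw [hζ, ← Complex.exp_add]
      simp
    rw [Complex.sin, ← hζ]
    linear_combination Complex.I * this / 2
  have h1 : q.eval ζ = ζ ^ k * f (sphereMap (axisRotation φ) x) := by
    rw [hfP, evalAt_eq, ← eval_smul_of_isHomogeneous hPh, ← Polynomial.coe_aeval_eq_eval,
      ← coe_aeval_eq_eval]
    change ((Polynomial.aeval ζ).comp (aeval g)) P = aeval _ P
    rw [comp_aeval]
    congr 2
    funext i
    fin_cases i
    · simp [g, axisRotation_apply]
      linear_combination -a * hcos + b * hsin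
    · simp [g, axisRotation_apply]
      linear_combination -b * hcos - a * hsin
    · simp [g, axisRotation_apply, c, mul_comm ζ]
  rw [Polynomial.eval_eq_sum_range' hq] at h1
  have h2 : f (sphereMap (axisRotation φ) x) =
      (∑ i ∈ Finset.range (2 * k + 1), q.coeff i * ζ ^ i) / ζ ^ k := by
    rw [h1]
    field_simp
  rw [h2, Finset.sum_div]
  refine Finset.sum_congr rfl fun i _ => ?_
  rw [mul_div_assoc]
  congr 1
  rw [hζ, ← Complex.exp_nat_mul, ← Complex.exp_nat_mul, ← Complex.exp_sub]
  congr 1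
  push_cast
  ring

/-- The discrete rotation by `2πj/(2k+1)` about the third axis. -/
noncomputable def stepRotation (k j : ℕ) : ℝ³ ≃ₗᵢ[ℝ] ℝ³ :=
  axisRotation (2 * Real.pi * j / (2 * k + 1 : ℕ))

/-- Decomposition of a spherical harmonic into weight functions. -/
theorem exists_weight_decomposition {k : ℕ} {f : C(𝕊², ℂ)} (hf : f ∈ sphericalHarmonic k) :
    ∃ g : ℕ → C(𝕊², ℂ), (∀ i, g i ∈ sphericalHarmonic k) ∧
      (∀ i ∈ Finset.range (2 * k + 1), IsWeightFunction (i - k) (g i)) ∧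
      f = ∑ i ∈ Finset.range (2 * k + 1), g i := by
  choose c hc using fun x => exists_expansion_axisRotation hf x
  set N := 2 * k + 1 with hN
  have hN0 : (N : ℂ) ≠ 0 := by rw [hN]; exact_mod_cast Nat.succ_ne_zero (2 * k)
  let g : ℕ → C(𝕊², ℂ) := fun i => (N : ℂ)⁻¹ • ∑ j ∈ Finset.range N,
    Complex.exp (-((i - k : ℤ) : ℂ) * (2 * Real.pi * j / N) * Complex.I) •
      rotate (stepRotation k j) f
  have hg : ∀ i ∈ Finset.range N, ∀ (φ : ℝ) (x : 𝕊²), g i (sphereMap (axisRotation φ) x) =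
      Complex.exp (((i - k : ℤ) : ℂ) * φ * Complex.I) * c x i := by
    intro i hi φ x
    have e : ∀ j ∈ Finset.range N,
        Complex.exp (-((i - k : ℤ) : ℂ) * (2 * Real.pi * j / N) * Complex.I) *
          f (sphereMap (stepRotation k j) (sphereMap (axisRotation φ) x)) =
        ∑ l ∈ Finset.range N, c x l * Complex.exp (((l - k : ℤ) : ℂ) * φ * Complex.I) *
          Complex.exp (((l - i : ℤ) : ℂ) * (2 * Real.pi * j / N) * Complex.I) := by
      intro j _
      rw [stepRotation, sphereMap_axisRotation_add, hc, Finset.mul_sum]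
      refine Finset.sum_congr rfl fun l _ => ?_
      rw [mul_left_comm, ← Complex.exp_add, mul_assoc (c x l), ← Complex.exp_add]
      congr 2
      push_cast [hN]
      ring
    simp only [g, ContinuousMap.coe_smul, ContinuousMap.coe_sum, Pi.smul_apply, Finset.sum_apply,
      smul_eq_mul, rotate_apply]
    rw [Finset.sum_congr rfl e, Finset.sum_comm]
    simp_rw [← Finset.mul_sum]
    rw [Finset.sum_eq_single i]
    · rw [sum_range_exp_two_pi (by simp [hN])]
      simp only [sub_self, if_true]
      field_simp
    · intro l hl hli
      rw [Finset.mem_range] at hi hl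
      rw [sum_range_exp_two_pi (abs_lt.2 ⟨by omega, by omega⟩), if_neg (by omega), mul_zero]
    · exact fun h => absurd hi h
  have hg0 : ∀ i ∈ Finset.range N, ∀ x, g i x = c x i := fun i hi x => by
    have := hg i hi 0 x
    rw [sphereMap_axisRotation_zero] at this
    simpa using this
  refine ⟨g, fun i => ?_, fun i hi φ x => ?_, ?_⟩
  · exact Submodule.smul_mem _ _ (Submodule.sum_mem _ fun j _ =>
      Submodule.smul_mem _ _ (rotate_mem _ hf))
  · rw [hg i hi, hg0 i hi]
  · ext x
    have := hc x 0
    rw [sphereMap_axisRotation_zero] at this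
    rw [this, ContinuousMap.coe_sum, Finset.sum_apply]
    refine Finset.sum_congr rfl fun i hi => ?_
    rw [hg0 i hi]
    simp

/-- Weight functions of weight below the turning point are bounded near the equator. -/
theorem exists_norm_sq_weightFunction_le : ∃ C : ℝ, 0 < C ∧ ∀ (k : ℕ), 20 ≤ k → ∀ m : ℤ,
    (m : ℝ) ^ 2 ≤ 65 / 100 * (k * (k + 1)) → ∀ g ∈ sphericalHarmonic k, IsWeightFunction m g →
      ∀ x : 𝕊², |(x : ℝ³) 2| ≤ 1 / 2 → ‖g x‖ ^ 2 ≤ C * sphereNormSq g := by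
  obtain ⟨c, hc0, hctop, hc⟩ := exists_map_sphereMeasure_height
  have hcpos : 0 < c.toReal := ENNReal.toReal_pos hc0 hctop
  refine ⟨90 / c.toReal, by positivity, fun k hk m hm g hg hgm x hx => ?_⟩
  obtain ⟨P, hP, hgP⟩ := mem_sphericalHarmonic.1 hg
  have hw : HasWeight m P := by
    intro a s φ h
    rw [← evalAt_spherePoint h, ← evalAt_spherePoint_zero h, ← hgP, ← hgP,
      ← sphereMap_axisRotation_spherePoint, hgm]
    simp
  have hnorm : ∀ y : 𝕊², ‖g y‖ = ‖meridian P ((y : ℝ³) 2)‖ := by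
    intro y
    obtain ⟨h, φ, hy⟩ := exists_eq_sphereMap_axisRotation y
    conv_lhs => rw [hy]
    rw [hgm.norm_eq, hgP, evalAt_spherePoint_zero, meridian]
  have hcont : Continuous fun t => ‖meridian P t‖ ^ 2 := (continuous_meridian P).norm.pow 2
  have hintg : sphereNormSq g = c.toReal * ∫ t in Set.Ioo (-1 : ℝ) 1, ‖meridian P t‖ ^ 2 := by
    rw [sphereNormSq, ← smul_eq_mul, ← integral_smul_measure, ← hc,
      integral_map continuous_sphere_height.aemeasurable hcont.aestronglyMeasurable]
    exact integral_congr_ae (ae_of_all _ fun y => by simp only [hnorm])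
  have hmono : ∫ t in (0 : ℝ)..(1 / 2), ‖meridian P t‖ ^ 2 ≤
      ∫ t in Set.Ioo (-1 : ℝ) 1, ‖meridian P t‖ ^ 2 := by
    rw [intervalIntegral.integral_of_le (by norm_num)]
    refine setIntegral_mono_set ?_ (ae_of_all _ fun t => by positivity)
      (LE.le.eventuallyLE fun t ht => ⟨by linarith [ht.1], by linarith [ht.2]⟩)
    exact (hcont.integrableOn_Icc (a := -1) (b := 1)).mono_set Set.Ioo_subset_Icc_self
  have hk' : (20 : ℝ) ≤ k := by exact_mod_cast hk
  have hd1 : ∀ s ∈ Set.Icc (-1 / 2 : ℝ) (1 / 2), HasDerivAt (meridian P)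
      (meridianFlux k P s / ((1 - s ^ 2 : ℝ) : ℂ)) s := fun s hs =>
    hasDerivAt_meridian_flux hP ⟨by linarith [hs.1], by linarith [hs.2]⟩
  have hd2 : ∀ s ∈ Set.Icc (-1 / 2 : ℝ) (1 / 2), HasDerivAt (meridianFlux k P)
      (-(((k * (k + 1) - (m : ℝ) ^ 2 / (1 - s ^ 2) : ℝ) : ℂ) * meridian P s)) s := fun s hs =>
    hasDerivAt_meridianFlux hP hw ⟨by linarith [hs.1], by linarith [hs.2]⟩
  have ht : (x : ℝ³) 2 ∈ Set.Icc (-1 / 2 : ℝ) (1 / 2) := by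
    rw [abs_le] at hx
    exact ⟨by linarith [hx.1], hx.2⟩
  have hre := assocLegendre_sup_le (l := k * (k + 1)) (μ := (m : ℝ) ^ 2) (by nlinarith)
    (by positivity) hm (u := fun s => (meridian P s).re) (w := fun s => (meridianFlux k P s).re)
    (fun s hs => by
      have := (Complex.reCLM.hasFDerivAt.comp_hasDerivAt s (hd1 s hs))
      rwa [Complex.reCLM_apply, Complex.div_ofReal_re] at this)
    (fun s hs => by
      have := (Complex.reCLM.hasFDerivAt.comp_hasDerivAt s (hd2 s hs))
      rwa [Complex.reCLM_apply, Complex.neg_re, Complex.re_ofReal_mul] at this) ht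
  have him := assocLegendre_sup_le (l := k * (k + 1)) (μ := (m : ℝ) ^ 2) (by nlinarith)
    (by positivity) hm (u := fun s => (meridian P s).im) (w := fun s => (meridianFlux k P s).im)
    (fun s hs => by
      have := (Complex.imCLM.hasFDerivAt.comp_hasDerivAt s (hd1 s hs))
      rwa [Complex.imCLM_apply, Complex.div_ofReal_im] at this)
    (fun s hs => by
      have := (Complex.imCLM.hasFDerivAt.comp_hasDerivAt s (hd2 s hs))
      rwa [Complex.imCLM_apply, Complex.neg_im, Complex.im_ofReal_mul] at this) ht
  have hsplit : ∫ s in (0 : ℝ)..(1 / 2), ‖meridian P s‖ ^ 2 =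
      (∫ s in (0 : ℝ)..(1 / 2), (meridian P s).re ^ 2) +
        ∫ s in (0 : ℝ)..(1 / 2), (meridian P s).im ^ 2 := by
    have h1 : Continuous fun s => (meridian P s).re ^ 2 :=
      (Complex.continuous_re.comp (continuous_meridian P)).pow 2
    have h2 : Continuous fun s => (meridian P s).im ^ 2 :=
      (Complex.continuous_im.comp (continuous_meridian P)).pow 2
    rw [← intervalIntegral.integral_add (h1.intervalIntegrable _ _) (h2.intervalIntegrable _ _)]
    refine intervalIntegral.integral_congr fun s _ => ?_
    simp only [Complex.sq_norm, Complex.normSq_apply]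
    ring
  calc ‖g x‖ ^ 2 = (meridian P ((x : ℝ³) 2)).re ^ 2 + (meridian P ((x : ℝ³) 2)).im ^ 2 := by
        rw [hnorm, Complex.sq_norm, Complex.normSq_apply]
        ring
    _ ≤ 90 * ∫ s in (0 : ℝ)..(1 / 2), ‖meridian P s‖ ^ 2 := by
        rw [hsplit]
        linarith
    _ ≤ 90 * ∫ t in Set.Ioo (-1 : ℝ) 1, ‖meridian P t‖ ^ 2 := by gcongr
    _ = _ := by
        rw [hintg]
        field_simp

theorem sum_norm_sq_stepRotation {k : ℕ} {g : ℕ → C(𝕊², ℂ)}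
    (hg : ∀ i ∈ Finset.range (2 * k + 1), IsWeightFunction (i - k) (g i)) (x : 𝕊²) :
    ∑ j ∈ Finset.range (2 * k + 1),
      ‖(∑ i ∈ Finset.range (2 * k + 1), g i) (sphereMap (stepRotation k j) x)‖ ^ 2 =
      (2 * k + 1 : ℕ) * ∑ i ∈ Finset.range (2 * k + 1), ‖g i x‖ ^ 2 := by
  set N := 2 * k + 1 with hN
  have e : ∀ j ∈ Finset.range N,
      ((‖(∑ i ∈ Finset.range N, g i) (sphereMap (stepRotation k j) x)‖ ^ 2 : ℝ) : ℂ) =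
      ∑ i ∈ Finset.range N, ∑ l ∈ Finset.range N, starRingEnd ℂ (g i x) * g l x *
        Complex.exp (((l - i : ℤ) : ℂ) * (2 * Real.pi * j / N) * Complex.I) := by
    intro j _
    rw [Complex.ofReal_pow, ← Complex.conj_mul', ContinuousMap.coe_sum, Finset.sum_apply, map_sum,
      Finset.sum_mul_sum]
    refine Finset.sum_congr rfl fun i hi => Finset.sum_congr rfl fun l hl => ?_
    rw [stepRotation, hg i hi, hg l hl, map_mul, ← Complex.exp_conj]
    rw [mul_mul_mul_comm, ← Complex.exp_add, mul_comm]
    congr 2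
    simp only [map_mul, Complex.conj_I, Complex.conj_ofReal, map_intCast]
    push_cast [hN]
    ring
  have : ((∑ j ∈ Finset.range N,
      ‖(∑ i ∈ Finset.range N, g i) (sphereMap (stepRotation k j) x)‖ ^ 2 : ℝ) : ℂ) =
      ((N * ∑ i ∈ Finset.range N, ‖g i x‖ ^ 2 : ℝ) : ℂ) := by
    rw [Complex.ofReal_sum, Finset.sum_congr rfl e, Finset.sum_comm]
    rw [Complex.ofReal_mul, Complex.ofReal_sum, Finset.mul_sum]
    refine Finset.sum_congr rfl fun i hi => ?_
    rw [Finset.sum_comm]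
    simp_rw [← Finset.mul_sum]
    rw [Finset.sum_eq_single i, sum_range_exp_two_pi (by simp [hN]), Complex.ofReal_pow,
      ← Complex.conj_mul']
    · simp [mul_comm]
    · intro l hl hli
      rw [Finset.mem_range] at hi hl
      rw [sum_range_exp_two_pi (abs_lt.2 ⟨by omega, by omega⟩), if_neg (by omega), mul_zero]
    · exact fun h => absurd hi h
  exact_mod_cast this

/-- The Fejér weights on the group of rotations by multiples of `2π/(2k+1)`. -/
noncomputable def fejerWeight (k n j : ℕ) : ℝ :=
  ‖∑ a ∈ Finset.range n, Complex.exp (a * (2 * Real.pi * j / (2 * k + 1 : ℕ)) * Complex.I)‖ ^ 2 /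
    ((2 * k + 1 : ℕ) * n)

/-- The Fourier coefficients of the Fejér weights. -/
noncomputable def fejerCoeff (n : ℕ) (m : ℤ) : ℝ :=
  (∑ a ∈ Finset.range n, ∑ b ∈ Finset.range n, if (a : ℤ) + m = b then (1 : ℝ) else 0) / n

theorem fejerWeight_nonneg (k n j : ℕ) : 0 ≤ fejerWeight k n j := by
  rw [fejerWeight]
  positivity

theorem sum_fejerWeight_mul_exp {k n : ℕ} (hn : n ≤ k + 1) {m : ℤ} (hm : |m| ≤ k) :
    ∑ j ∈ Finset.range (2 * k + 1), (fejerWeight k n j : ℂ) *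
      Complex.exp (m * (2 * Real.pi * j / (2 * k + 1 : ℕ)) * Complex.I) = fejerCoeff n m := by
  set N := 2 * k + 1 with hN
  have hN0 : (N : ℂ) ≠ 0 := by rw [hN]; exact_mod_cast Nat.succ_ne_zero (2 * k)
  have e : ∀ j ∈ Finset.range N, (fejerWeight k n j : ℂ) *
      Complex.exp (m * (2 * Real.pi * j / N) * Complex.I) =
      (∑ a ∈ Finset.range n, ∑ b ∈ Finset.range n,
        Complex.exp (((a + m - b : ℤ) : ℂ) * (2 * Real.pi * j / N) * Complex.I)) / (N * n) := by
    intro j _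
    rw [fejerWeight, ← hN, Complex.ofReal_div, Complex.ofReal_pow, Complex.ofReal_mul,
      Complex.ofReal_natCast, Complex.ofReal_natCast, div_mul_eq_mul_div,
      ← Complex.mul_conj', map_sum, Finset.sum_mul_sum, Finset.sum_mul]
    congr 1
    refine Finset.sum_congr rfl fun a _ => ?_
    rw [Finset.sum_mul]
    refine Finset.sum_congr rfl fun b _ => ?_
    rw [← Complex.exp_conj, ← Complex.exp_add, ← Complex.exp_add]
    congr 1
    simp only [map_mul, Complex.conj_I, Complex.conj_ofReal, map_natCast, map_div₀, map_ofNat]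
    push_cast [hN]
    ring
  rw [Finset.sum_congr rfl e, ← Finset.sum_div, Finset.sum_comm]
  have e2 : ∀ a ∈ Finset.range n, ∑ j ∈ Finset.range N, ∑ b ∈ Finset.range n,
      Complex.exp (((a + m - b : ℤ) : ℂ) * (2 * Real.pi * j / N) * Complex.I) =
      N * ∑ b ∈ Finset.range n, if (a : ℤ) + m = b then (1 : ℂ) else 0 := by
    intro a ha
    rw [Finset.sum_comm, Finset.mul_sum]
    refine Finset.sum_congr rfl fun b hb => ?_
    rw [Finset.mem_range] at ha hb
    rw [abs_le] at hm
    rw [sum_range_exp_two_pi (abs_lt.2 ⟨by omega, by omega⟩)]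
    simp [sub_eq_zero]
  rw [Finset.sum_congr rfl e2, ← Finset.mul_sum, mul_div_mul_left _ _ hN0, fejerCoeff]
  push_cast
  congr 1
  refine Finset.sum_congr rfl fun a _ => Finset.sum_congr rfl fun b _ => ?_
  split_ifs <;> simp

theorem fejerCoeff_eq (n : ℕ) (m : ℤ) : fejerCoeff n m =
    (∑ a ∈ Finset.range n, if 0 ≤ (a : ℤ) + m ∧ (a : ℤ) + m < n then (1 : ℝ) else 0) / n := by
  rw [fejerCoeff]
  congr 1
  refine Finset.sum_congr rfl fun a _ => ?_
  split_ifs with h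
  · rw [Finset.sum_eq_single ((a : ℤ) + m).toNat]
    · rw [if_pos (by omega)]
    · intro b _ hb
      rw [if_neg (by omega)]
    · intro hb
      rw [Finset.mem_range] at hb
      omega
  · refine Finset.sum_eq_zero fun b hb => ?_
    rw [Finset.mem_range] at hb
    rw [if_neg (by omega)]

theorem fejerCoeff_nonneg (n : ℕ) (m : ℤ) : 0 ≤ fejerCoeff n m := by
  rw [fejerCoeff]
  positivity

theorem fejerCoeff_le_one (n : ℕ) (m : ℤ) : fejerCoeff n m ≤ 1 := by
  rw [fejerCoeff_eq]
  refine div_le_one_of_le₀ ?_ (by positivity)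
  calc _ ≤ ∑ a ∈ Finset.range n, (1 : ℝ) := Finset.sum_le_sum fun a _ => by split_ifs <;> norm_num
    _ = n := by simp

theorem fejerCoeff_zero {n : ℕ} (hn : 0 < n) : fejerCoeff n 0 = 1 := by
  have hn' : (n : ℝ) ≠ 0 := by exact_mod_cast hn.ne'
  rw [fejerCoeff_eq, Finset.sum_congr rfl fun a ha => if_pos (by
    rw [Finset.mem_range] at ha
    omega)]
  simp [hn']

theorem fejerCoeff_eq_zero {n : ℕ} {m : ℤ} (h : n ≤ |m|) : fejerCoeff n m = 0 := by
  rw [fejerCoeff_eq, Finset.sum_eq_zero, zero_div]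
  intro a ha
  rw [Finset.mem_range] at ha
  rw [if_neg]
  rcases le_abs'.1 h with h | h <;> omega

theorem one_sub_fejerCoeff_le {n : ℕ} (hn : 0 < n) (m : ℤ) :
    1 - fejerCoeff n m ≤ |(m : ℝ)| / n := by
  have hn' : (n : ℝ) ≠ 0 := by exact_mod_cast hn.ne'
  have h1 : 1 - fejerCoeff n m = (∑ a ∈ Finset.range n,
      if 0 ≤ (a : ℤ) + m ∧ (a : ℤ) + m < n then (0 : ℝ) else 1) / n := by
    rw [fejerCoeff_eq, eq_div_iff hn', sub_mul, div_mul_cancel₀ _ hn', one_mul, sub_eq_iff_eq_add,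
      ← Finset.sum_add_distrib, Finset.sum_congr rfl (g := fun _ => (1 : ℝ))]
    · simp
    · intro a _
      split_ifs <;> norm_num
  rw [h1]
  gcongr
  have h2 : ∀ a ∈ Finset.range n, (if 0 ≤ (a : ℤ) + m ∧ (a : ℤ) + m < n then (0 : ℝ) else 1) =
      if ¬(0 ≤ (a : ℤ) + m ∧ (a : ℤ) + m < n) then (1 : ℝ) else 0 := by
    intro a _
    split_ifs <;> simp_all
  rw [Finset.sum_congr rfl h2, Finset.sum_boole]
  have h3 : ((Finset.range n).filter fun a : ℕ => ¬(0 ≤ (a : ℤ) + m ∧ (a : ℤ) + m < n)).card ≤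
      m.natAbs := by
    rcases le_total 0 m with h0 | h0
    · calc _ ≤ (Finset.Ico (n - m.natAbs) n).card := Finset.card_le_card fun a ha => by
            rw [Finset.mem_filter, Finset.mem_range] at ha
            rw [Finset.mem_Ico]
            omega
        _ ≤ _ := by
          rw [Nat.card_Ico]
          omega
    · calc _ ≤ (Finset.range m.natAbs).card := Finset.card_le_card fun a ha => by
            rw [Finset.mem_filter, Finset.mem_range] at ha
            rw [Finset.mem_range]
            omega
        _ ≤ _ := by simp
  calc _ ≤ (m.natAbs : ℝ) := by exact_mod_cast h3
    _ = _ := by rw [Nat.cast_natAbs, Int.cast_abs]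

theorem sum_fejerWeight {k n : ℕ} (hn0 : 0 < n) (hn : n ≤ k + 1) :
    ∑ j ∈ Finset.range (2 * k + 1), fejerWeight k n j = 1 := by
  have := sum_fejerWeight_mul_exp hn (m := 0) (by simp)
  simp only [Int.cast_zero, zero_mul, Complex.exp_zero, mul_one, fejerCoeff_zero hn0] at this
  exact_mod_cast this

/-- Fejér averaging over rotations about the third axis. -/
noncomputable def fejerAverage (k n : ℕ) : C(𝕊², ℂ) →ₗ[ℂ] C(𝕊², ℂ) :=
  ∑ j ∈ Finset.range (2 * k + 1), (fejerWeight k n j : ℂ) • rotate (stepRotation k j)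

theorem fejerAverage_apply (k n : ℕ) (f : C(𝕊², ℂ)) (x : 𝕊²) :
    fejerAverage k n f x = ∑ j ∈ Finset.range (2 * k + 1),
      (fejerWeight k n j : ℂ) * f (sphereMap (stepRotation k j) x) := by
  simp [fejerAverage, LinearMap.sum_apply]

theorem fejerAverage_mem {k : ℕ} (n : ℕ) {f : C(𝕊², ℂ)} (hf : f ∈ sphericalHarmonic k) :
    fejerAverage k n f ∈ sphericalHarmonic k := by
  rw [fejerAverage, LinearMap.sum_apply]
  exact Submodule.sum_mem _ fun j _ => Submodule.smul_mem _ _ (rotate_mem _ hf)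

theorem fejerAverage_of_weight {k n : ℕ} (hn : n ≤ k + 1) {m : ℤ} (hm : |m| ≤ k)
    {g : C(𝕊², ℂ)} (hg : IsWeightFunction m g) :
    fejerAverage k n g = (fejerCoeff n m : ℂ) • g := by
  ext x
  rw [fejerAverage_apply, ContinuousMap.smul_apply, smul_eq_mul, ← sum_fejerWeight_mul_exp hn hm,
    Finset.sum_mul]
  refine Finset.sum_congr rfl fun j _ => ?_
  rw [stepRotation, hg]
  push_cast
  ring

/-- The duality step of the `TT*` argument. -/
theorem sq_lintegral_pow_six_le {n : ℕ} (c : Fin n → ℂ) (ψ : Fin n → C(𝕊², ℂ)) (F : C(𝕊², ℂ))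
    (hF : F = ∑ i, c i • ψ i) (B : Set 𝕊²) :
    (∫⁻ x in B, ‖F x‖ₑ ^ 6 ∂sphereMeasure) ^ 2 ≤
      ENNReal.ofReal (∑ i, ‖c i‖ ^ 2) * ∫⁻ x in B, ∫⁻ y in B,
        ‖F x‖ₑ ^ 5 * (‖F y‖ₑ ^ 5 * ‖∑ i, ψ i x * star (ψ i y)‖ₑ) ∂sphereMeasure ∂sphereMeasure := by
  set ν := sphereMeasure.restrict B
  have hintg : ∀ {g : 𝕊² → ℂ}, Continuous g → Integrable g ν := fun hg =>
    (integrable_of_continuous hg).restrict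
  let G : 𝕊² → ℂ := fun x => (‖F x‖ ^ 4 : ℝ) * star (F x)
  have hG : Continuous G := by fun_prop
  have hGn : ∀ x, ‖G x‖ₑ = ‖F x‖ₑ ^ 5 := fun x => by
    have : ‖G x‖ = ‖F x‖ ^ 5 := by
      simp only [G]
      rw [norm_mul, norm_star, Complex.norm_of_nonneg (by positivity), ← pow_succ]
    rw [← ofReal_norm, this, ENNReal.ofReal_pow (norm_nonneg _), ofReal_norm]
  let a : Fin n → ℂ := fun i => ∫ x, ψ i x * G x ∂ν
  have hFG : ∀ x, F x * G x = (‖F x‖ ^ 6 : ℝ) := fun x => by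
    simp only [G]
    rw [mul_left_comm, ← starRingEnd_apply, Complex.mul_conj']
    push_cast
    ring
  have h1 : ((∫ x, ‖F x‖ ^ 6 ∂ν : ℝ) : ℂ) = ∑ i, c i * a i := by
    rw [← integral_complex_ofReal]
    calc ∫ x, ((‖F x‖ ^ 6 : ℝ) : ℂ) ∂ν = ∫ x, ∑ i, c i * (ψ i x * G x) ∂ν := by
          refine integral_congr_ae (ae_of_all _ fun x => ?_)
          simp only [← hFG]
          conv_lhs => rw [hF]
          simp [Finset.sum_mul, mul_assoc]
      _ = _ := by
          rw [integral_finsetSum _ fun i _ => hintg (by fun_prop)]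
          exact Finset.sum_congr rfl fun i _ => integral_const_mul _ _
  have h2 : (∫ x, ‖F x‖ ^ 6 ∂ν) ^ 2 ≤ (∑ i, ‖c i‖ ^ 2) * ∑ i, ‖a i‖ ^ 2 := by
    refine le_trans ?_ (Finset.sum_mul_sq_le_sq_mul_sq Finset.univ (fun i => ‖c i‖) fun i => ‖a i‖)
    have h0 : 0 ≤ ∫ x, ‖F x‖ ^ 6 ∂ν := integral_nonneg fun x => by positivity
    refine pow_le_pow_left₀ h0 ?_ 2
    rw [← Complex.norm_of_nonneg h0, h1]
    exact (norm_sum_le _ _).trans (by simp)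
  have h3 : ((∑ i, ‖a i‖ ^ 2 : ℝ) : ℂ) =
      ∫ x, G x * ∫ y, star (G y) * ∑ i, ψ i x * star (ψ i y) ∂ν ∂ν := by
    have e : ∀ x, ∫ y, star (G y) * ∑ i, ψ i x * star (ψ i y) ∂ν = ∑ i, ψ i x * star (a i) := by
      intro x
      simp only [Finset.mul_sum]
      rw [integral_finsetSum _ fun i _ => hintg (by fun_prop)]
      refine Finset.sum_congr rfl fun i _ => ?_
      rw [← starRingEnd_apply (a i), ← integral_conj, ← integral_const_mul]
      refine integral_congr_ae (ae_of_all _ fun y => ?_)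
      simp only [map_mul, starRingEnd_apply]
      ring
    simp only [e]
    simp only [Finset.mul_sum]
    rw [integral_finsetSum _ fun i _ => hintg (by fun_prop), Complex.ofReal_sum]
    refine Finset.sum_congr rfl fun i _ => ?_
    rw [Complex.ofReal_pow, ← Complex.mul_conj', starRingEnd_apply]
    simp only [a]
    rw [← integral_mul_const]
    refine integral_congr_ae (ae_of_all _ fun y => ?_)
    simp only
    ring
  have h4 : ENNReal.ofReal (∑ i, ‖a i‖ ^ 2) ≤ ∫⁻ x, ∫⁻ y,
      ‖F x‖ₑ ^ 5 * (‖F y‖ₑ ^ 5 * ‖∑ i, ψ i x * star (ψ i y)‖ₑ) ∂ν ∂ν := by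
    have h0 : 0 ≤ ∑ i, ‖a i‖ ^ 2 := by positivity
    rw [← Complex.norm_of_nonneg h0, ofReal_norm, h3]
    refine (enorm_integral_le_lintegral_enorm _).trans (lintegral_mono fun x => ?_)
    rw [enorm_mul, hGn, lintegral_const_mul' _ _ (by finiteness)]
    refine mul_le_mul_right ((enorm_integral_le_lintegral_enorm _).trans
      (lintegral_mono fun y => ?_)) _
    rw [enorm_mul, ← ofReal_norm (star (G y)), norm_star, ofReal_norm, hGn]
  have h5 : ∫⁻ x, ‖F x‖ₑ ^ 6 ∂ν = ENNReal.ofReal (∫ x, ‖F x‖ ^ 6 ∂ν) := by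
    rw [ofReal_integral_eq_lintegral_ofReal _ (ae_of_all _ fun x => by positivity)]
    · refine lintegral_congr fun x => ?_
      rw [ENNReal.ofReal_pow (norm_nonneg _), ofReal_norm]
    · have : Continuous fun x => ‖F x‖ ^ 6 := by fun_prop
      exact (this.integrable_of_hasCompactSupport (HasCompactSupport.of_compactSpace _)).restrict
  calc _ ≤ ENNReal.ofReal ((∑ i, ‖c i‖ ^ 2) * ∑ i, ‖a i‖ ^ 2) := by
        rw [h5, ← ENNReal.ofReal_pow (integral_nonneg fun x => by positivity)]
        exact ENNReal.ofReal_le_ofReal h2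
    _ ≤ _ := by
        rw [ENNReal.ofReal_mul (by positivity)]
        gcongr

theorem norm_sum_fejerAverage_le {k n l : ℕ} {Y : Fin n → C(𝕊², ℂ)} (hl0 : 0 < l)
    (hl : l ≤ k + 1) {M : ℝ} {x y : 𝕊²}
    (hM : ∀ i j, ‖kernelSection Y (sphereMap (stepRotation k j) y)
      (sphereMap (stepRotation k i) x)‖ ≤ M) :
    ‖∑ i, fejerAverage k l (Y i) x * star (fejerAverage k l (Y i) y)‖ ≤ M := by
  have h : ∑ i, fejerAverage k l (Y i) x * star (fejerAverage k l (Y i) y) =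
      ∑ a ∈ Finset.range (2 * k + 1), ∑ b ∈ Finset.range (2 * k + 1),
        ((fejerWeight k l a * fejerWeight k l b : ℝ) : ℂ) *
          kernelSection Y (sphereMap (stepRotation k b) y) (sphereMap (stepRotation k a) x) := by
    have hprod : ∀ i, fejerAverage k l (Y i) x * star (fejerAverage k l (Y i) y) =
        ∑ a ∈ Finset.range (2 * k + 1), ∑ b ∈ Finset.range (2 * k + 1),
          ((fejerWeight k l a * fejerWeight k l b : ℝ) : ℂ) *
            (Y i (sphereMap (stepRotation k a) x) *
              star (Y i (sphereMap (stepRotation k b) y))) := by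
      intro i
      rw [fejerAverage_apply, fejerAverage_apply, star_sum, Finset.sum_mul_sum]
      refine Finset.sum_congr rfl fun a _ => Finset.sum_congr rfl fun b _ => ?_
      rw [star_mul', ← starRingEnd_apply (fejerWeight k l b : ℂ), Complex.conj_ofReal]
      push_cast
      ring
    rw [Finset.sum_congr rfl fun i _ => hprod i, Finset.sum_comm]
    refine Finset.sum_congr rfl fun a _ => ?_
    rw [Finset.sum_comm]
    exact Finset.sum_congr rfl fun b _ => by rw [kernelSection_apply, Finset.mul_sum]
  rw [h]
  calc _ ≤ ∑ a ∈ Finset.range (2 * k + 1), ∑ b ∈ Finset.range (2 * k + 1),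
        fejerWeight k l a * fejerWeight k l b * M := by
        refine (norm_sum_le _ _).trans (Finset.sum_le_sum fun a _ => (norm_sum_le _ _).trans
          (Finset.sum_le_sum fun b _ => ?_))
        have h0 := mul_nonneg (fejerWeight_nonneg k l a) (fejerWeight_nonneg k l b)
        rw [norm_mul, Complex.norm_of_nonneg h0]
        exact mul_le_mul_of_nonneg_left (hM a b) h0
    _ = (∑ a ∈ Finset.range (2 * k + 1), fejerWeight k l a) *
        (∑ b ∈ Finset.range (2 * k + 1), fejerWeight k l b) * M := by
        rw [Finset.sum_mul_sum]
        simp only [Finset.sum_mul]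
    _ = M := by rw [sum_fejerWeight hl0 hl, one_mul, one_mul]

/-- Averaging over the rotations by multiples of `2π/(2k+1)`. -/
noncomputable def stepAverage (k : ℕ) (h : 𝕊² → ℝ≥0∞) (x : 𝕊²) : ℝ≥0∞ :=
  ((2 * k + 1 : ℕ) : ℝ≥0∞)⁻¹ * ∑ j ∈ Finset.range (2 * k + 1), h (sphereMap (stepRotation k j) x)

theorem sphereMap_stepRotation_two (k j : ℕ) (x : 𝕊²) :
    ((sphereMap (stepRotation k j) x : 𝕊²) : ℝ³) 2 = (x : ℝ³) 2 := by
  simp [stepRotation]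

theorem measurable_stepAverage {k : ℕ} {h : 𝕊² → ℝ≥0∞} (hh : Measurable h) :
    Measurable (stepAverage k h) :=
  (Finset.measurable_fun_sum _ fun _ _ =>
    hh.comp (continuous_sphereMap _).measurable).const_mul _

theorem lintegral_stepAverage {k : ℕ} {h : 𝕊² → ℝ≥0∞} (hh : Measurable h) :
    ∫⁻ x, stepAverage k h x ∂sphereMeasure = ∫⁻ x, h x ∂sphereMeasure := by
  have hm : ∀ j, Measurable fun x => h (sphereMap (stepRotation k j) x) := fun j =>
    hh.comp (continuous_sphereMap _).measurable
  simp only [stepAverage]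
  rw [lintegral_const_mul _ (Finset.measurable_fun_sum _ fun j _ => hm j),
    lintegral_finsetSum _ fun j _ => hm j]
  simp only [lintegral_comp_sphereMap, Finset.sum_const, Finset.card_range, nsmul_eq_mul]
  rw [← mul_assoc, ENNReal.inv_mul_cancel (by simp) (ENNReal.natCast_ne_top _), one_mul]

theorem stepAverage_mul {k : ℕ} (h : 𝕊² → ℝ≥0∞) (q : ℝ → ℝ≥0∞) (x : 𝕊²) :
    stepAverage k (fun x => h x * q ((x : ℝ³) 2)) x = stepAverage k h x * q ((x : ℝ³) 2) := by
  simp only [stepAverage, sphereMap_stepRotation_two]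
  rw [← Finset.sum_mul, mul_assoc]

theorem stepAverage_pow_five_le (k : ℕ) (h : 𝕊² → ℝ≥0∞) (x : 𝕊²) :
    stepAverage k (fun x => h x ^ 5) x ≤
      stepAverage k (fun x => h x ^ 2) x ^ (1 / 4 : ℝ) *
        stepAverage k (fun x => h x ^ 6) x ^ (3 / 4 : ℝ) := by
  simp only [stepAverage]
  set c := ((2 * k + 1 : ℕ) : ℝ≥0∞)⁻¹
  have hpq : (4 : ℝ).HolderConjugate (4 / 3) := by constructor <;> norm_num
  have := ENNReal.inner_le_Lp_mul_Lq (Finset.range (2 * k + 1))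
    (fun j => h (sphereMap (stepRotation k j) x) ^ (1 / 2 : ℝ))
    (fun j => h (sphereMap (stepRotation k j) x) ^ (9 / 2 : ℝ)) hpq
  have e1 : ∀ t : ℝ≥0∞, t ^ (1 / 2 : ℝ) * t ^ (9 / 2 : ℝ) = t ^ 5 := fun t => by
    rw [← ENNReal.rpow_add_of_nonneg _ _ (by norm_num) (by norm_num), ← ENNReal.rpow_natCast]
    norm_num
  have e2 : ∀ t : ℝ≥0∞, (t ^ (1 / 2 : ℝ)) ^ (4 : ℝ) = t ^ 2 := fun t => by
    rw [← ENNReal.rpow_mul, ← ENNReal.rpow_natCast]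
    norm_num
  have e3 : ∀ t : ℝ≥0∞, (t ^ (9 / 2 : ℝ)) ^ (4 / 3 : ℝ) = t ^ 6 := fun t => by
    rw [← ENNReal.rpow_mul, ← ENNReal.rpow_natCast]
    norm_num
  simp only [e1, e2, e3] at this
  rw [ENNReal.mul_rpow_of_nonneg _ _ (by norm_num), ENNReal.mul_rpow_of_nonneg _ _ (by norm_num),
    mul_mul_mul_comm, ← ENNReal.rpow_add_of_nonneg _ _ (by norm_num) (by norm_num)]
  norm_num at this ⊢
  gcongr

theorem IsWeightFunction.smul {m : ℤ} {g : C(𝕊², ℂ)} (hg : IsWeightFunction m g) (c : ℂ) :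
    IsWeightFunction m (c • g) := fun φ x => by
  rw [ContinuousMap.smul_apply, ContinuousMap.smul_apply, hg, smul_eq_mul, smul_eq_mul]
  ring

theorem fejerAverage_sum_weight {k n : ℕ} (hn : n ≤ k + 1) {g : ℕ → C(𝕊², ℂ)}
    (hg : ∀ i ∈ Finset.range (2 * k + 1), IsWeightFunction (i - k) (g i)) :
    fejerAverage k n (∑ i ∈ Finset.range (2 * k + 1), g i) =
      ∑ i ∈ Finset.range (2 * k + 1), (fejerCoeff n (i - k) : ℂ) • g i := by
  rw [map_sum]
  refine Finset.sum_congr rfl fun i hi => fejerAverage_of_weight hn ?_ (hg i hi)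
  rw [Finset.mem_range] at hi
  exact abs_le.2 ⟨by omega, by omega⟩

theorem sphereNormSq_sum_weight {k : ℕ} {g : ℕ → C(𝕊², ℂ)}
    (hg : ∀ i ∈ Finset.range (2 * k + 1), IsWeightFunction (i - k) (g i)) (v : ℕ → ℂ) :
    sphereNormSq (∑ i ∈ Finset.range (2 * k + 1), v i • g i) =
      ∑ i ∈ Finset.range (2 * k + 1), ‖v i‖ ^ 2 * sphereNormSq (g i) :=
  sphereNormSq_sum_smul _ (fun i : ℕ => (i - k : ℤ)) (fun a b h => by simpa using h) g hg v

theorem exists_stepAverage_sq_le : ∃ C : ℝ, 0 < C ∧ ∀ k : ℕ, 20 ≤ k →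
    ∀ f ∈ sphericalHarmonic k, ∀ x : 𝕊², |(x : ℝ³) 2| ≤ 1 / 2 →
      stepAverage k (fun y => ‖fejerAverage k ((3 * k + 3) / 4) f y‖ₑ ^ 2) x ≤
        ENNReal.ofReal (C * sphereNormSq f) := by
  obtain ⟨C, hC, h⟩ := exists_norm_sq_weightFunction_le
  refine ⟨C, hC, fun k hk f hf x hx => ?_⟩
  obtain ⟨g, hgk, hgw, rfl⟩ := exists_weight_decomposition hf
  set n := (3 * k + 3) / 4 with hn
  have hnk : n ≤ k + 1 := by omega
  rw [fejerAverage_sum_weight hnk hgw]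
  set N := 2 * k + 1 with hN
  have h1 := sum_norm_sq_stepRotation
    (g := fun i => (fejerCoeff n (i - k) : ℂ) • g i) (fun i hi => (hgw i hi).smul _) x
  have h2 : ∑ i ∈ Finset.range N, ‖((fejerCoeff n (i - k) : ℂ) • g i) x‖ ^ 2 ≤
      C * sphereNormSq (∑ i ∈ Finset.range N, g i) := by
    have h3 := sphereNormSq_sum_weight hgw 1
    simp only [Pi.one_apply, one_smul, norm_one, one_pow, one_mul] at h3
    rw [h3, Finset.mul_sum]
    refine Finset.sum_le_sum fun i hi => ?_
    by_cases him : (n : ℤ) ≤ |(i - k : ℤ)|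
    · simp [fejerCoeff_eq_zero him, mul_nonneg hC.le (sphereNormSq_nonneg _)]
    · have hb : ‖((fejerCoeff n (i - k) : ℂ) • g i) x‖ ≤ ‖g i x‖ := by
        rw [ContinuousMap.smul_apply, norm_smul, Complex.norm_of_nonneg (fejerCoeff_nonneg _ _)]
        exact mul_le_of_le_one_left (norm_nonneg _) (fejerCoeff_le_one _ _)
      refine (pow_le_pow_left₀ (norm_nonneg _) hb 2).trans
        (h k hk (i - k) ?_ (g i) (hgk i) (hgw i hi) x hx)
      have hm : 4 * |(i - k : ℤ)| ≤ 3 * k := by omega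
      have hm' : 4 * |((i - k : ℤ) : ℝ)| ≤ 3 * k := by exact_mod_cast hm
      rw [← sq_abs]
      nlinarith [abs_nonneg ((i - k : ℤ) : ℝ)]
  have hN0 : ((N : ℕ) : ℝ≥0∞) ≠ 0 := by rw [hN]; simp
  simp only [stepAverage]
  rw [ENNReal.inv_mul_le_iff hN0 (ENNReal.natCast_ne_top _)]
  calc _ = ENNReal.ofReal (∑ j ∈ Finset.range N, ‖(∑ i ∈ Finset.range N,
        (fejerCoeff n (i - k) : ℂ) • g i) (sphereMap (stepRotation k j) x)‖ ^ 2) := by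
        rw [ENNReal.ofReal_sum_of_nonneg fun _ _ => by positivity]
        refine Finset.sum_congr rfl fun j _ => ?_
        rw [ENNReal.ofReal_pow (norm_nonneg _), ofReal_norm]
    _ ≤ _ := by
        rw [h1, ENNReal.ofReal_mul (by positivity), ENNReal.ofReal_natCast]
        gcongr

theorem fejerAverage_eq_sum {k l n : ℕ} {Y : Fin n → C(𝕊², ℂ)} (hY : IsHarmonicBasis k n Y)
    {f : C(𝕊², ℂ)} (hf : f ∈ sphericalHarmonic k) :
    fejerAverage k l f = ∑ i, spherePair (Y i) f • fejerAverage k l (Y i) := by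
  conv_lhs => rw [hY.sum_repr f hf, map_sum]
  simp only [map_smul]

theorem exists_enorm_sum_fejerAverage_le : ∃ C : ℝ, 0 < C ∧ ∀ (k n l : ℕ)
    (Y : Fin n → C(𝕊², ℂ)), IsHarmonicBasis k n Y → 1 ≤ k → 0 < l → l ≤ k + 1 → ∀ x y : 𝕊²,
      0 ≤ (x : ℝ³) 2 * (y : ℝ³) 2 →
      ‖∑ i, fejerAverage k l (Y i) x * star (fejerAverage k l (Y i) y)‖ₑ ≤
        ENNReal.ofReal (√(C * k)) *
          ENNReal.ofReal |(x : ℝ³) 2 - (y : ℝ³) 2| ^ (-(1 / 2) : ℝ) := by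
  obtain ⟨C, hC, h⟩ := exists_norm_sq_kernelSection_mul_le
  refine ⟨C, hC, fun k n l Y hY hk hl0 hl x y hxy => ?_⟩
  have hk0 : (0 : ℝ) < k := by exact_mod_cast hk
  rcases eq_or_ne ((x : ℝ³) 2) ((y : ℝ³) 2) with he | he
  · rw [he, sub_self, abs_zero, ENNReal.ofReal_zero, ENNReal.zero_rpow_of_neg (by norm_num),
      ENNReal.mul_top]
    · exact le_top
    · exact (ENNReal.ofReal_pos.2 (Real.sqrt_pos.2 (by positivity))).ne'
  · have hd : 0 < |(x : ℝ³) 2 - (y : ℝ³) 2| := abs_pos.2 (sub_ne_zero.2 he)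
    set d := |(x : ℝ³) 2 - (y : ℝ³) 2| with hdd
    have := norm_sum_fejerAverage_le (Y := Y) (k := k) hl0 hl (M := √(C * k) * d ^ (-(1 / 2) : ℝ))
      (x := x) (y := y) fun i j => by
        have h1 := h k n Y hY hk (sphereMap (stepRotation k i) x) (sphereMap (stepRotation k j) y)
          (by simpa only [sphereMap_stepRotation_two] using hxy)
        simp only [sphereMap_stepRotation_two] at h1
        rw [Real.rpow_neg hd.le, ← Real.sqrt_eq_rpow, ← div_eq_mul_inv,
          ← Real.sqrt_div' _ hd.le]
        exact Real.le_sqrt_of_sq_le ((le_div_iff₀ hd).2 h1)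
    rw [← ofReal_norm, ENNReal.ofReal_rpow_of_pos hd, ← ENNReal.ofReal_mul (by positivity)]
    exact ENNReal.ofReal_le_ofReal this

theorem le_sq_of_sq_le_mul_rpow {K t : ℝ} (ht : 0 ≤ t)
    (h : t ^ 2 ≤ K * t ^ (3 / 2 : ℝ)) : t ≤ K ^ 2 := by
  rcases ht.eq_or_lt with rfl | ht
  · positivity
  have e : t ^ 2 = √t * t ^ (3 / 2 : ℝ) := by
    rw [Real.sqrt_eq_rpow, ← Real.rpow_add ht]
    norm_num
  rw [e] at h
  rw [← Real.sq_sqrt ht.le]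
  exact pow_le_pow_left₀ (Real.sqrt_nonneg _) (le_of_mul_le_mul_right h (by positivity)) 2

theorem lintegral_mul_height {k : ℕ} {h : 𝕊² → ℝ≥0∞} (hh : Measurable h) {q : ℝ → ℝ≥0∞}
    (hq : Measurable q) : ∫⁻ x, h x * q ((x : ℝ³) 2) ∂sphereMeasure =
      ∫⁻ x, stepAverage k h x * q ((x : ℝ³) 2) ∂sphereMeasure := by
  simp only [← stepAverage_mul]
  rw [lintegral_stepAverage]
  exact hh.mul (hq.comp continuous_sphere_height.measurable)

theorem lintegral_lintegral_height {k : ℕ} {h : 𝕊² → ℝ≥0∞} (hh : Measurable h)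
    {T : ℝ → ℝ → ℝ≥0∞} (hT : Measurable fun z : ℝ × ℝ => T z.1 z.2) :
    ∫⁻ x, ∫⁻ y, h x * (h y * T ((x : ℝ³) 2) ((y : ℝ³) 2)) ∂sphereMeasure ∂sphereMeasure =
      ∫⁻ x, ∫⁻ y, stepAverage k h x * (stepAverage k h y * T ((x : ℝ³) 2) ((y : ℝ³) 2))
        ∂sphereMeasure ∂sphereMeasure := by
  have hheight := (continuous_sphere_height).measurable
  have hm : ∀ g : 𝕊² → ℝ≥0∞, Measurable g → ∀ x : 𝕊²,
      Measurable fun y : 𝕊² => g y * T ((x : ℝ³) 2) ((y : ℝ³) 2) := fun g hg x =>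
    hg.mul (hT.comp (measurable_const.prodMk hheight))
  have hA := measurable_stepAverage (k := k) hh
  simp only [lintegral_const_mul _ (hm _ hh _), lintegral_const_mul _ (hm _ hA _)]
  have e : ∀ x : 𝕊², ∫⁻ y, h y * T ((x : ℝ³) 2) ((y : ℝ³) 2) ∂sphereMeasure =
      ∫⁻ y, stepAverage k h y * T ((x : ℝ³) 2) ((y : ℝ³) 2) ∂sphereMeasure := fun x =>
    lintegral_mul_height hh (hT.comp (measurable_const.prodMk measurable_id))
  simp only [e]
  refine lintegral_mul_height hh (q := fun t => ∫⁻ y : 𝕊²,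
    stepAverage k h y * T t ((y : ℝ³) 2) ∂sphereMeasure) ?_
  refine Measurable.lintegral_prod_right' (f := fun z : ℝ × 𝕊² =>
    stepAverage k h z.2 * T z.1 ((z.2 : ℝ³) 2)) ?_
  exact (hA.comp measurable_snd).mul
    (hT.comp (measurable_fst.prodMk (hheight.comp measurable_snd)))

/-- Localized `L⁶` bound for the part of a spherical harmonic of moderate weight. -/
theorem exists_lintegral_fejerAverage_pow_six_le : ∃ C : ℝ, 0 < C ∧ ∀ k : ℕ, 20 ≤ k →
    ∀ f ∈ sphericalHarmonic k, ∀ S : Set ℝ, MeasurableSet S → (∀ t ∈ S, |t| ≤ 1 / 2) →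
      (∀ s ∈ S, ∀ t ∈ S, 0 ≤ s * t) →
      ∫⁻ x in {x : 𝕊² | (x : ℝ³) 2 ∈ S}, ‖fejerAverage k ((3 * k + 3) / 4) f x‖ₑ ^ 6
        ∂sphereMeasure ≤ ENNReal.ofReal (C * k * sphereNormSq f ^ 3) := by
  obtain ⟨C₁, hC₁, h₁⟩ := exists_stepAverage_sq_le
  obtain ⟨C₂, hC₂, h₂⟩ := exists_enorm_sum_fejerAverage_le
  obtain ⟨c, hc0, hctop, hc⟩ := exists_map_sphereMeasure_height
  set H : ℝ≥0∞ := 2 * (4 * c + (2 * c) ^ (1 / 4 : ℝ)) with hH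
  have hHtop : H ≠ ∞ := by finiteness
  have hHpos : 0 < H.toReal := by
    refine ENNReal.toReal_pos ?_ hHtop
    simp [hH, hc0]
  refine ⟨C₁ * C₂ * H.toReal ^ 2, by positivity, fun k hk f hf S hS hS1 hS2 => ?_⟩
  have hheight := (continuous_sphere_height).measurable
  have hmap : sphereMeasure.map (fun x : 𝕊² => (x : ℝ³) 2) ≤ c • volume := by
    rw [hc]
    exact Measure.le_iff.2 fun s _ => by
      simp only [Measure.smul_apply, smul_eq_mul]
      gcongr
      exact Measure.restrict_le_self
  set n := (3 * k + 3) / 4 with hn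
  set F := fejerAverage k n f with hF
  set B : Set 𝕊² := {x : 𝕊² | (x : ℝ³) 2 ∈ S} with hB
  have hBm : MeasurableSet B := hheight hS
  have hFm : Measurable fun x => ‖F x‖ₑ := F.continuous.enorm.measurable
  set χ : ℝ → ℝ≥0∞ := S.indicator 1 with hχ
  have hχm : Measurable χ := measurable_one.indicator hS
  have hχB : ∀ (g : 𝕊² → ℝ≥0∞), ∫⁻ x in B, g x ∂sphereMeasure =
      ∫⁻ x, g x * χ ((x : ℝ³) 2) ∂sphereMeasure := fun g => by
    rw [← lintegral_indicator hBm]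
    refine lintegral_congr fun x => ?_
    by_cases hx : (x : ℝ³) 2 ∈ S
    · simp [hχ, hx, hB]
    · simp [hχ, hx, hB]
  set Q := sphereNormSq f with hQ
  have hQ0 : 0 ≤ Q := sphereNormSq_nonneg f
  set I := ∫⁻ x in B, ‖F x‖ₑ ^ 6 ∂sphereMeasure with hI
  set J : 𝕊² → ℝ≥0∞ := fun x =>
    stepAverage k (fun y => ‖F y‖ₑ ^ 6) x * χ ((x : ℝ³) 2) with hJ
  have hJI : ∫⁻ x, J x ∂sphereMeasure = I := by
    rw [hI, hχB, ← lintegral_mul_height (hFm.pow_const 6) hχm]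
  have hJm : Measurable J :=
    (measurable_stepAverage (hFm.pow_const 6)).mul (hχm.comp hheight)
  have hχle : ∀ t, χ t ≤ 1 := fun t => Set.indicator_le_self' (by simp) t
  have hJtop : ∀ x, J x ≠ ∞ := fun x => by
    refine ENNReal.mul_ne_top (ENNReal.mul_ne_top (by simp) ?_)
      ((hχle _).trans_lt ENNReal.one_lt_top).ne
    exact ENNReal.sum_ne_top.2 fun j _ => by finiteness
  have hItop : I ≠ ∞ := by
    have : Continuous fun x => ‖F x‖ ^ 6 := by fun_prop
    have hfin := (this.integrable_of_hasCompactSupport (μ := sphereMeasure)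
      (HasCompactSupport.of_compactSpace _)).2
    rw [hasFiniteIntegral_iff_enorm] at hfin
    refine ((setLIntegral_le_lintegral B _).trans_lt ?_).ne
    simpa only [enorm_pow, enorm_norm] using hfin
  obtain ⟨d, Y, hY⟩ := exists_isHarmonicBasis k
  set a := ENNReal.ofReal (C₁ * Q) ^ (1 / 4 : ℝ) with ha
  have hstep1 := sq_lintegral_pow_six_le (fun i => spherePair (Y i) f)
    (fun i => fejerAverage k n (Y i)) F (fejerAverage_eq_sum hY hf) B
  rw [← hY.sphereNormSq_eq hf] at hstep1
  have hstep2 : ∫⁻ x in B, ∫⁻ y in B, ‖F x‖ₑ ^ 5 * (‖F y‖ₑ ^ 5 *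
      ‖∑ i, fejerAverage k n (Y i) x * star (fejerAverage k n (Y i) y)‖ₑ)
        ∂sphereMeasure ∂sphereMeasure ≤
      ENNReal.ofReal √(C₂ * k) * (a * a * (H * I ^ (3 / 2 : ℝ))) := by
    let T : ℝ → ℝ → ℝ≥0∞ := fun s t => χ s * (χ t * ENNReal.ofReal |s - t| ^ (-(1 / 2) : ℝ))
    have hT : Measurable fun z : ℝ × ℝ => T z.1 z.2 := by
      refine (hχm.comp measurable_fst).mul ((hχm.comp measurable_snd).mul ?_)
      fun_prop
    calc _ ≤ ∫⁻ x, ∫⁻ y, ENNReal.ofReal √(C₂ * k) * (‖F x‖ₑ ^ 5 * (‖F y‖ₑ ^ 5 *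
          T ((x : ℝ³) 2) ((y : ℝ³) 2))) ∂sphereMeasure ∂sphereMeasure := by
          rw [hχB]
          refine lintegral_mono fun x => ?_
          dsimp only
          rw [hχB, ← lintegral_mul_const' _ _ ((hχle _).trans_lt ENNReal.one_lt_top).ne]
          refine lintegral_mono fun y => ?_
          dsimp only [T]
          by_cases hx : (x : ℝ³) 2 ∈ S
          · by_cases hy : (y : ℝ³) 2 ∈ S
            · simp only [hχ, Set.indicator_of_mem hx, Set.indicator_of_mem hy, Pi.one_apply,
                mul_one, one_mul]
              rw [mul_left_comm (ENNReal.ofReal _), mul_left_comm (ENNReal.ofReal _)]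
              gcongr
              exact h₂ k d n Y hY (by omega) (by omega) (by omega) x y (hS2 _ hx _ hy)
            · simp [hχ, hy]
          · simp [hχ, hx]
      _ = ENNReal.ofReal √(C₂ * k) * ∫⁻ x, ∫⁻ y, stepAverage k (fun y => ‖F y‖ₑ ^ 5) x *
          (stepAverage k (fun y => ‖F y‖ₑ ^ 5) y * T ((x : ℝ³) 2) ((y : ℝ³) 2))
            ∂sphereMeasure ∂sphereMeasure := by
          simp only [lintegral_const_mul' _ _ ENNReal.ofReal_ne_top]
          rw [lintegral_lintegral_height (hFm.pow_const 5) hT]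
      _ ≤ ENNReal.ofReal √(C₂ * k) * ∫⁻ x, ∫⁻ y, a * a * (J x ^ (3 / 4 : ℝ) * J y ^ (3 / 4 : ℝ) *
          ENNReal.ofReal |(x : ℝ³) 2 - (y : ℝ³) 2| ^ (-(1 / 2) : ℝ))
            ∂sphereMeasure ∂sphereMeasure := by
          have hav : ∀ x : 𝕊², stepAverage k (fun y => ‖F y‖ₑ ^ 5) x * χ ((x : ℝ³) 2) ≤
              a * J x ^ (3 / 4 : ℝ) := by
            intro x
            by_cases hx : (x : ℝ³) 2 ∈ S
            · simp only [hJ, hχ, Set.indicator_of_mem hx, Pi.one_apply, mul_one]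
              refine (stepAverage_pow_five_le k _ x).trans ?_
              gcongr
              exact ENNReal.rpow_le_rpow (h₁ k hk f hf x (hS1 _ hx)) (by norm_num)
            · simp [hχ, hx]
          refine mul_le_mul_right (lintegral_mono fun x => lintegral_mono fun y => ?_) _
          calc _ = (stepAverage k (fun y => ‖F y‖ₑ ^ 5) x * χ ((x : ℝ³) 2)) *
                (stepAverage k (fun y => ‖F y‖ₑ ^ 5) y * χ ((y : ℝ³) 2)) *
                ENNReal.ofReal |(x : ℝ³) 2 - (y : ℝ³) 2| ^ (-(1 / 2) : ℝ) := by
                dsimp only [T]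
                ring
            _ ≤ (a * J x ^ (3 / 4 : ℝ)) * (a * J y ^ (3 / 4 : ℝ)) *
                ENNReal.ofReal |(x : ℝ³) 2 - (y : ℝ³) 2| ^ (-(1 / 2) : ℝ) := by
                exact mul_le_mul_left (mul_le_mul' (hav x) (hav y)) _
            _ = _ := by ring
      _ ≤ _ := by
          have hatop : a * a ≠ ∞ := by finiteness
          simp only [lintegral_const_mul' _ _ hatop]
          gcongr
          have := hls_diagonal hheight hmap hJm hJtop (by rwa [hJI])
          rwa [hJI] at this
  have hfinal := hstep1.trans (mul_le_mul_right hstep2 _)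
  have haa : (a * a).toReal = √(C₁ * Q) := by
    rw [ha, ← ENNReal.rpow_add_of_nonneg _ _ (by norm_num) (by norm_num),
      ENNReal.ofReal_rpow_of_nonneg (by positivity) (by norm_num),
      ENNReal.toReal_ofReal (by positivity), Real.sqrt_eq_rpow]
    norm_num
  have hreal := ENNReal.toReal_mono (by finiteness) hfinal
  rw [ENNReal.toReal_pow, ENNReal.toReal_mul, ENNReal.toReal_mul, ENNReal.toReal_mul, haa,
    ENNReal.toReal_mul, ← ENNReal.toReal_rpow, ENNReal.toReal_ofReal hQ0,
    ENNReal.toReal_ofReal (Real.sqrt_nonneg _)] at hreal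
  have := le_sq_of_sq_le_mul_rpow (K := Q * (√(C₂ * k) * (√(C₁ * Q) * H.toReal)))
    ENNReal.toReal_nonneg (hreal.trans_eq (by ring))
  rw [← ENNReal.ofReal_toReal hItop]
  refine ENNReal.ofReal_le_ofReal (this.trans_eq ?_)
  rw [mul_pow, mul_pow, mul_pow, Real.sq_sqrt (by positivity), Real.sq_sqrt (by positivity)]
  ring

/-- The angular derivative `xᵢ∂ⱼ - xⱼ∂ᵢ` on polynomials. -/
noncomputable def angularDeriv (i j : Fin 3) (P : MvPolynomial (Fin 3) ℂ) :
    MvPolynomial (Fin 3) ℂ := X i * pderiv j P - X j * pderiv i P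

theorem evalAt_angularDeriv_angularDeriv {i j : Fin 3} (hij : i ≠ j)
    (P : MvPolynomial (Fin 3) ℂ) (x : ℝ³) :
    evalAt x (angularDeriv i j (angularDeriv i j P)) =
      x i ^ 2 * evalAt x (pderiv j (pderiv j P)) + x j ^ 2 * evalAt x (pderiv i (pderiv i P))
        - 2 * (x i * x j * evalAt x (pderiv i (pderiv j P))) - x i * evalAt x (pderiv i P)
        - x j * evalAt x (pderiv j P) := by
  simp only [angularDeriv, map_sub, pderiv_mul, pderiv_X, map_add, map_mul, evalAt_eq, eval_X,
    Pi.single_eq_same, Pi.single_eq_of_ne hij, Pi.single_eq_of_ne hij.symm, map_zero, map_one,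
    pderiv_pderiv_comm j i]
  ring

theorem sum_angularDeriv {k : ℕ} {P : MvPolynomial (Fin 3) ℂ} (hP : P ∈ solidHarmonic k)
    (x : 𝕊²) : evalAt x (angularDeriv 0 1 (angularDeriv 0 1 P)) +
      evalAt x (angularDeriv 1 2 (angularDeriv 1 2 P)) +
      evalAt x (angularDeriv 2 0 (angularDeriv 2 0 P)) = -(k * (k + 1)) * evalAt x P := by
  obtain ⟨hPh, hPl⟩ := mem_solidHarmonic.1 hP
  set v : Fin 3 → ℂ := fun i => ((x : ℝ³) i : ℂ) with hv
  have hs : v 0 ^ 2 + v 1 ^ 2 + v 2 ^ 2 = 1 := by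
    simp only [hv]
    have := congrArg Complex.ofReal (sphere_sum_sq x)
    simpa using this
  have hl := congrArg (eval v) hPl
  have h1 := sum_mul_eval_pderiv hPh v
  have h2 := sum_mul_eval_pderiv_pderiv hPh v
  have h20 := h2 0
  have h21 := h2 1
  have h22 := h2 2
  simp only [Fin.sum_univ_three, map_add, map_zero] at h1 h20 h21 h22 hl
  rw [evalAt_angularDeriv_angularDeriv (by decide), evalAt_angularDeriv_angularDeriv (by decide),
    evalAt_angularDeriv_angularDeriv (by decide)]
  simp only [evalAt_eq, ← hv]
  simp only [show ((x : ℝ³) 0 : ℂ) = v 0 from rfl, show ((x : ℝ³) 1 : ℂ) = v 1 from rfl,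
    show ((x : ℝ³) 2 : ℂ) = v 2 from rfl]
  rw [pderiv_pderiv_comm 1 0] at h20
  rw [pderiv_pderiv_comm 2 1] at h21
  rw [pderiv_pderiv_comm 0 2] at h22
  linear_combination (v 0 ^ 2 + v 1 ^ 2 + v 2 ^ 2) * hl - v 0 * h20 - v 1 * h21 - v 2 * h22 -
    (k + 1) * h1

/-- The isometry permuting the coordinates. -/
noncomputable def permIsometry (σ : Equiv.Perm (Fin 3)) : ℝ³ ≃ₗᵢ[ℝ] ℝ³ :=
  LinearIsometryEquiv.piLpCongrLeft 2 ℝ ℝ σ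

theorem permIsometry_apply (σ : Equiv.Perm (Fin 3)) (x : ℝ³) (i : Fin 3) :
    permIsometry σ x (σ i) = x i := by
  simp [permIsometry, LinearIsometryEquiv.piLpCongrLeft]

theorem hasDerivAt_evalAt_axisRotation (σ : Equiv.Perm (Fin 3)) (P : MvPolynomial (Fin 3) ℂ)
    (y : ℝ³) (φ : ℝ) : HasDerivAt (fun s => evalAt (permIsometry σ (axisRotation s y)) P)
      (evalAt (permIsometry σ (axisRotation φ y)) (angularDeriv (σ 0) (σ 1) P)) φ := by
  have hsin := (Real.hasDerivAt_sin φ).ofReal_comp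
  have hcos := (Real.hasDerivAt_cos φ).ofReal_comp
  have hd : ∀ i, HasDerivAt (fun s : ℝ => ((axisRotation s y i : ℝ) : ℂ))
      ((![-(axisRotation φ y 1 : ℝ), axisRotation φ y 0, 0] i : ℝ) : ℂ) φ := by
    intro i
    fin_cases i
    · simpa [axisRotation_apply, sub_eq_add_neg, add_comm] using
        (hcos.mul_const (y 0 : ℂ)).fun_sub (hsin.mul_const (y 1 : ℂ))
    · simpa [axisRotation_apply, sub_eq_add_neg, add_comm] using
        (hsin.mul_const (y 0 : ℂ)).fun_add (hcos.mul_const (y 1 : ℂ))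
    · simpa [axisRotation_apply] using hasDerivAt_const φ ((y 2 : ℝ) : ℂ)
  have hd' : ∀ i, HasDerivAt (fun s : ℝ => ((permIsometry σ (axisRotation s y) i : ℝ) : ℂ))
      ((![-(axisRotation φ y 1 : ℝ), axisRotation φ y 0, 0] (σ.symm i) : ℝ) : ℂ) φ := by
    intro i
    have key : ∀ w : ℝ³, permIsometry σ w i = w (σ.symm i) := fun w => by
      have := permIsometry_apply σ w (σ.symm i)
      rwa [Equiv.apply_symm_apply] at this
    simp only [key]
    exact hd _
  simp only [evalAt_eq]
  refine (hasDerivAt_eval (γ := fun i s => ((permIsometry σ (axisRotation s y) i : ℝ) : ℂ))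
    (γ' := fun i s => ((![-(axisRotation s y 1 : ℝ), axisRotation s y 0, 0] (σ.symm i) : ℝ) : ℂ))
    hd' P).congr_deriv ?_
  rw [← Equiv.sum_comp σ, Fin.sum_univ_three]
  simp only [Equiv.symm_apply_apply, angularDeriv, map_sub, map_mul, eval_X, permIsometry_apply]
  simp
  ring

theorem rotate_permIsometry_angularDeriv {ι : Type*} (s : Finset ι) (m : ι → ℤ)
    (g : ι → C(𝕊², ℂ)) (hg : ∀ i ∈ s, IsWeightFunction (m i) (g i)) (σ : Equiv.Perm (Fin 3))
    (P : MvPolynomial (Fin 3) ℂ) (c : ι → ℂ)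
    (h : rotate (permIsometry σ) (restrictSphere P) = ∑ i ∈ s, c i • g i) :
    rotate (permIsometry σ) (restrictSphere (angularDeriv (σ 0) (σ 1) P)) =
      ∑ i ∈ s, (m i * Complex.I * c i) • g i := by
  ext y
  have e : ∀ t : ℝ, evalAt (permIsometry σ (axisRotation t y)) P =
      ∑ i ∈ s, c i * (Complex.exp (m i * t * Complex.I) * g i y) := by
    intro t
    have := DFunLike.congr_fun h (sphereMap (axisRotation t) y)
    simp only [rotate_apply, restrictSphere_apply, coe_sphereMap, ContinuousMap.sum_apply,
      ContinuousMap.smul_apply, smul_eq_mul] at this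
    rw [this]
    exact Finset.sum_congr rfl fun i hi => by rw [hg i hi]
  have h1 := hasDerivAt_evalAt_axisRotation σ P y 0
  rw [funext e] at h1
  have h2 : HasDerivAt (fun t : ℝ => ∑ i ∈ s, c i * (Complex.exp (m i * t * Complex.I) * g i y))
      (∑ i ∈ s, c i * (Complex.exp (m i * (0 : ℝ) * Complex.I) *
        (m i * 1 * Complex.I) * g i y)) 0 := by
    refine HasDerivAt.fun_sum fun i _ => HasDerivAt.const_mul _ (HasDerivAt.mul_const ?_ _)
    have h0 : HasDerivAt (fun t : ℝ => (t : ℂ)) 1 0 := Complex.ofRealCLM.hasDerivAt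
    exact ((h0.const_mul (m i : ℂ)).mul_const Complex.I).cexp
  have h3 := h1.unique h2
  have h4 : axisRotation 0 (y : ℝ³) = y := by
    have := congrArg Subtype.val (sphereMap_axisRotation_zero y)
    simpa using this
  rw [h4] at h3
  simp only [rotate_apply, restrictSphere_apply, coe_sphereMap, ContinuousMap.sum_apply,
      ContinuousMap.smul_apply, smul_eq_mul]
  rw [h3]
  refine Finset.sum_congr rfl fun i _ => ?_
  simp
  ring

theorem sphereNormSq_sub_fejerAverage_le {k n : ℕ} (hn : 0 < n) (hnk : n ≤ k + 1)
    {P : MvPolynomial (Fin 3) ℂ} (hP : P ∈ solidHarmonic k) (σ : Equiv.Perm (Fin 3)) :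
    n ^ 2 * sphereNormSq (rotate (permIsometry σ) (restrictSphere P) -
        fejerAverage k n (rotate (permIsometry σ) (restrictSphere P))) ≤
      -(spherePair (restrictSphere P)
        (restrictSphere (angularDeriv (σ 0) (σ 1) (angularDeriv (σ 0) (σ 1) P)))).re := by
  obtain ⟨g, -, hgw, hg⟩ := exists_weight_decomposition
    (rotate_mem (permIsometry σ) (mem_sphericalHarmonic.2 ⟨P, hP, restrictSphere_apply P⟩))
  have hg1 : rotate (permIsometry σ) (restrictSphere P) =
      ∑ i ∈ Finset.range (2 * k + 1), (1 : ℂ) • g i := by simpa using hg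
  have hL := rotate_permIsometry_angularDeriv _ (fun i : ℕ => (i - k : ℤ)) g hgw σ _ _
    (rotate_permIsometry_angularDeriv _ (fun i : ℕ => (i - k : ℤ)) g hgw σ _ _ hg1)
  rw [← spherePair_rotate (permIsometry σ), hL, spherePair_sum_smul]
  have hsp : ∀ i ∈ Finset.range (2 * k + 1),
      spherePair (rotate (permIsometry σ) (restrictSphere P)) (g i) = sphereNormSq (g i) := by
    intro i hi
    rw [hg1, sum_smul_spherePair, Finset.sum_eq_single i, spherePair_self]
    · simp
    · intro j hj hji
      rw [(hgw j hj).spherePair_eq_zero (by simpa using hji) (hgw i hi), mul_zero]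
    · exact fun h => absurd hi h
  rw [Finset.sum_congr rfl fun i hi => by rw [hsp i hi], Complex.re_sum, ← Finset.sum_neg_distrib,
    hg, fejerAverage_sum_weight hnk hgw, ← Finset.sum_sub_distrib]
  have hsub : ∀ i, g i - (fejerCoeff n (i - k) : ℂ) • g i
      = ((1 - fejerCoeff n (i - k) : ℝ) : ℂ) • g i := fun i => by
    ext x
    simp [sub_mul]
  rw [Finset.sum_congr rfl fun i _ => hsub i, sphereNormSq_sum_weight hgw, Finset.mul_sum]
  refine Finset.sum_le_sum fun i _ => ?_
  have hre : -((((i - k : ℤ) : ℂ) * Complex.I * (((i - k : ℤ) : ℂ) * Complex.I * 1)) *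
      (sphereNormSq (g i) : ℂ)).re = ((i - k : ℤ) : ℝ) ^ 2 * sphereNormSq (g i) := by
    have : (((i - k : ℤ) : ℂ) * Complex.I * (((i - k : ℤ) : ℂ) * Complex.I * 1)) *
      (sphereNormSq (g i) : ℂ) = ((-(((i - k : ℤ) : ℝ) ^ 2 * sphereNormSq (g i)) : ℝ) : ℂ) := by
      push_cast
      linear_combination ((i : ℂ) - k) ^ 2 * (sphereNormSq (g i) : ℂ) * Complex.I_sq
    rw [this, Complex.ofReal_re, neg_neg]
  rw [hre, ← mul_assoc, Complex.norm_real, Real.norm_eq_abs,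
    abs_of_nonneg (sub_nonneg.2 (fejerCoeff_le_one _ _))]
  refine mul_le_mul_of_nonneg_right ?_ (sphereNormSq_nonneg _)
  have h := one_sub_fejerCoeff_le hn (i - k : ℤ)
  rw [le_div_iff₀ (by exact_mod_cast hn)] at h
  rw [← mul_pow, ← sq_abs ((i - k : ℤ) : ℝ), mul_comm (n : ℝ)]
  exact pow_le_pow_left₀ (mul_nonneg (sub_nonneg.2 (fejerCoeff_le_one _ _)) (by positivity)) h 2

theorem sum_energy {k : ℕ} {P : MvPolynomial (Fin 3) ℂ} (hP : P ∈ solidHarmonic k) :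
    -(spherePair (restrictSphere P) (restrictSphere (angularDeriv 0 1 (angularDeriv 0 1 P)))).re +
      -(spherePair (restrictSphere P)
        (restrictSphere (angularDeriv 1 2 (angularDeriv 1 2 P)))).re +
      -(spherePair (restrictSphere P)
        (restrictSphere (angularDeriv 2 0 (angularDeriv 2 0 P)))).re =
      k * (k + 1) * sphereNormSq (restrictSphere P) := by
  have h : ∑ i : Fin 3, (1 : ℂ) • restrictSphere (![angularDeriv 0 1 (angularDeriv 0 1 P),
      angularDeriv 1 2 (angularDeriv 1 2 P), angularDeriv 2 0 (angularDeriv 2 0 P)] i) =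
      ∑ i : Fin 1, (-(k * (k + 1)) : ℂ) • restrictSphere P := by
    ext x
    simpa [Fin.sum_univ_three, restrictSphere_apply] using sum_angularDeriv hP x
  have h2 := congrArg (fun g => (spherePair (restrictSphere P) g).re) h
  simp only [spherePair_sum_smul, spherePair_self] at h2
  simp [Fin.sum_univ_three] at h2
  linarith

/-- One of the first two coordinate axes carries at most half of the angular energy. -/
theorem exists_sphereNormSq_sub_fejerAverage_le {k : ℕ} (hk : 20 ≤ k) {f : C(𝕊², ℂ)}
    (hf : f ∈ sphericalHarmonic k) : ∃ σ : Equiv.Perm (Fin 3), (σ 2 = 0 ∨ σ 2 = 1) ∧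
      sphereNormSq (rotate (permIsometry σ) f -
        fejerAverage k ((3 * k + 3) / 4) (rotate (permIsometry σ) f)) ≤
          (49 / 50) ^ 2 * sphereNormSq f := by
  obtain ⟨P, hP, rfl⟩ : ∃ P ∈ solidHarmonic k, restrictSphere P = f := hf
  have hn : 0 < (3 * k + 3) / 4 := by omega
  have hnk : (3 * k + 3) / 4 ≤ k + 1 := by omega
  have h0 := sphereNormSq_sub_fejerAverage_le hn hnk hP 1
  have h1 := sphereNormSq_sub_fejerAverage_le hn hnk hP (finRotate 3)
  have h2 := sphereNormSq_sub_fejerAverage_le hn hnk hP (finRotate 3 ^ 2)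
  rw [show (finRotate 3) 0 = 1 by decide, show (finRotate 3) 1 = 2 by decide] at h1
  rw [show (finRotate 3 ^ 2) 0 = 2 by decide, show (finRotate 3 ^ 2) 1 = 0 by decide] at h2
  have hE := sum_energy hP
  have h0' := (mul_nonneg (by positivity) (sphereNormSq_nonneg _)).trans h0
  simp only [Equiv.Perm.one_apply] at h0'
  have hk' : (20 : ℝ) ≤ k := by exact_mod_cast hk
  have hn4 : (3 * k : ℝ) ≤ 4 * ((3 * k + 3) / 4 : ℕ) := by
    have : 3 * k ≤ 4 * ((3 * k + 3) / 4) := by omega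
    exact_mod_cast this
  set N : ℝ := (((3 * k + 3) / 4 : ℕ) : ℝ)
  set Q := sphereNormSq (restrictSphere P) with hQ
  have hQ0 : 0 ≤ Q := sphereNormSq_nonneg _
  have hN2 : (3 * k : ℝ) ^ 2 ≤ (4 * N) ^ 2 := pow_le_pow_left₀ (by positivity) hn4 2
  have hlam : k * (k + 1) * Q / 2 ≤ N ^ 2 * ((49 / 50) ^ 2 * Q) := by
    have : (k * (k + 1) / 2 : ℝ) ≤ N ^ 2 * (49 / 50) ^ 2 := by nlinarith
    nlinarith [mul_le_mul_of_nonneg_right this hQ0]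
  have hNpos : 0 < N ^ 2 := by nlinarith
  rcases le_total (-(spherePair (restrictSphere P)
      (restrictSphere (angularDeriv 1 2 (angularDeriv 1 2 P)))).re) (k * (k + 1) * Q / 2) with h | h
  · exact ⟨finRotate 3, Or.inl (by decide),
      le_of_mul_le_mul_left ((h1.trans h).trans hlam) hNpos⟩
  · exact ⟨finRotate 3 ^ 2, Or.inr (by decide),
      le_of_mul_le_mul_left ((h2.trans (by linarith)).trans hlam) hNpos⟩

theorem setLIntegral_comp_sphereMap_symm (R : ℝ³ ≃ₗᵢ[ℝ] ℝ³) (U : Set 𝕊²) (g : 𝕊² → ℝ≥0∞) :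
    ∫⁻ x in U, g (sphereMap R.symm x) ∂sphereMeasure =
      ∫⁻ x in sphereMap R ⁻¹' U, g x ∂sphereMeasure := by
  rw [← (measurePreserving_sphereMap R).setLIntegral_comp_preimage_emb
    (measurableEmbedding_sphereMap R)]
  simp only [sphereMap_symm_apply]

theorem eLpNorm_six_eq {α : Type*} [MeasurableSpace α] (μ : Measure α) (f : α → ℂ) :
    eLpNorm f 6 μ = (∫⁻ x, ‖f x‖ₑ ^ 6 ∂μ) ^ (1 / 6 : ℝ) := by
  rw [eLpNorm_eq_lintegral_rpow_enorm_toReal (by norm_num) (by norm_num)]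
  simp only [ENNReal.toReal_ofNat]
  congr 2
  ext x
  exact_mod_cast ENNReal.rpow_natCast ‖f x‖ₑ 6

theorem exists_eLpNorm_fejerAverage_le : ∃ C : ℝ, 0 < C ∧ ∀ k : ℕ, 20 ≤ k →
    ∀ f ∈ sphericalHarmonic k, eLpNorm (fejerAverage k ((3 * k + 3) / 4) f) 6
      (sphereMeasure.restrict {x : 𝕊² | |(x : ℝ³) 2| ≤ 1 / 2}) ≤
        ENNReal.ofReal ((C * k) ^ (1 / 6 : ℝ) * √(sphereNormSq f)) := by
  obtain ⟨C, hC, h⟩ := exists_lintegral_fejerAverage_pow_six_le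
  refine ⟨C + C, by positivity, fun k hk f hf => ?_⟩
  have hQ := sphereNormSq_nonneg f
  have h1 := h k hk f hf (Set.Icc 0 (1 / 2)) measurableSet_Icc
    (fun t ht => abs_le.2 ⟨by linarith [ht.1], ht.2⟩) fun s hs t ht => mul_nonneg hs.1 ht.1
  have h2 := h k hk f hf (Set.Icc (-(1 / 2)) 0) measurableSet_Icc
    (fun t ht => abs_le.2 ⟨ht.1, by linarith [ht.2]⟩) fun s hs t ht =>
      mul_nonneg_of_nonpos_of_nonpos hs.2 ht.2
  have hsub : {x : 𝕊² | |(x : ℝ³) 2| ≤ 1 / 2} ⊆ {x : 𝕊² | (x : ℝ³) 2 ∈ Set.Icc (0 : ℝ) (1 / 2)} ∪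
      {x : 𝕊² | (x : ℝ³) 2 ∈ Set.Icc (-(1 / 2) : ℝ) 0} := by
    intro x hx
    rw [Set.mem_ofPred_eq, abs_le] at hx
    rcases le_total 0 ((x : ℝ³) 2) with h0 | h0
    · exact Or.inl ⟨h0, hx.2⟩
    · exact Or.inr ⟨hx.1, h0⟩
  have h3 := (lintegral_mono_set hsub).trans ((lintegral_union_le
    (fun x => ‖fejerAverage k ((3 * k + 3) / 4) f x‖ₑ ^ 6) _ _).trans (add_le_add h1 h2))
  rw [← ENNReal.ofReal_add (by positivity) (by positivity), ← add_mul, ← add_mul] at h3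
  rw [eLpNorm_six_eq]
  refine (ENNReal.rpow_le_rpow h3 (by norm_num)).trans_eq ?_
  rw [ENNReal.ofReal_rpow_of_nonneg (by positivity) (by norm_num),
    Real.mul_rpow (by positivity) (by positivity), ← Real.rpow_natCast, ← Real.rpow_mul hQ,
    Real.sqrt_eq_rpow]
  norm_num

theorem exists_eLpNorm_six_le (k : ℕ) (μ : Measure 𝕊²) [IsFiniteMeasure μ] :
    ∃ D : ℝ, 0 ≤ D ∧ ∀ f ∈ sphericalHarmonic k,
      eLpNorm f 6 μ ≤ ENNReal.ofReal (D * √(sphereNormSq f)) := by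
  obtain ⟨C, hC, h⟩ := exists_norm_sq_le_of_mem_sphericalHarmonic
  refine ⟨(μ Set.univ ^ (1 / 6 : ℝ)).toReal * √(C * (1 + k)), by positivity, fun f hf => ?_⟩
  have hb : ∀ x, ‖f x‖ ≤ √(C * (1 + k)) * √(sphereNormSq f) := fun x => by
    rw [← Real.sqrt_mul (by positivity)]
    exact Real.le_sqrt_of_sq_le (h k f hf x)
  refine (eLpNorm_le_of_ae_bound (ae_of_all _ hb)).trans_eq ?_
  rw [mul_assoc, ENNReal.ofReal_mul ENNReal.toReal_nonneg, ENNReal.ofReal_toReal (by finiteness)]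
  norm_num

/-- The points of the sphere at height at most `1 / 2` along the first two axes. -/
def twoBand : Set 𝕊² := {x | |(x : ℝ³) 0| ≤ 1 / 2 ∧ |(x : ℝ³) 1| ≤ 1 / 2}

theorem exists_eLpNorm_twoBand_le : ∃ C : ℝ, 0 < C ∧ ∀ k : ℕ, 20 ≤ k →
    ∀ f ∈ sphericalHarmonic k, eLpNorm f 6 (sphereMeasure.restrict twoBand) ≤
        ENNReal.ofReal (50 * (C * k) ^ (1 / 6 : ℝ) * √(sphereNormSq f)) := by
  obtain ⟨C, hC, h⟩ := exists_eLpNorm_fejerAverage_le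
  refine ⟨C, hC, fun k hk => ?_⟩
  obtain ⟨D, hD, hDb⟩ := exists_eLpNorm_six_le k (sphereMeasure.restrict twoBand)
  set B := (C * k) ^ (1 / 6 : ℝ) with hB
  have hB0 : 0 ≤ B := by positivity
  have key : ∀ N : ℕ, ∀ f ∈ sphericalHarmonic k, eLpNorm f 6 (sphereMeasure.restrict twoBand) ≤
      ENNReal.ofReal ((50 * B + (49 / 50) ^ N * D) * √(sphereNormSq f)) := by
    intro N
    induction N with
    | zero =>
      intro f hf
      refine (hDb f hf).trans (ENNReal.ofReal_le_ofReal ?_)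
      refine mul_le_mul_of_nonneg_right ?_ (Real.sqrt_nonneg _)
      rw [pow_zero]
      linarith
    | succ N ih =>
      intro f hf
      obtain ⟨σ, hσ, hr⟩ := exists_sphereNormSq_sub_fejerAverage_le hk hf
      set R := permIsometry σ with hR
      set n := (3 * k + 3) / 4 with hn
      have hm := rotate_mem R hf
      have hVm := fejerAverage_mem n hm
      set r := rotate R f - fejerAverage k n (rotate R f) with hrd
      have hdec : f = rotate R.symm (fejerAverage k n (rotate R f)) + rotate R.symm r := by
        rw [← map_add, hrd, add_sub_cancel]
        ext x
        simp [rotate_apply, sphereMap_apply_symm]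
      have hrm : rotate R.symm r ∈ sphericalHarmonic k :=
        rotate_mem _ (Submodule.sub_mem _ hm hVm)
      have h1 : eLpNorm (rotate R.symm (fejerAverage k n (rotate R f))) 6
          (sphereMeasure.restrict twoBand) ≤ ENNReal.ofReal (B * √(sphereNormSq f)) := by
        have := h k hk _ hm
        rw [sphereNormSq_rotate] at this
        refine le_trans ?_ this
        rw [eLpNorm_six_eq, eLpNorm_six_eq]
        refine ENNReal.rpow_le_rpow ?_ (by norm_num)
        simp only [rotate_apply]
        rw [setLIntegral_comp_sphereMap_symm R twoBand
          fun x => ‖fejerAverage k n (rotate R f) x‖ₑ ^ 6]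
        refine lintegral_mono_set fun x hx => ?_
        have hx2 := permIsometry_apply σ (x : ℝ³) 2
        rw [Set.mem_ofPred_eq, ← hx2]
        rcases hσ with e | e <;> rw [e]
        exacts [hx.1, hx.2]
      have h2 := ih _ hrm
      rw [sphereNormSq_rotate] at h2
      have h3 : √(sphereNormSq r) ≤ 49 / 50 * √(sphereNormSq f) := by
        refine (Real.sqrt_le_sqrt hr).trans_eq ?_
        rw [Real.sqrt_mul (by positivity), Real.sqrt_sq (by norm_num)]
      have h4 : eLpNorm f 6 (sphereMeasure.restrict twoBand) ≤
          eLpNorm (rotate R.symm (fejerAverage k n (rotate R f))) 6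
            (sphereMeasure.restrict twoBand) +
          eLpNorm (rotate R.symm r) 6 (sphereMeasure.restrict twoBand) := by
        conv_lhs => rw [hdec, ContinuousMap.coe_add]
        exact eLpNorm_add_le (ContinuousMap.continuous _).aestronglyMeasurable
          (ContinuousMap.continuous _).aestronglyMeasurable (by norm_num)
      refine (h4.trans (add_le_add h1 h2)).trans ?_
      rw [← ENNReal.ofReal_add (by positivity) (by positivity)]
      refine ENNReal.ofReal_le_ofReal ?_
      have := mul_le_mul_of_nonneg_left h3 (show 0 ≤ 50 * B + (49 / 50) ^ N * D by positivity)
      rw [pow_succ]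
      linarith
  intro f hf
  refine ge_of_tendsto' (x := Filter.atTop) (ENNReal.tendsto_ofReal ?_) fun N => key N f hf
  have := ((tendsto_pow_atTop_nhds_zero_of_lt_one (by norm_num) (by norm_num :
    (49 / 50 : ℝ) < 1)).mul_const D).const_add (50 * B) |>.mul_const (√(sphereNormSq f))
  simpa using this

theorem exists_twoBand_cover : ∃ t : Finset (ℝ³ ≃ₗᵢ[ℝ] ℝ³),
    ⋃ R ∈ t, sphereMap R ⁻¹' twoBand = Set.univ := by
  classical
  choose R hR using fun x => exists_sphereMap_eq x northPole
  set O : Set 𝕊² := {x | |(x : ℝ³) 0| < 1 / 2 ∧ |(x : ℝ³) 1| < 1 / 2} with hO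
  have hOo : IsOpen O := by
    refine IsOpen.and ?_ ?_ <;> exact isOpen_lt (by fun_prop) continuous_const
  have hOn : northPole ∈ O := by
    simp [hO, northPole]
  obtain ⟨t, ht⟩ := isCompact_univ.elim_finite_subcover (fun x => sphereMap (R x) ⁻¹' O)
    (fun x => hOo.preimage (continuous_sphereMap _))
    fun x _ => Set.mem_iUnion.2 ⟨x, by rw [Set.mem_preimage, hR]; exact hOn⟩
  refine ⟨t.image R, Set.eq_univ_of_univ_subset (ht.trans ?_)⟩
  rw [Finset.set_biUnion_finset_image]
  exact Set.iUnion₂_mono fun x _ => Set.preimage_mono fun y hy => ⟨hy.1.le, hy.2.le⟩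

theorem exists_lintegral_pow_six_le : ∃ C : ℝ, 0 < C ∧ ∀ k : ℕ, ∀ f ∈ sphericalHarmonic k,
    ∫⁻ x, ‖f x‖ₑ ^ 6 ∂sphereMeasure ≤ ENNReal.ofReal (C * (1 + k) * sphereNormSq f ^ 3) := by
  obtain ⟨C, hC, h⟩ := exists_eLpNorm_twoBand_le
  obtain ⟨C₁, hC₁, h₁⟩ := exists_norm_sq_le_of_mem_sphericalHarmonic
  obtain ⟨t, ht⟩ := exists_twoBand_cover
  set m := sphereMeasure.real Set.univ with hm
  refine ⟨t.card * (50 ^ 6 * C) + 400 * C₁ ^ 3 * m + 1, by positivity, fun k f hf => ?_⟩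
  have hQ := sphereNormSq_nonneg f
  rcases lt_or_ge k 20 with hk | hk
  · have hb : ∀ x, ‖f x‖ₑ ^ 6 ≤ ENNReal.ofReal ((C₁ * (1 + k) * sphereNormSq f) ^ 3) := fun x => by
      rw [← ofReal_norm, ← ENNReal.ofReal_pow (norm_nonneg _)]
      refine ENNReal.ofReal_le_ofReal ?_
      rw [show 6 = 2 * 3 by rfl, pow_mul]
      exact pow_le_pow_left₀ (by positivity) (h₁ k f hf x) 3
    refine (lintegral_mono hb).trans ?_
    rw [lintegral_const, ← ofReal_measureReal, ← hm, ← ENNReal.ofReal_mul (by positivity)]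
    refine ENNReal.ofReal_le_ofReal ?_
    have hk' : (1 + k : ℝ) ≤ 20 := by
      have : 1 + k ≤ 20 := by omega
      exact_mod_cast this
    have hk2 : (1 + k : ℝ) ^ 2 ≤ 20 ^ 2 := pow_le_pow_left₀ (by positivity) hk' 2
    calc (C₁ * (1 + k) * sphereNormSq f) ^ 3 * m
        = (1 + k) ^ 2 * (C₁ ^ 3 * m * (1 + k) * sphereNormSq f ^ 3) := by ring
      _ ≤ 20 ^ 2 * (C₁ ^ 3 * m * (1 + k) * sphereNormSq f ^ 3) := by gcongr
      _ = (400 * C₁ ^ 3 * m) * ((1 + k) * sphereNormSq f ^ 3) := by ring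
      _ ≤ (t.card * (50 ^ 6 * C) + 400 * C₁ ^ 3 * m + 1) * ((1 + k) * sphereNormSq f ^ 3) := by
        gcongr
        have : 0 ≤ (t.card : ℝ) * (50 ^ 6 * C) := by positivity
        linarith
      _ = _ := by ring
  · have hU : ∀ g ∈ sphericalHarmonic k, ∫⁻ x in twoBand, ‖g x‖ₑ ^ 6 ∂sphereMeasure ≤
        ENNReal.ofReal (50 ^ 6 * (C * k) * sphereNormSq g ^ 3) := by
      intro g hg
      have hQ := sphereNormSq_nonneg g
      have := pow_le_pow_left' (h k hk g hg) 6
      rw [eLpNorm_six_eq, ← ENNReal.ofReal_pow (by positivity), ← ENNReal.rpow_mul_natCast,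
        mul_pow, mul_pow, ← Real.rpow_mul_natCast (by positivity),
        show √(sphereNormSq g) ^ 6 = (√(sphereNormSq g) ^ 2) ^ 3 by ring, Real.sq_sqrt hQ] at this
      norm_num at this ⊢
      exact this
    calc ∫⁻ x, ‖f x‖ₑ ^ 6 ∂sphereMeasure
        = ∫⁻ x in ⋃ R ∈ t, sphereMap R ⁻¹' twoBand, ‖f x‖ₑ ^ 6 ∂sphereMeasure := by
          rw [ht, setLIntegral_univ]
      _ ≤ ∑ R ∈ t, ∫⁻ x in sphereMap R ⁻¹' twoBand, ‖f x‖ₑ ^ 6 ∂sphereMeasure := by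
          rw [show ⋃ R ∈ t, sphereMap R ⁻¹' twoBand = ⋃ R : t, sphereMap R.1 ⁻¹' twoBand by
            ext; simp, ← Finset.sum_coe_sort]
          exact (lintegral_iUnion_le _ _).trans_eq (tsum_fintype _)
      _ ≤ ∑ R ∈ t, ENNReal.ofReal (50 ^ 6 * (C * k) * sphereNormSq f ^ 3) := by
          refine Finset.sum_le_sum fun R _ => ?_
          rw [← setLIntegral_comp_sphereMap_symm R twoBand fun x => ‖f x‖ₑ ^ 6]
          have := hU _ (rotate_mem R.symm hf)
          rwa [sphereNormSq_rotate] at this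
      _ = ENNReal.ofReal (t.card * (50 ^ 6 * (C * k) * sphereNormSq f ^ 3)) := by
          rw [Finset.sum_const, nsmul_eq_mul, ENNReal.ofReal_mul (Nat.cast_nonneg _),
            ENNReal.ofReal_natCast]
      _ ≤ _ := by
        refine ENNReal.ofReal_le_ofReal ?_
        calc t.card * (50 ^ 6 * (C * k) * sphereNormSq f ^ 3)
            = t.card * (50 ^ 6 * C) * (k * sphereNormSq f ^ 3) := by ring
          _ ≤ (t.card * (50 ^ 6 * C) + 400 * C₁ ^ 3 * m + 1) *
              ((1 + k) * sphereNormSq f ^ 3) := by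
            gcongr
            · have : 0 ≤ 400 * C₁ ^ 3 * m := by positivity
              linarith
            · linarith
          _ = _ := by ring

theorem eLpNorm_two_eq_sqrt_sphereNormSq (f : C(𝕊², ℂ)) :
    eLpNorm f 2 sphereMeasure = ENNReal.ofReal √(sphereNormSq f) := by
  have hi : Integrable (fun x => ‖f x‖ ^ 2) sphereMeasure :=
    (f.continuous.norm.pow 2).integrable_of_hasCompactSupport (HasCompactSupport.of_compactSpace _)
  rw [eLpNorm_eq_lintegral_rpow_enorm_toReal (by norm_num) (by norm_num), ENNReal.toReal_ofNat,
    Real.sqrt_eq_rpow, ← ENNReal.ofReal_rpow_of_nonneg (sphereNormSq_nonneg f) (by norm_num),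
    sphereNormSq, ofReal_integral_eq_lintegral_ofReal hi (ae_of_all _ fun _ => by positivity)]
  congr 2
  ext x
  rw [ENNReal.ofReal_pow (norm_nonneg _), ofReal_norm]
  exact_mod_cast ENNReal.rpow_natCast ‖f x‖ₑ 2

theorem eLpNorm_sphere_le {A Q q : ℝ} (hA : 0 ≤ A) (hQ : 0 ≤ Q) (hq : 6 ≤ q) {f : C(𝕊², ℂ)}
    (hsup : ∀ x, ‖f x‖ ^ 2 ≤ A * Q)
    (hsix : ∫⁻ x, ‖f x‖ₑ ^ 6 ∂sphereMeasure ≤ ENNReal.ofReal (A * Q ^ 3)) :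
    eLpNorm f (ENNReal.ofReal q) sphereMeasure ≤
      ENNReal.ofReal (A ^ (1 / 2 - 2 / q) * √Q) := by
  have hq0 : 0 < q := by linarith
  rw [eLpNorm_eq_lintegral_rpow_enorm_toReal (by simpa using hq0) ENNReal.ofReal_ne_top,
    ENNReal.toReal_ofReal hq0.le]
  have hpt : ∀ x, ‖f x‖ₑ ^ q ≤ ENNReal.ofReal ((A * Q) ^ ((q - 6) / 2)) * ‖f x‖ₑ ^ 6 := fun x => by
    rw [← ofReal_norm, ENNReal.ofReal_rpow_of_nonneg (norm_nonneg _) hq0.le,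
      ← ENNReal.ofReal_pow (norm_nonneg _), ← ENNReal.ofReal_mul (by positivity)]
    refine ENNReal.ofReal_le_ofReal ?_
    have e : ‖f x‖ ^ q = (‖f x‖ ^ 2) ^ ((q - 6) / 2) * ‖f x‖ ^ 6 := by
      rw [← Real.rpow_natCast, ← Real.rpow_natCast, ← Real.rpow_mul (norm_nonneg _),
        ← Real.rpow_add_of_nonneg (norm_nonneg _) (by push_cast; linarith) (by positivity)]
      congr 1
      push_cast
      ring
    rw [e]
    exact mul_le_mul_of_nonneg_right (Real.rpow_le_rpow (by positivity) (hsup x) (by linarith))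
      (by positivity)
  have hintg : ∫⁻ x, ‖f x‖ₑ ^ q ∂sphereMeasure ≤
      ENNReal.ofReal ((A * Q) ^ ((q - 6) / 2) * (A * Q ^ 3)) := by
    refine (lintegral_mono hpt).trans ?_
    rw [lintegral_const_mul' _ _ ENNReal.ofReal_ne_top, ENNReal.ofReal_mul (by positivity)]
    exact mul_le_mul_right hsix _
  refine (ENNReal.rpow_le_rpow hintg (by positivity)).trans_eq ?_
  rw [ENNReal.ofReal_rpow_of_nonneg (by positivity) (by positivity)]
  congr 1
  have e1 : A ^ ((q - 6) / 2) * A = A ^ (q / 2 - 2) := by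
    conv_lhs => rw [← Real.rpow_one A, ← Real.rpow_mul hA, one_mul]
    rw [← Real.rpow_add_of_nonneg hA (by linarith) (by norm_num)]
    congr 1
    ring
  have e2 : Q ^ ((q - 6) / 2) * Q ^ 3 = Q ^ (q / 2) := by
    rw [← Real.rpow_natCast, ← Real.rpow_add_of_nonneg hQ (by linarith) (by positivity)]
    congr 1
    push_cast
    ring
  rw [Real.mul_rpow hA hQ, mul_mul_mul_comm, e1, e2, Real.mul_rpow (by positivity) (by positivity),
    ← Real.rpow_mul hA, ← Real.rpow_mul hQ, Real.sqrt_eq_rpow]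
  congr 2 <;> field_simp

/-- Sogge's `L^p` eigenfunction estimate on `S²` in the range `6 ≤ p ≤ ∞`:
`‖f‖_{L^p(S²)} ≤ C (1+k)^{2(1/4 − 1/p)} ‖f‖_{L²(S²)}` for `f ∈ ℋ_k`; for `p = ∞` the
left-hand side is the essential supremum of `|f|` and the exponent is `1/2`. -/
theorem sogge_Lp_estimate_high (p : ℝ≥0∞) (hp6 : 6 ≤ p) :
    ∃ C : ℝ, 0 < C ∧ ∀ (k : ℕ) (f : sphere (0 : EuclideanSpace ℝ (Fin 3)) 1 → ℂ),
      IsSphericalHarmonic k f →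
      eLpNorm f p sphereMeasure ≤
        ENNReal.ofReal (C * (1 + (k : ℝ)) ^ (2 * ((1 : ℝ) / 4 - (1 / p).toReal))) *
          eLpNorm f 2 sphereMeasure := by
  obtain ⟨C₁, hC₁, h₁⟩ := exists_norm_sq_le_of_mem_sphericalHarmonic
  obtain ⟨C₂, hC₂, h₂⟩ := exists_lintegral_pow_six_le
  refine ⟨(max C₁ C₂) ^ (2 * ((1 : ℝ) / 4 - (1 / p).toReal)), by positivity, fun k f hf => ?_⟩
  obtain ⟨F, hF, rfl⟩ := hf.exists_mem
  have hQ := sphereNormSq_nonneg F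
  have hsup : ∀ x, ‖F x‖ ^ 2 ≤ max C₁ C₂ * (1 + k) * sphereNormSq F := fun x =>
    (h₁ k F hF x).trans (by gcongr; exact le_max_left _ _)
  rw [eLpNorm_two_eq_sqrt_sphereNormSq, ← Real.mul_rpow (by positivity) (by positivity),
    ← ENNReal.ofReal_mul (by positivity)]
  rcases eq_or_ne p ∞ with rfl | hp
  · rw [eLpNorm_exponent_top]
    refine eLpNormEssSup_le_of_ae_bound (ae_of_all _ fun x => ?_)
    have e : (2 * ((1 : ℝ) / 4 - (1 / (∞ : ℝ≥0∞)).toReal)) = 1 / 2 := by norm_num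
    rw [e, ← Real.sqrt_eq_rpow, ← Real.sqrt_mul (by positivity)]
    exact Real.le_sqrt_of_sq_le (hsup x)
  · have hq : 6 ≤ p.toReal := by
      have := ENNReal.toReal_mono hp hp6
      simpa using this
    have h := eLpNorm_sphere_le (A := max C₁ C₂ * (1 + k)) (by positivity) hQ hq hsup
      ((h₂ k F hF).trans (ENNReal.ofReal_le_ofReal (by gcongr; exact le_max_right _ _)))
    rw [ENNReal.ofReal_toReal hp] at h
    refine h.trans_eq ?_
    rw [one_div p, ENNReal.toReal_inv]
    congr 3
    ring
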